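/- arXiv:2010.05799 — 2 statements merged into one kernel-verified Lean document; each statement's English description precedes it below -/
import Mathlib

section
/- Let r, p, d ∈ ℕ. Every graph of TM(r,p,d) is MSO-pseudo-finite: for every G ∈ TM(r,p,d) and every MSO sentence φ over the vocabulary {E, P_1,…,P_p} with G ⊨ φ, there exists a finite graph H ∈ TM(r,p,d) that is an induced labeled subgraph of G with H ⊨ φ; moreover, if G is infinite, there exist infinitely many pairwise distinct finite induced labeled subgraphs of G, each belonging to TM(r,p,d) and each satisfying φ. -/
open Cardinal

/-- The tower function: `tower 0 n = n`, `tower (d+1) n = 2 ^ tower d n`. -/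
def tower : ℕ → ℕ → ℕ
  | 0, n => n
  | d + 1, n => 2 ^ tower d n

/-- MSO formulas over the vocabulary consisting of one binary relation symbol `E`
and unary relation symbols indexed by `ι`.  First-order variables and set
variables are both indexed by `ℕ`. -/
inductive MSOForm (ι : Type u) : Type u
  | fal : MSOForm ι
  | eq : ℕ → ℕ → MSOForm ι
  | edge : ℕ → ℕ → MSOForm ι
  | pred : ι → ℕ → MSOForm ι
  | mem : ℕ → ℕ → MSOForm ι
  | imp : MSOForm ι → MSOForm ι → MSOForm ι
  | exFO : ℕ → MSOForm ι → MSOForm ι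
  | exSO : ℕ → MSOForm ι → MSOForm ι

namespace MSOForm

variable {ι : Type u}

/-- Quantifier rank: the maximum nesting depth of (first- and second-order) quantifiers. -/
def qr : MSOForm ι → ℕ
  | fal => 0
  | eq _ _ => 0
  | edge _ _ => 0
  | pred _ _ => 0
  | mem _ _ => 0
  | imp φ ψ => max φ.qr ψ.qr
  | exFO _ φ => φ.qr + 1
  | exSO _ φ => φ.qr + 1

/-- Free first-order variables. -/
def freeFO : MSOForm ι → Finset ℕ
  | fal => ∅
  | eq i j => {i, j}
  | edge i j => {i, j}
  | pred _ i => {i}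
  | mem i _ => {i}
  | imp φ ψ => φ.freeFO ∪ ψ.freeFO
  | exFO n φ => φ.freeFO.erase n
  | exSO _ φ => φ.freeFO

/-- Free set variables. -/
def freeSO : MSOForm ι → Finset ℕ
  | fal => ∅
  | eq _ _ => ∅
  | edge _ _ => ∅
  | pred _ _ => ∅
  | mem _ X => {X}
  | imp φ ψ => φ.freeSO ∪ ψ.freeSO
  | exFO _ φ => φ.freeSO
  | exSO X φ => φ.freeSO.erase X

/-- A sentence is a formula with no free variables of either kind. -/
def IsSentence (φ : MSOForm ι) : Prop := φ.freeFO = ∅ ∧ φ.freeSO = ∅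

/-- First-order formulas: no set quantification and no set membership. -/
def IsFO : MSOForm ι → Prop
  | fal => True
  | eq _ _ => True
  | edge _ _ => True
  | pred _ _ => True
  | mem _ _ => False
  | imp φ ψ => φ.IsFO ∧ ψ.IsFO
  | exFO _ φ => φ.IsFO
  | exSO _ _ => False

/-- Formulas that do not mention the binary relation symbol `E`
(i.e. formulas over a purely monadic vocabulary). -/
def NoEdge : MSOForm ι → Prop
  | fal => True
  | eq _ _ => True
  | edge _ _ => False
  | pred _ _ => True
  | mem _ _ => True
  | imp φ ψ => φ.NoEdge ∧ ψ.NoEdge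
  | exFO _ φ => φ.NoEdge
  | exSO _ φ => φ.NoEdge

end MSOForm

/-- A structure over the vocabulary with one binary relation `E` and `ι`-indexed
unary predicates: a universe, a binary relation and unary relations. -/
structure MStr (ι : Type u) where
  V : Type
  E : V → V → Prop
  P : ι → V → Prop

namespace MStr

/-- Satisfaction of an MSO formula under first-order and set variable assignments. -/
def Realize {ι : Type u} (M : MStr ι) : MSOForm ι → (ℕ → M.V) → (ℕ → Set M.V) → Prop
  | .fal, _, _ => False
  | .eq i j, v, _ => v i = v j
  | .edge i j, v, _ => M.E (v i) (v j)
  | .pred a i, v, _ => M.P a (v i)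
  | .mem i X, v, s => v i ∈ s X
  | .imp φ ψ, v, s => Realize M φ v s → Realize M ψ v s
  | .exFO n φ, v, s => ∃ x : M.V, Realize M φ (Function.update v n x) s
  | .exSO X φ, v, s => ∃ A : Set M.V, Realize M φ v (Function.update s X A)

/-- A structure satisfies a sentence. -/
def Sat {ι : Type u} (M : MStr ι) (φ : MSOForm ι) : Prop :=
  ∀ (v : ℕ → M.V) (s : ℕ → Set M.V), M.Realize φ v s

/-- `M ≡^MSO_m N` : `M` and `N` agree on all MSO sentences of quantifier rank at most `m`. -/
def MSOEquiv {ι : Type u} (m : ℕ) (M N : MStr ι) : Prop :=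
  ∀ φ : MSOForm ι, φ.IsSentence → φ.qr ≤ m → (M.Sat φ ↔ N.Sat φ)

/-- `M` and `N` agree on all MSO sentences. -/
def MSOEq {ι : Type u} (M N : MStr ι) : Prop :=
  ∀ φ : MSOForm ι, φ.IsSentence → (M.Sat φ ↔ N.Sat φ)

/-- `M ≡^FO_q N` over a purely monadic vocabulary: `M` and `N` agree on all
first-order sentences (not mentioning `E`) of quantifier rank at most `q`. -/
def FOEquiv {ι : Type u} (q : ℕ) (M N : MStr ι) : Prop :=
  ∀ φ : MSOForm ι, φ.IsFO → φ.NoEdge → φ.IsSentence → φ.qr ≤ q → (M.Sat φ ↔ N.Sat φ)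

end MStr

/-- A (finite or infinite) `p`-labeled graph: a simple undirected loop-free graph
each of whose vertices carries exactly one label from `Fin p`. -/
structure PGraph (p : ℕ) where
  V : Type
  adj : V → V → Prop
  symm : ∀ u v, adj u v → adj v u
  irrefl : ∀ v, ¬ adj v v
  label : V → Fin p

namespace PGraph

variable {p : ℕ}

/-- A `p`-labeled graph as a structure over the vocabulary `{E, P_1, …, P_p}`. -/
def toStr (G : PGraph p) : MStr (Fin p) :=
  ⟨G.V, G.adj, fun j v => G.label v = j⟩

/-- The induced labeled subgraph on a set of vertices (with the inherited labels). -/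
def induce (G : PGraph p) (s : Set G.V) : PGraph p where
  V := ↥s
  adj a b := G.adj a.1 b.1
  symm := fun _ _ h => G.symm _ _ h
  irrefl := fun _ h => G.irrefl _ h
  label := fun a => G.label a.1

/-- `G` is an induced labeled subgraph of `H` (up to isomorphism):
there is an injection of `G` into `H` preserving adjacency, non-adjacency and labels. -/
def Emb (G H : PGraph p) : Prop :=
  ∃ f : G.V → H.V, Function.Injective f ∧
    (∀ a b, G.adj a b ↔ H.adj (f a) (f b)) ∧ ∀ a, H.label (f a) = G.label a

end PGraph

/-- A tree model with `r` labels and height `d` for a `p`-labeled graph `G`: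
a rooted tree all of whose root-to-leaf paths have length exactly `d`, whose
leaves are exactly the vertices of `G`, each leaf carrying a pair `(i, j)` with
`i ∈ Fin r` (recorded by `iLab`) and `j` the label of the vertex in `G`,
together with a symmetric signature `S` determining adjacency from the leaf
labels and the distance in the tree. -/
structure TModel (r p d : ℕ) (G : PGraph p) where
  W : Type
  g : SimpleGraph W
  tree : g.IsTree
  root : W
  depthLe : ∀ w, g.dist root w ≤ d
  branch : ∀ w, g.dist root w < d → ∃ w', g.Adj w w' ∧ g.dist root w' = g.dist root w + 1
  leafEquiv : G.V ≃ {w : W // g.dist root w = d}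
  iLab : G.V → Fin r
  S : Set (Fin r × Fin r × ℕ)
  S_range : ∀ x ∈ S, 1 ≤ x.2.2 ∧ x.2.2 ≤ d
  S_symm : ∀ i j l, (i, j, l) ∈ S ↔ (j, i, l) ∈ S
  edge_iff : ∀ u v : G.V, u ≠ v → ∀ l : ℕ,
    g.dist (leafEquiv u).1 (leafEquiv v).1 = 2 * l →
      (G.adj u v ↔ (iLab u, iLab v, l) ∈ S)

/-- The class of all (finite or infinite) `p`-labeled graphs admitting a tree model
with `r` labels and height `d`. -/
def TM (r p d : ℕ) : Set (PGraph p) := {G | Nonempty (TModel r p d G)}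

/-- Two sets have the same number of elements, counted up to the threshold `q`. -/
def SameCount {I I' : Type*} (q : ℕ) (A : Set I) (B : Set I') : Prop :=
  A.encard = B.encard ∨ ((q : ℕ∞) ≤ A.encard ∧ (q : ℕ∞) ≤ B.encard)

namespace SameCount

variable {I I' : Type*} {q : ℕ} {A : Set I} {B : Set I'}

theorem symm (h : SameCount q A B) : SameCount q B A :=
  h.elim (fun h => .inl h.symm) fun h => .inr ⟨h.2, h.1⟩

theorem le_encard (h : SameCount q A B) {n : ℕ} (hn : n ≤ q) (hA : (n : ℕ∞) ≤ A.encard) :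
    (n : ℕ∞) ≤ B.encard := by
  rcases h with h | h
  · rwa [← h]
  · exact le_trans (by exact_mod_cast hn) h.2

end SameCount

/-- A set coloured with finitely many colours contains a finite set in which every colour
occurs equally often up to the threshold `q`. -/
theorem exists_subset_of_coloring {I Z : Type*} [Finite Z] (q : ℕ) (F : Set I) (z : I → Z) :
    ∃ F₀ ⊆ F, F₀.encard ≤ (Nat.card Z * q : ℕ) ∧
      ∀ a, {i ∈ F | z i = a} ⊆ F₀ ∨ (q : ℕ∞) ≤ {i ∈ F₀ | z i = a}.encard := by
  have hG : ∀ a, ∃ G ⊆ {i ∈ F | z i = a}, G.encard ≤ q ∧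
      ({i ∈ F | z i = a} ⊆ G ∨ (q : ℕ∞) ≤ G.encard) := by
    intro a
    rcases le_total (q : ℕ∞) {i ∈ F | z i = a}.encard with h | h
    · obtain ⟨G, hGF, hGq⟩ := Set.exists_subset_encard_eq h
      exact ⟨G, hGF, hGq.le, .inr hGq.ge⟩
    · exact ⟨_, subset_rfl, h, .inl subset_rfl⟩
  choose G hGF hGq hG using hG
  refine ⟨⋃ a, G a, Set.iUnion_subset fun a => (hGF a).trans (Set.sep_subset _ _), ?_, fun a => ?_⟩
  · have := Fintype.ofFinite Z
    refine (Set.encard_iUnion_le_of_fintype G).trans ((Finset.sum_le_sum fun a _ => hGq a).trans ?_)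
    simp [Nat.card_eq_fintype_card]
  · refine (hG a).imp (fun h => h.trans (Set.subset_iUnion G a)) fun h => h.trans ?_
    exact Set.encard_le_encard fun i hi => ⟨Set.mem_iUnion_of_mem a hi, (hGF a hi).2⟩

/-- If two sets have the same number of elements up to a large threshold, then every colouring of
the first can be imitated on the second. -/
theorem SameCount.exists_coloring {I I' Z : Type*} [Finite Z] [Nonempty Z] {q : ℕ} {F : Set I}
    {F' : Set I'} (h : SameCount (Nat.card Z * q + 1) F F') (z : I → Z) :
    ∃ z' : I' → Z, (∀ i' ∈ F', ∃ i ∈ F, z i = z' i') ∧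
      ∀ a, SameCount q {i ∈ F | z i = a} {i ∈ F' | z' i = a} := by
  classical
  by_cases hc : F.encard = F'.encard ∧ F.Finite
  · obtain ⟨hc, hF⟩ := hc
    have hF' : F'.Finite := Set.encard_lt_top_iff.1 (hc ▸ Set.encard_lt_top_iff.2 hF)
    rcases isEmpty_or_nonempty I with hI | hI
    · have : F = ∅ := Set.eq_empty_of_isEmpty F
      have hF'0 : F' = ∅ := by rw [← Set.encard_eq_zero, ← hc, this, Set.encard_empty]
      refine ⟨fun _ => Classical.arbitrary Z, by simp [hF'0], fun a => .inl ?_⟩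
      simp [this, hF'0]
    · obtain ⟨f, hf⟩ := hF'.exists_bijOn_of_encard_eq hc.symm
      refine ⟨z ∘ f, fun i hi => ⟨f i, hf.mapsTo hi, rfl⟩, fun a => .inl ?_⟩
      have : {i ∈ F | z i = a} = f '' {i ∈ F' | (z ∘ f) i = a} := by
        ext i
        constructor
        · rintro ⟨hi, rfl⟩
          obtain ⟨j, hj, rfl⟩ := hf.surjOn hi
          exact ⟨j, ⟨hj, rfl⟩, rfl⟩
        · rintro ⟨j, ⟨hj, rfl⟩, rfl⟩
          exact ⟨hf.mapsTo hj, rfl⟩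
      rw [this, (hf.injOn.mono (Set.sep_subset _ _)).encard_image]
  · have hq : ((Nat.card Z * q + 1 : ℕ) : ℕ∞) ≤ F.encard ∧
        ((Nat.card Z * q + 1 : ℕ) : ℕ∞) ≤ F'.encard := by
      rcases h with h | h
      · have : F.encard = ⊤ := Set.encard_eq_top_iff.2 fun hF => hc ⟨h, hF⟩
        rw [← h, this]
        simp
      · exact h
    obtain ⟨F₀, hF₀, hcard, hcol⟩ := exists_subset_of_coloring q F z
    have hlt : F₀.encard < ((Nat.card Z * q + 1 : ℕ) : ℕ∞) :=
      hcard.trans_lt (by exact_mod_cast Nat.lt_succ_self _)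
    have hfin : F₀.Finite := Set.encard_lt_top_iff.1 (hlt.trans_le le_top)
    obtain ⟨i₀, hi₀, hi₀'⟩ : ∃ i ∈ F, i ∉ F₀ := by
      by_contra! hcon
      exact absurd (Set.encard_le_encard hcon) (not_le.2 (hlt.trans_le hq.1))
    have hi₀q : (q : ℕ∞) ≤ {i ∈ F₀ | z i = z i₀}.encard :=
      (hcol (z i₀)).resolve_left fun h => hi₀' (h ⟨hi₀, rfl⟩)
    have : Nonempty I' := by
      have : F'.encard ≠ 0 := fun h0 => by
        have := hq.2
        rw [h0] at this
        simp at this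
      exact (Set.encard_ne_zero.1 this).to_type
    obtain ⟨f, hf, hinj⟩ := hfin.exists_injOn_of_encard_le (hlt.le.trans hq.2)
    let z' : I' → Z := fun x => if h : ∃ a ∈ F₀, f a = x then z h.choose else z i₀
    have hz' : ∀ a ∈ F₀, z' (f a) = z a := by
      intro a ha
      have h : ∃ b ∈ F₀, f b = f a := ⟨a, ha, rfl⟩
      simp only [z', dif_pos h]
      rw [hinj h.choose_spec.1 ha h.choose_spec.2]
    have hz'' : ∀ x, x ∉ f '' F₀ → z' x = z i₀ := fun x hx => dif_neg hx
    have himg : ∀ a, f '' {i ∈ F₀ | z i = a} ⊆ {i ∈ F' | z' i = a} := by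
      rintro a _ ⟨i, ⟨hi, rfl⟩, rfl⟩
      exact ⟨hf hi, hz' i hi⟩
    have hle : ∀ a, {i ∈ F₀ | z i = a}.encard ≤ {i ∈ F' | z' i = a}.encard := by
      intro a
      rw [← (hinj.mono (Set.sep_subset _ _)).encard_image]
      exact Set.encard_le_encard (himg a)
    have hle' : ∀ a, {i ∈ F₀ | z i = a}.encard ≤ {i ∈ F | z i = a}.encard := fun a =>
      Set.encard_le_encard fun i hi => ⟨hF₀ hi.1, hi.2⟩
    refine ⟨z', fun x _ => ?_, fun a => ?_⟩
    · by_cases hx : x ∈ f '' F₀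
      · obtain ⟨a, ha, rfl⟩ := hx
        exact ⟨a, hF₀ ha, (hz' a ha).symm⟩
      · exact ⟨i₀, hi₀, (hz'' x hx).symm⟩
    · by_cases ha : a = z i₀
      · subst ha
        exact .inr ⟨hi₀q.trans (hle' _), hi₀q.trans (hle _)⟩
      · rcases hcol a with h | h
        · left
          have h₁ : {i ∈ F | z i = a} = {i ∈ F₀ | z i = a} :=
            subset_antisymm (fun i hi => ⟨h hi, hi.2⟩) fun i hi => ⟨hF₀ hi.1, hi.2⟩
          have h₂ : {i ∈ F' | z' i = a} = f '' {i ∈ F₀ | z i = a} := by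
            refine subset_antisymm ?_ (himg a)
            rintro x ⟨hx, rfl⟩
            have : x ∈ f '' F₀ := by
              by_contra hcon
              exact ha (hz'' x hcon)
            obtain ⟨b, hb, rfl⟩ := this
            exact ⟨b, ⟨hb, (hz' b hb).symm⟩, rfl⟩
          rw [h₁, h₂, (hinj.mono (Set.sep_subset _ _)).encard_image]
        · exact .inr ⟨h.trans (hle' a), h.trans (hle a)⟩

/-- The finite set of possible rank `m` monadic types of graphs coloured by `C`. -/
def MSOType : ℕ → Type → Type
  | 0, C => Set (C × C × Prop × Prop)
  | m + 1, C => Set (MSOType m (C × Prop))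

instance MSOType.instFinite (m : ℕ) (C : Type) [Finite C] : Finite (MSOType m C) := by
  induction m generalizing C with
  | zero => exact inferInstanceAs (Finite (Set (C × C × Prop × Prop)))
  | succ m ih =>
    have := ih (C × Prop)
    exact inferInstanceAs (Finite (Set (MSOType m (C × Prop))))

instance MSOType.instNonempty (m : ℕ) (C : Type) : Nonempty (MSOType m C) := by
  cases m with
  | zero => exact inferInstanceAs (Nonempty (Set (C × C × Prop × Prop)))
  | succ m => exact inferInstanceAs (Nonempty (Set (MSOType m (C × Prop))))

/-- The rank `m` monadic type of the restriction to `s` of a graph `E` coloured by `c`. -/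
def msoType : (m : ℕ) → {C V : Type} → (V → V → Prop) → (V → C) → Set V → MSOType m C
  | 0, C, _, E, c, s =>
    ({x | ∃ u ∈ s, ∃ v ∈ s, x = (c u, c v, u = v, E u v)} : Set (C × C × Prop × Prop))
  | m + 1, C, V, E, c, s =>
    (Set.range fun A : V → Prop => msoType m E (fun u => (c u, A u)) s :
      Set (MSOType m (C × Prop)))

theorem msoType_succ_eq_iff {m : ℕ} {C V V' : Type} {E : V → V → Prop} {E' : V' → V' → Prop}
    {c : V → C} {c' : V' → C} {s : Set V} {s' : Set V'} :
    msoType (m + 1) E c s = msoType (m + 1) E' c' s' ↔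
      (∀ A : V → Prop, ∃ B : V' → Prop,
        msoType m E' (fun u => (c' u, B u)) s' = msoType m E (fun u => (c u, A u)) s) ∧
      (∀ B : V' → Prop, ∃ A : V → Prop,
        msoType m E (fun u => (c u, A u)) s = msoType m E' (fun u => (c' u, B u)) s') := by
  refine Set.Subset.antisymm_iff.trans (and_congr ?_ ?_) <;> exact Set.range_subset_iff

theorem msoType_zero_eq_iff {C V V' : Type} {E : V → V → Prop} {E' : V' → V' → Prop}
    {c : V → C} {c' : V' → C} {s : Set V} {s' : Set V'} :
    msoType 0 E c s = msoType 0 E' c' s' ↔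
      (∀ u ∈ s, ∀ v ∈ s, ∃ u' ∈ s', ∃ v' ∈ s',
        c' u' = c u ∧ c' v' = c v ∧ (u' = v' ↔ u = v) ∧ (E' u' v' ↔ E u v)) ∧
      (∀ u' ∈ s', ∀ v' ∈ s', ∃ u ∈ s, ∃ v ∈ s,
        c u = c' u' ∧ c v = c' v' ∧ (u = v ↔ u' = v') ∧ (E u v ↔ E' u' v')) := by
  have key : ∀ {V V' : Type} {E : V → V → Prop} {E' : V' → V' → Prop}
    {c : V → C} {c' : V' → C} {s : Set V} {s' : Set V'},
    ({x | ∃ u ∈ s, ∃ v ∈ s, x = (c u, c v, u = v, E u v)} : Set (C × C × Prop × Prop)) ⊆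
      {x | ∃ u ∈ s', ∃ v ∈ s', x = (c' u, c' v, u = v, E' u v)} ↔
      (∀ u ∈ s, ∀ v ∈ s, ∃ u' ∈ s', ∃ v' ∈ s',
        c' u' = c u ∧ c' v' = c v ∧ (u' = v' ↔ u = v) ∧ (E' u' v' ↔ E u v)) := by
    intro V V' E E' c c' s s'
    constructor
    · intro h u hu v hv
      obtain ⟨u', hu', v', hv', h⟩ := h ⟨u, hu, v, hv, rfl⟩
      simp only [Prod.mk.injEq, eq_iff_iff] at h
      exact ⟨u', hu', v', hv', h.1.symm, h.2.1.symm, h.2.2.1.symm, h.2.2.2.symm⟩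
    · rintro h _ ⟨u, hu, v, hv, rfl⟩
      obtain ⟨u', hu', v', hv', h₁, h₂, h₃, h₄⟩ := h u hu v hv
      exact ⟨u', hu', v', hv', by simp [h₁, h₂, h₃, h₄]⟩
  exact Set.Subset.antisymm_iff.trans (and_congr key key)

theorem msoType_congr {m : ℕ} {C V : Type} {E : V → V → Prop} {c c' : V → C} {s : Set V}
    (h : Set.EqOn c c' s) : msoType m E c s = msoType m E c' s := by
  induction m generalizing C with
  | zero =>
    refine msoType_zero_eq_iff.2 ⟨fun u hu v hv => ⟨u, hu, v, hv, ?_⟩,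
      fun u hu v hv => ⟨u, hu, v, hv, ?_⟩⟩ <;> simp [h hu, h hv]
  | succ m ih =>
    refine msoType_succ_eq_iff.2 ⟨fun A => ⟨A, ih fun u hu => ?_⟩, fun A => ⟨A, ih fun u hu => ?_⟩⟩
      <;> simp [h hu]

theorem msoType_subtype {m : ℕ} {C V : Type} (E : V → V → Prop) (c : V → C) (s : Set V) :
    msoType m (fun a b : s => E a.1 b.1) (fun a => c a.1) Set.univ = msoType m E c s := by
  classical
  induction m generalizing C with
  | zero =>
    refine msoType_zero_eq_iff.2 ⟨fun u _ v _ => ⟨u.1, u.2, v.1, v.2, ?_⟩,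
      fun u hu v hv => ⟨⟨u, hu⟩, trivial, ⟨v, hv⟩, trivial, ?_⟩⟩ <;> simp [Subtype.ext_iff]
  | succ m ih =>
    refine msoType_succ_eq_iff.2 ⟨fun A => ⟨fun v => ∃ h : v ∈ s, A ⟨v, h⟩, ?_⟩,
      fun A => ⟨fun v => A v.1, ih fun v => (c v, A v)⟩⟩
    rw [← ih]
    congr 1
    funext a
    simp

/-- Composition: if a graph is cut into pieces such that the edges between different pieces are
determined by the colours, then its type is determined by how often the types of the pieces occur,
counted up to some threshold. -/
theorem exists_threshold (m : ℕ) (C Y : Type) [Finite C] [Finite Y] :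
    ∃ q : ℕ, ∀ {V I : Type} (E : V → V → Prop) (R : C → C → Prop) (π : V → I) (c c' : V → C)
      (s s' : Set V) (J J' : Set I) (t t' : I → Y),
      (∀ u ∈ s, π u ∈ J) → (∀ u ∈ s', π u ∈ J') →
      (∀ u ∈ s, ∀ v ∈ s, π u ≠ π v → (E u v ↔ R (c u) (c v))) →
      (∀ u ∈ s', ∀ v ∈ s', π u ≠ π v → (E u v ↔ R (c' u) (c' v))) →
      (∀ i ∈ J, ∀ i' ∈ J', t i = t' i' →
        msoType m E c (s ∩ π ⁻¹' {i}) = msoType m E c' (s' ∩ π ⁻¹' {i'})) →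
      (∀ y, SameCount q {i ∈ J | t i = y} {i ∈ J' | t' i = y}) →
      msoType m E c s = msoType m E c' s' := by
  classical
  induction m generalizing C Y with
  | zero =>
    refine ⟨2, ?_⟩
    have key : ∀ {V I : Type} (E : V → V → Prop) (R : C → C → Prop) (π : V → I) (c c' : V → C)
      (s s' : Set V) (J J' : Set I) (t t' : I → Y),
      (∀ u ∈ s, π u ∈ J) → (∀ u ∈ s, ∀ v ∈ s, π u ≠ π v → (E u v ↔ R (c u) (c v))) →
      (∀ u ∈ s', ∀ v ∈ s', π u ≠ π v → (E u v ↔ R (c' u) (c' v))) →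
      (∀ i ∈ J, ∀ i' ∈ J', t i = t' i' →
        msoType 0 E c (s ∩ π ⁻¹' {i}) = msoType 0 E c' (s' ∩ π ⁻¹' {i'})) →
      (∀ y, SameCount 2 {i ∈ J | t i = y} {i ∈ J' | t' i = y}) →
      ∀ u ∈ s, ∀ v ∈ s, ∃ u' ∈ s', ∃ v' ∈ s',
        c' u' = c u ∧ c' v' = c v ∧ (u' = v' ↔ u = v) ∧ (E u' v' ↔ E u v) := by
      intro V I E R π c c' s s' J J' t t' hJ hR hR' htp hcount u hu v hv
      have hex : ∀ i ∈ J, ∃ i' ∈ J', t' i' = t i := by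
        intro i hi
        have h1 := (hcount (t i)).le_encard (n := 1) (by norm_num)
          (by simpa [Set.one_le_encard_iff_nonempty] using ⟨i, hi, rfl⟩)
        rw [Nat.cast_one, Set.one_le_encard_iff_nonempty] at h1
        obtain ⟨i', h, h'⟩ := h1
        exact ⟨i', h, h'⟩
      by_cases huv : π u = π v
      · obtain ⟨i', hi', ht⟩ := hex _ (hJ u hu)
        obtain ⟨u', hu', v', hv', h⟩ := (msoType_zero_eq_iff.1 (htp _ (hJ u hu) i' hi' ht.symm)).1
          u ⟨hu, rfl⟩ v ⟨hv, huv.symm⟩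
        exact ⟨u', hu'.1, v', hv'.1, h⟩
      · obtain ⟨i', hi', j', hj', hti, htj, hij⟩ : ∃ i' ∈ J', ∃ j' ∈ J', t' i' = t (π u) ∧
            t' j' = t (π v) ∧ i' ≠ j' := by
          by_cases htt : t (π u) = t (π v)
          · have h2 := (hcount (t (π u))).le_encard (n := 2) le_rfl (by
              have : 1 < {i ∈ J | t i = t (π u)}.encard :=
                Set.one_lt_encard_iff.2 ⟨π u, π v, ⟨hJ u hu, rfl⟩, ⟨hJ v hv, htt.symm⟩, huv⟩
              simpa [one_add_one_eq_two] using Order.add_one_le_of_lt this)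
            have : 1 < {i ∈ J' | t' i = t (π u)}.encard :=
              lt_of_lt_of_le (by norm_num) h2
            obtain ⟨i', j', hi', hj', hne⟩ := Set.one_lt_encard_iff.1 this
            exact ⟨i', hi'.1, j', hj'.1, hi'.2, hj'.2.trans htt, hne⟩
          · obtain ⟨i', hi', hti⟩ := hex _ (hJ u hu)
            obtain ⟨j', hj', htj⟩ := hex _ (hJ v hv)
            refine ⟨i', hi', j', hj', hti, htj, ?_⟩
            rintro rfl
            exact htt (hti.symm.trans htj)
        obtain ⟨u', hu', -, -, hcu, -⟩ := (msoType_zero_eq_iff.1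
          (htp _ (hJ u hu) i' hi' hti.symm)).1 u ⟨hu, rfl⟩ u ⟨hu, rfl⟩
        obtain ⟨v', hv', -, -, hcv, -⟩ := (msoType_zero_eq_iff.1
          (htp _ (hJ v hv) j' hj' htj.symm)).1 v ⟨hv, rfl⟩ v ⟨hv, rfl⟩
        have hpi : π u' ≠ π v' := by
          rw [show π u' = i' from hu'.2, show π v' = j' from hv'.2]
          exact hij
        refine ⟨u', hu'.1, v', hv'.1, hcu, hcv, ?_, ?_⟩
        · exact iff_of_false (fun h => hpi (congrArg π h)) fun h => huv (congrArg π h)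
        · rw [hR' u' hu'.1 v' hv'.1 hpi, hR u hu v hv huv, hcu, hcv]
    intro V I E R π c c' s s' J J' t t' hJ hJ' hR hR' htp hcount
    exact msoType_zero_eq_iff.2 ⟨key E R π c c' s s' J J' t t' hJ hR hR' htp hcount,
      key E R π c' c s' s J' J t' t hJ' hR' hR
        (fun i hi i' hi' h => (htp i' hi' i hi h.symm).symm) fun y => (hcount y).symm⟩
  | succ m ih =>
    obtain ⟨q, hq⟩ := ih (C × Prop) (Y × MSOType m (C × Prop))
    refine ⟨Nat.card (MSOType m (C × Prop)) * q + 1, ?_⟩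
    have key : ∀ {V I : Type} (E : V → V → Prop) (R : C → C → Prop) (π : V → I) (c c' : V → C)
      (s s' : Set V) (J J' : Set I) (t t' : I → Y),
      (∀ u ∈ s, π u ∈ J) → (∀ u ∈ s', π u ∈ J') →
      (∀ u ∈ s, ∀ v ∈ s, π u ≠ π v → (E u v ↔ R (c u) (c v))) →
      (∀ u ∈ s', ∀ v ∈ s', π u ≠ π v → (E u v ↔ R (c' u) (c' v))) →
      (∀ i ∈ J, ∀ i' ∈ J', t i = t' i' →
        msoType (m + 1) E c (s ∩ π ⁻¹' {i}) = msoType (m + 1) E c' (s' ∩ π ⁻¹' {i'})) →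
      (∀ y, SameCount (Nat.card (MSOType m (C × Prop)) * q + 1)
        {i ∈ J | t i = y} {i ∈ J' | t' i = y}) →
      ∀ A : V → Prop, ∃ B : V → Prop,
        msoType m E (fun u => (c' u, B u)) s' = msoType m E (fun u => (c u, A u)) s := by
      intro V I E R π c c' s s' J J' t t' hJ hJ' hR hR' htp hcount A
      let z : I → MSOType m (C × Prop) := fun i =>
        msoType m E (fun u => (c u, A u)) (s ∩ π ⁻¹' {i})
      choose w hw hw' using fun y => (hcount y).exists_coloring z
      have hB : ∀ i', ∃ B : V → Prop, i' ∈ J' →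
          msoType m E (fun u => (c' u, B u)) (s' ∩ π ⁻¹' {i'}) = w (t' i') i' := by
        intro i'
        by_cases hi' : i' ∈ J'
        · obtain ⟨i, hi, hz⟩ := hw (t' i') i' ⟨hi', rfl⟩
          obtain ⟨B, hB⟩ := (msoType_succ_eq_iff.1 (htp i hi.1 i' hi' hi.2)).1 A
          exact ⟨B, fun _ => hB.trans hz⟩
        · exact ⟨A, fun h => absurd h hi'⟩
      choose B hB using hB
      refine ⟨fun u => B (π u) u, Eq.symm ?_⟩
      refine hq E (fun a b => R a.1 b.1) π _ _ s s' J J' (fun i => (t i, z i))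
        (fun i => (t' i, w (t' i) i)) hJ hJ' hR hR' ?_ ?_
      · intro i hi i' hi' h
        rw [Prod.mk.injEq] at h
        refine h.2.trans ((hB i' hi').symm.trans (msoType_congr fun u hu => ?_))
        obtain rfl : π u = i' := hu.2
        rfl
      · rintro ⟨y, a⟩
        have h1 : {i ∈ J | (t i, z i) = (y, a)} = {i ∈ {i ∈ J | t i = y} | z i = a} := by
          ext i
          simp [and_assoc]
        have h2 : {i ∈ J' | (t' i, w (t' i) i) = (y, a)} =
            {i ∈ {i ∈ J' | t' i = y} | w y i = a} := by
          ext i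
          simp only [Set.mem_ofPred_eq, Prod.mk.injEq, and_assoc]
          refine and_congr_right fun _ => and_congr_right fun h => ?_
          rw [h]
        rw [h1, h2]
        exact hw' y a
    intro V I E R π c c' s s' J J' t t' hJ hJ' hR hR' htp hcount
    exact msoType_succ_eq_iff.2 ⟨key E R π c c' s s' J J' t t' hJ hJ' hR hR' htp hcount,
      key E R π c' c s' s J' J t' t hJ' hJ hR' hR
        (fun i hi i' hi' h => (htp i' hi' i hi h.symm).symm) fun y => (hcount y).symm⟩

theorem msoType_comp {m : ℕ} {C D V V' : Type} {E : V → V → Prop} {E' : V' → V' → Prop}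
    {c : V → C} {c' : V' → C} {s : Set V} {s' : Set V'} (f : C → D)
    (h : msoType m E c s = msoType m E' c' s') :
    msoType m E (fun u => f (c u)) s = msoType m E' (fun u => f (c' u)) s' := by
  induction m generalizing C D with
  | zero =>
    rw [msoType_zero_eq_iff] at h ⊢
    refine ⟨fun u hu v hv => ?_, fun u hu v hv => ?_⟩
    · obtain ⟨u', hu', v', hv', h₁, h₂, h₃⟩ := h.1 u hu v hv
      exact ⟨u', hu', v', hv', congrArg f h₁, congrArg f h₂, h₃⟩
    · obtain ⟨u', hu', v', hv', h₁, h₂, h₃⟩ := h.2 u hu v hv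
      exact ⟨u', hu', v', hv', congrArg f h₁, congrArg f h₂, h₃⟩
  | succ m ih =>
    rw [msoType_succ_eq_iff] at h ⊢
    refine ⟨fun A => ?_, fun A => ?_⟩
    · obtain ⟨B, hB⟩ := h.1 A
      exact ⟨B, (ih (fun x : C × Prop => (f x.1, x.2)) hB.symm).symm⟩
    · obtain ⟨B, hB⟩ := h.2 A
      exact ⟨B, ih (fun x : C × Prop => (f x.1, x.2)) hB⟩

theorem msoType_zero_of_eq {m : ℕ} {C V V' : Type} {E : V → V → Prop} {E' : V' → V' → Prop}
    {c : V → C} {c' : V' → C} {s : Set V} {s' : Set V'}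
    (h : msoType m E c s = msoType m E' c' s') : msoType 0 E c s = msoType 0 E' c' s' := by
  induction m generalizing C with
  | zero => exact h
  | succ m ih =>
    obtain ⟨B, hB⟩ := (msoType_succ_eq_iff.1 h).1 fun _ => False
    exact (msoType_comp Prod.fst (ih hB.symm))

/-- The colouring `c` determines the unary relations of `M` and the values of the first-order
variables in `F` and of the set variables in `F'`, by means of the colour predicates `D`, `K`
and `L`. -/
structure MStr.Coded {ι : Type u} {C : Type} (M : MStr ι) (c : M.V → C) (D : ι → C → Prop)
    (F F' : Finset ℕ) (K L : ℕ → C → Prop) (v : ℕ → M.V) (s : ℕ → Set M.V) : Prop where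
  pred : ∀ a u, M.P a u ↔ D a (c u)
  fo : ∀ i ∈ F, ∀ u, K i (c u) ↔ u = v i
  so : ∀ X ∈ F', ∀ u, L X (c u) ↔ u ∈ s X

namespace MStr.Coded

variable {ι : Type u} {C : Type} {M : MStr ι} {c : M.V → C} {D : ι → C → Prop}
  {F F' : Finset ℕ} {K L : ℕ → C → Prop} {v : ℕ → M.V} {s : ℕ → Set M.V}

theorem mono {F₁ F₁' : Finset ℕ} (h : M.Coded c D F F' K L v s) (hF : F₁ ⊆ F) (hF' : F₁' ⊆ F') :
    M.Coded c D F₁ F₁' K L v s :=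
  ⟨h.pred, fun i hi => h.fo i (hF hi), fun X hX => h.so X (hF' hX)⟩

theorem update_fo {n : ℕ} (h : M.Coded c D (F.erase n) F' K L v s) (A : M.V → Prop) (x : M.V)
    (hx : ∀ u, A u ↔ u = x) :
    M.Coded (fun u => (c u, A u)) (fun a y => D a y.1) F F'
      (Function.update (fun i y => K i y.1) n fun y => y.2) (fun X y => L X y.1)
      (Function.update v n x) s := by
  refine ⟨h.pred, fun i hi u => ?_, h.so⟩
  by_cases hin : i = n
  · subst hin
    simpa using hx u
  · simpa [Function.update_of_ne hin] using h.fo i (Finset.mem_erase.2 ⟨hin, hi⟩) u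

theorem update_so {n : ℕ} (h : M.Coded c D F (F'.erase n) K L v s) (A : M.V → Prop) (B : Set M.V)
    (hx : ∀ u, A u ↔ u ∈ B) :
    M.Coded (fun u => (c u, A u)) (fun a y => D a y.1) F F'
      (fun i y => K i y.1) (Function.update (fun X y => L X y.1) n fun y => y.2)
      v (Function.update s n B) := by
  refine ⟨h.pred, h.fo, fun i hi u => ?_⟩
  by_cases hin : i = n
  · subst hin
    simpa using hx u
  · simpa [Function.update_of_ne hin] using h.so i (Finset.mem_erase.2 ⟨hin, hi⟩) u

end MStr.Coded

theorem exists_unique_color_of_msoType {C V V' : Type} {E : V → V → Prop} {E' : V' → V' → Prop}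
    {c : V → C} {c' : V' → C} (h : msoType 0 E c Set.univ = msoType 0 E' c' Set.univ)
    {K : C → Prop} {x : V} (hx : ∀ u, K (c u) ↔ u = x) : ∃ x', ∀ u, K (c' u) ↔ u = x' := by
  rw [msoType_zero_eq_iff] at h
  obtain ⟨x', -, -, -, hx', -⟩ := h.1 x trivial x trivial
  have hKx' : K (c' x') := by
    rw [hx', hx]
  refine ⟨x', fun u => ⟨fun hu => ?_, fun hu => hu ▸ hKx'⟩⟩
  obtain ⟨a, -, b, -, ha, hb, hab, -⟩ := h.2 u trivial x' trivial
  rw [← hab, (hx a).1 (ha ▸ hu), (hx b).1 (hb ▸ hKx')]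

theorem MStr.Coded.atoms_iff {ι : Type u} {m : ℕ} {C : Type} {M M' : MStr ι} {c : M.V → C}
    {c' : M'.V → C} {D : ι → C → Prop} {F F' : Finset ℕ} {K L : ℕ → C → Prop}
    {v : ℕ → M.V} {v' : ℕ → M'.V} {s : ℕ → Set M.V} {s' : ℕ → Set M'.V}
    (h : M.Coded c D F F' K L v s) (h' : M'.Coded c' D F F' K L v' s')
    (htp : msoType m M.E c Set.univ = msoType m M'.E c' Set.univ) {i j : ℕ} (hi : i ∈ F)
    (hj : j ∈ F) :
    (v i = v j ↔ v' i = v' j) ∧ (M.E (v i) (v j) ↔ M'.E (v' i) (v' j)) ∧ c' (v' i) = c (v i) := by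
  obtain ⟨a, -, b, -, ha, hb, hab, hE⟩ :=
    (msoType_zero_eq_iff.1 (msoType_zero_of_eq htp)).1 (v i) trivial (v j) trivial
  obtain rfl := (h'.fo i hi a).1 (ha ▸ (h.fo i hi _).2 rfl)
  obtain rfl := (h'.fo j hj b).1 (hb ▸ (h.fo j hj _).2 rfl)
  exact ⟨hab.symm, hE.symm, ha⟩

/-- Coloured structures of the same type agree on formulas of the corresponding rank. -/
theorem MStr.realize_iff_of_msoType {ι : Type u} (φ : MSOForm ι) {m : ℕ} (hm : φ.qr ≤ m) {C : Type}
    {M M' : MStr ι} {c : M.V → C} {c' : M'.V → C} {D : ι → C → Prop} {K L : ℕ → C → Prop}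
    {v : ℕ → M.V} {v' : ℕ → M'.V} {s : ℕ → Set M.V} {s' : ℕ → Set M'.V}
    (h : M.Coded c D φ.freeFO φ.freeSO K L v s) (h' : M'.Coded c' D φ.freeFO φ.freeSO K L v' s')
    (htp : msoType m M.E c Set.univ = msoType m M'.E c' Set.univ) :
    M.Realize φ v s ↔ M'.Realize φ v' s' := by
  induction φ generalizing m C M M' with
  | fal => exact Iff.rfl
  | eq i j =>
    exact (h.atoms_iff h' htp (i := i) (j := j) (by simp [MSOForm.freeFO])
      (by simp [MSOForm.freeFO])).1
  | edge i j =>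
    exact (h.atoms_iff h' htp (i := i) (j := j) (by simp [MSOForm.freeFO])
      (by simp [MSOForm.freeFO])).2.1
  | pred a i =>
    have hi : i ∈ (MSOForm.pred a i).freeFO := by simp [MSOForm.freeFO]
    simp only [MStr.Realize]
    rw [h.pred, h'.pred, (h.atoms_iff h' htp hi hi).2.2]
  | mem i X =>
    have hi : i ∈ (MSOForm.mem i X : MSOForm ι).freeFO := by simp [MSOForm.freeFO]
    have hX : X ∈ (MSOForm.mem i X : MSOForm ι).freeSO := by simp [MSOForm.freeSO]
    simp only [MStr.Realize]
    rw [← h.so X hX, ← h'.so X hX, (h.atoms_iff h' htp hi hi).2.2]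
  | imp φ ψ ihφ ihψ =>
    simp only [MSOForm.qr, max_le_iff] at hm
    simp only [MStr.Realize]
    have hl₁ : φ.freeFO ⊆ (φ.imp ψ).freeFO := Finset.subset_union_left
    have hl₂ : φ.freeSO ⊆ (φ.imp ψ).freeSO := Finset.subset_union_left
    have hr₁ : ψ.freeFO ⊆ (φ.imp ψ).freeFO := Finset.subset_union_right
    have hr₂ : ψ.freeSO ⊆ (φ.imp ψ).freeSO := Finset.subset_union_right
    exact imp_congr (ihφ hm.1 (h.mono hl₁ hl₂) (h'.mono hl₁ hl₂) htp)
      (ihψ hm.2 (h.mono hr₁ hr₂) (h'.mono hr₁ hr₂) htp)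
  | exFO n φ ih =>
    simp only [MSOForm.qr] at hm
    obtain ⟨m, rfl⟩ : ∃ k, m = k + 1 := ⟨m - 1, by omega⟩
    have step : ∀ {M M' : MStr ι} {c : M.V → C} {c' : M'.V → C}
        {v : ℕ → M.V} {v' : ℕ → M'.V} {s : ℕ → Set M.V} {s' : ℕ → Set M'.V},
        M.Coded c D (φ.freeFO.erase n) φ.freeSO K L v s →
        M'.Coded c' D (φ.freeFO.erase n) φ.freeSO K L v' s' →
        msoType (m + 1) M.E c Set.univ = msoType (m + 1) M'.E c' Set.univ →
        M.Realize (φ.exFO n) v s → M'.Realize (φ.exFO n) v' s' := by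
      rintro M M' c c' v v' s s' h h' htp ⟨x, hx⟩
      obtain ⟨B, hB⟩ := (msoType_succ_eq_iff.1 htp).1 (· = x)
      obtain ⟨x', hx'⟩ := exists_unique_color_of_msoType (K := fun y : C × Prop => y.2)
        (msoType_zero_of_eq hB.symm) (x := x) fun u => Iff.rfl
      exact ⟨x', (ih (by omega) (h.update_fo _ x fun _ => Iff.rfl) (h'.update_fo B x' hx')
        hB.symm).1 hx⟩
    exact ⟨step h h' htp, step h' h htp.symm⟩
  | exSO n φ ih =>
    simp only [MSOForm.qr] at hm
    obtain ⟨m, rfl⟩ : ∃ k, m = k + 1 := ⟨m - 1, by omega⟩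
    have step : ∀ {M M' : MStr ι} {c : M.V → C} {c' : M'.V → C}
        {v : ℕ → M.V} {v' : ℕ → M'.V} {s : ℕ → Set M.V} {s' : ℕ → Set M'.V},
        M.Coded c D φ.freeFO (φ.freeSO.erase n) K L v s →
        M'.Coded c' D φ.freeFO (φ.freeSO.erase n) K L v' s' →
        msoType (m + 1) M.E c Set.univ = msoType (m + 1) M'.E c' Set.univ →
        M.Realize (φ.exSO n) v s → M'.Realize (φ.exSO n) v' s' := by
      rintro M M' c c' v v' s s' h h' htp ⟨A, hA⟩
      obtain ⟨B, hB⟩ := (msoType_succ_eq_iff.1 htp).1 (· ∈ A)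
      exact ⟨{u | B u}, (ih (by omega) (h.update_so _ A fun _ => Iff.rfl)
        (h'.update_so B {u | B u} fun _ => Iff.rfl) hB.symm).1 hA⟩
    exact ⟨step h h' htp, step h' h htp.symm⟩

/-- If the edges of a graph are determined by colours and by the lowest level of a hierarchy of
finite height at which their ends are identified, then every set lying in a single class of the
hierarchy can be approximated from within by finite sets of the same type. -/
theorem exists_finite_msoType_eq {V C W : Type} [Finite C] (m : ℕ) (E : V → V → Prop) (c : V → C)
    (R : ℕ → C → C → Prop) (π : ℕ → V → W) (hinj : Function.Injective (π 0)) (d : ℕ)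
    (hE : ∀ l < d, ∀ u v, π (l + 1) u = π (l + 1) v → π l u ≠ π l v →
      (E u v ↔ R l (c u) (c v))) {l : ℕ} (hl : l ≤ d) (X : Set V)
    (hX : ∀ u ∈ X, ∀ v ∈ X, π l u = π l v) (F : Set V) (hF : F.Finite) (hFX : F ⊆ X) :
    ∃ s : Set V, s.Finite ∧ F ⊆ s ∧ s ⊆ X ∧ msoType m E c s = msoType m E c X := by
  classical
  induction l generalizing X F with
  | zero =>
    have : X.Subsingleton := fun u hu v hv => hinj (hX u hu v hv)
    exact ⟨X, this.finite, hFX, subset_rfl, rfl⟩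
  | succ l ih =>
    obtain ⟨q, hq⟩ := exists_threshold m C (MSOType m C)
    have hpiece : ∀ i, ∃ s : Set V, s.Finite ∧ F ∩ π l ⁻¹' {i} ⊆ s ∧ s ⊆ X ∩ π l ⁻¹' {i} ∧
        msoType m E c s = msoType m E c (X ∩ π l ⁻¹' {i}) := fun i =>
      ih (by omega) _ (fun u hu v hv => hu.2.trans hv.2.symm) _ (hF.subset Set.inter_subset_left)
        (Set.inter_subset_inter_left _ hFX)
    choose s hsfin hFs hsX hs using hpiece
    obtain ⟨I₀, -, hI₀, hcol⟩ := exists_subset_of_coloring q (Set.univ : Set W)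
      fun i => msoType m E c (X ∩ π l ⁻¹' {i})
    have hI₀fin : I₀.Finite := Set.encard_lt_top_iff.1 (hI₀.trans_lt (ENat.natCast_lt_top _))
    set J : Set W := I₀ ∪ π l '' F
    have hJ : J.Finite := hI₀fin.union (hF.image _)
    have hsub : (⋃ i ∈ J, s i) ⊆ X :=
      Set.iUnion₂_subset fun i _ => (hsX i).trans Set.inter_subset_left
    have hinter : ∀ i ∈ J, (⋃ i ∈ J, s i) ∩ π l ⁻¹' {i} = s i := by
      intro i hi
      refine subset_antisymm ?_ fun u hu => ⟨Set.mem_biUnion hi hu, (hsX i hu).2⟩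
      rintro u ⟨hu, rfl⟩
      obtain ⟨j, hj, huj⟩ := Set.mem_iUnion₂.1 hu
      obtain rfl : π l u = j := (hsX j huj).2
      exact huj
    refine ⟨⋃ i ∈ J, s i, hJ.biUnion fun i _ => hsfin i, fun u hu => ?_, hsub, Eq.symm ?_⟩
    · exact Set.mem_biUnion (.inr ⟨u, hu, rfl⟩) (hFs (π l u) ⟨hu, rfl⟩)
    · refine hq E (R l) (π l) c c X _ Set.univ J (fun i => msoType m E c (X ∩ π l ⁻¹' {i}))
        (fun i => msoType m E c (X ∩ π l ⁻¹' {i})) (fun _ _ => trivial) ?_ ?_ ?_ ?_ ?_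
      · intro u hu
        obtain ⟨j, hj, huj⟩ := Set.mem_iUnion₂.1 hu
        obtain rfl : π l u = j := (hsX j huj).2
        exact hj
      · exact fun u hu v hv h => hE l (by omega) u v (hX u hu v hv) h
      · exact fun u hu v hv h => hE l (by omega) u v (hX u (hsub hu) v (hsub hv)) h
      · intro i _ i' hi' h
        rw [hinter i' hi', hs i']
        exact h
      · intro y
        rcases hcol y with h | h
        · left
          congr 1
          ext i
          exact ⟨fun hi => ⟨.inl (h hi), hi.2⟩, fun hi => ⟨trivial, hi.2⟩⟩
        · exact .inr ⟨h.trans (Set.encard_le_encard fun i hi => ⟨trivial, hi.2⟩),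
            h.trans (Set.encard_le_encard fun i hi => ⟨.inl hi.1, hi.2⟩)⟩

namespace SimpleGraph

variable {W : Type*} {g : SimpleGraph W}

theorem Connected.exists_adj_dist_eq (hg : g.Connected) {x y : W} (h : g.dist x y ≠ 0) :
    ∃ z, g.Adj x z ∧ g.dist x y = g.dist z y + 1 := by
  obtain ⟨p, hp⟩ := hg.exists_walk_length_eq_dist x y
  cases p with
  | nil => simp at h
  | @cons _ z _ hxz q =>
    refine ⟨z, hxz, le_antisymm ?_ ?_⟩
    · have := hg.dist_triangle (u := x) (v := z) (w := y)
      rw [dist_eq_one_iff_adj.2 hxz] at this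
      omega
    · have := dist_le q
      rw [Walk.length_cons] at hp
      omega

open Classical in
/-- A neighbour of `w` that is closer to `root`, if there is one. -/
noncomputable def parent (g : SimpleGraph W) (root w : W) : W :=
  if h : ∃ z, g.Adj w z ∧ g.dist w root = g.dist z root + 1 then h.choose else w

theorem Connected.adj_parent (hg : g.Connected) {root w : W} (h : g.dist w root ≠ 0) :
    g.Adj w (g.parent root w) ∧ g.dist w root = g.dist (g.parent root w) root + 1 := by
  have hex := hg.exists_adj_dist_eq h
  simp only [parent, dif_pos hex]
  exact hex.choose_spec

theorem Connected.dist_iterate_parent (hg : g.Connected) {root w : W} {l : ℕ}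
    (hl : l ≤ g.dist w root) : g.dist ((g.parent root)^[l] w) root = g.dist w root - l := by
  induction l with
  | zero => rfl
  | succ l ih =>
    have ih := ih (by omega)
    rw [Function.iterate_succ_apply']
    have := (hg.adj_parent (root := root) (w := (g.parent root)^[l] w) (by omega)).2
    omega

theorem Connected.exists_path_of_iterate_parent (hg : g.Connected) {root : W} (n : ℕ) {x y : W}
    (hxy : g.dist x root = g.dist y root) (hn : n < g.dist x root)
    (hne : (g.parent root)^[n] x ≠ (g.parent root)^[n] y)
    (heq : (g.parent root)^[n + 1] x = (g.parent root)^[n + 1] y) :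
    ∃ p : g.Walk x y, p.IsPath ∧ p.length = 2 * (n + 1) ∧
      ∀ w ∈ p.support, g.dist w root ≤ g.dist x root := by
  have hx := hg.adj_parent (root := root) (w := x) (by omega)
  have hy := hg.adj_parent (root := root) (w := y) (by omega)
  have hne' : x ≠ y := fun h => hne (by rw [h])
  obtain ⟨q, hq, hlen, hsupp⟩ : ∃ q : g.Walk (g.parent root x) (g.parent root y), q.IsPath ∧
      q.length = 2 * n ∧ ∀ w ∈ q.support, g.dist w root ≤ g.dist (g.parent root x) root := by
    cases n with
    | zero =>
      have heq : g.parent root x = g.parent root y := heq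
      rw [← heq]
      exact ⟨.nil, .nil, rfl, by simp⟩
    | succ n => exact hg.exists_path_of_iterate_parent n (by omega) (by omega) hne heq
  have hxq : x ∉ q.support := fun h => by
    have := hsupp x h
    omega
  have hyq : y ∉ q.support := fun h => by
    have := hsupp y h
    omega
  refine ⟨.cons hx.1 (q.concat hy.1.symm), ?_, ?_, ?_⟩
  · rw [Walk.cons_isPath_iff]
    refine ⟨hq.concat hyq _, ?_⟩
    simp [Walk.support_concat, hxq, hne']
  · simp [hlen]
    omega
  · intro w hw
    simp only [Walk.support_cons, Walk.support_concat, List.mem_cons,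
      List.mem_append, List.not_mem_nil, or_false] at hw
    rcases hw with rfl | hw | rfl
    · exact le_rfl
    · have := hsupp w hw
      omega
    · exact hxy.ge

theorem IsTree.dist_eq_of_isPath (hg : g.IsTree) {x y : W} {p : g.Walk x y} (hp : p.IsPath) :
    g.dist x y = p.length := by
  obtain ⟨q, hq, hlen⟩ := hg.connected.exists_path_of_dist x y
  rw [← hlen, (hg.existsUnique_path x y).unique hp hq]

theorem IsTree.dist_induce (hg : g.IsTree) {A : Set W} (hA : (g.induce A).Connected) (x y : A) :
    (g.induce A).dist x y = g.dist x.1 y.1 := by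
  obtain ⟨p, hp, hlen⟩ := hA.exists_path_of_dist x y
  have hp' := hp.map
    (f := (Embedding.induce A : g.induce A ↪g g).toHom) Subtype.val_injective
  have := hg.dist_eq_of_isPath hp'
  rw [Walk.length_map, hlen] at this
  exact this.symm

end SimpleGraph

namespace TModel

variable {r p d : ℕ} {G : PGraph p}

theorem dist_leaf (T : TModel r p d G) (v : G.V) : T.g.dist (T.leafEquiv v).1 T.root = d := by
  rw [SimpleGraph.dist_comm]
  exact (T.leafEquiv v).2

/-- The ancestor of a leaf that lies `l` levels above it. -/
noncomputable def ancestor (T : TModel r p d G) (l : ℕ) (v : G.V) : T.W :=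
  (T.g.parent T.root)^[l] (T.leafEquiv v).1

theorem ancestor_zero_injective (T : TModel r p d G) : Function.Injective (T.ancestor 0) :=
  Subtype.val_injective.comp T.leafEquiv.injective

theorem ancestor_height (T : TModel r p d G) (v : G.V) : T.ancestor d v = T.root := by
  have h := T.tree.connected.dist_iterate_parent (T.dist_leaf v).ge
  rw [T.dist_leaf, Nat.sub_self, T.tree.connected.dist_eq_zero_iff] at h
  exact h

theorem adj_iff_of_ancestor (T : TModel r p d G) {l : ℕ} (hl : l < d) {u v : G.V}
    (h : T.ancestor (l + 1) u = T.ancestor (l + 1) v) (hne : T.ancestor l u ≠ T.ancestor l v) :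
    G.adj u v ↔ (T.iLab u, T.iLab v, l + 1) ∈ T.S := by
  obtain ⟨q, hq, hlen, -⟩ := T.tree.connected.exists_path_of_iterate_parent l
    ((T.dist_leaf u).trans (T.dist_leaf v).symm) (by rwa [T.dist_leaf]) hne h
  refine T.edge_iff u v (fun h => hne (by rw [h])) (l + 1) ?_
  rw [T.tree.dist_eq_of_isPath hq, hlen]

theorem nonempty (T : TModel r p d G) : Nonempty G.V := by
  have h : ∀ k ≤ d, ∃ w, T.g.dist T.root w = k := by
    intro k
    induction k with
    | zero => exact fun _ => ⟨T.root, SimpleGraph.dist_self⟩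
    | succ k ih =>
      intro hk
      obtain ⟨w, hw⟩ := ih (by omega)
      obtain ⟨w', -, hw'⟩ := T.branch w (by omega)
      exact ⟨w', by omega⟩
  obtain ⟨w, hw⟩ := h d le_rfl
  exact ⟨T.leafEquiv.symm ⟨w, hw⟩⟩

/-- The nodes of the tree that lie above some leaf in `s`. -/
def above (T : TModel r p d G) (s : Set G.V) : Set T.W :=
  {w | ∃ v ∈ s, T.g.dist w T.root + T.g.dist w (T.leafEquiv v).1 = d}

theorem connected_induce_above (T : TModel r p d G) {s : Set G.V} (hs : s.Nonempty) :
    (T.g.induce (T.above s)).Connected := by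
  have hroot : T.root ∈ T.above s := by
    obtain ⟨v, hv⟩ := hs
    exact ⟨v, hv, by rw [SimpleGraph.dist_self, SimpleGraph.dist_comm, T.dist_leaf, zero_add]⟩
  have key : ∀ n, ∀ w (hw : w ∈ T.above s), T.g.dist w T.root = n →
      (T.g.induce (T.above s)).Reachable ⟨w, hw⟩ ⟨T.root, hroot⟩ := by
    intro n
    induction n with
    | zero =>
      intro w hw hn
      obtain rfl := T.tree.connected.dist_eq_zero_iff.1 hn
      rfl
    | succ n ih =>
      intro w hw hn
      obtain ⟨z, hwz, hz⟩ := T.tree.connected.exists_adj_dist_eq (x := w) (y := T.root) (by omega)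
      have hz' : z ∈ T.above s := by
        obtain ⟨v, hv, hvd⟩ := hw
        refine ⟨v, hv, ?_⟩
        have h₁ := T.tree.connected.dist_triangle (u := z) (v := w) (w := (T.leafEquiv v).1)
        have h₂ := T.tree.connected.dist_triangle (u := (T.leafEquiv v).1) (v := z) (w := T.root)
        rw [SimpleGraph.dist_eq_one_iff_adj.2 hwz.symm] at h₁
        rw [T.dist_leaf, SimpleGraph.dist_comm (u := (T.leafEquiv v).1)] at h₂
        omega
      have hadj : (T.g.induce (T.above s)).Adj ⟨w, hw⟩ ⟨z, hz'⟩ := hwz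
      exact hadj.reachable.trans (ih z hz' (by omega))
  have : Nonempty (T.above s) := ⟨⟨T.root, hroot⟩⟩
  exact ⟨fun x y => (key _ x.1 x.2 rfl).trans (key _ y.1 y.2 rfl).symm⟩

theorem mem_above_of_mem (T : TModel r p d G) {s : Set G.V} {v : G.V} (hv : v ∈ s) :
    (T.leafEquiv v).1 ∈ T.above s :=
  ⟨v, hv, by rw [SimpleGraph.dist_self, T.dist_leaf, add_zero]⟩

theorem mem_of_mem_above (T : TModel r p d G) {s : Set G.V} {v : G.V}
    (hv : (T.leafEquiv v).1 ∈ T.above s) : v ∈ s := by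
  obtain ⟨u, hu, h⟩ := hv
  rw [T.dist_leaf, Nat.add_eq_left, T.tree.connected.dist_eq_zero_iff] at h
  rwa [T.leafEquiv.injective (Subtype.ext h)]

/-- The tree model of an induced subgraph formed by the nodes above its vertices. -/
noncomputable def induce (T : TModel r p d G) (s : Set G.V) (hs : s.Nonempty) :
    TModel r p d (G.induce s) :=
  have hconn := T.connected_induce_above hs
  have hdist := T.tree.dist_induce hconn
  have hroot : T.root ∈ T.above s := by
    obtain ⟨v, hv⟩ := hs
    exact ⟨v, hv, by rw [SimpleGraph.dist_self, SimpleGraph.dist_comm, T.dist_leaf, zero_add]⟩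
  { W := T.above s
    g := T.g.induce (T.above s)
    tree := ⟨hconn, T.tree.isAcyclic.induce _⟩
    root := ⟨T.root, hroot⟩
    depthLe := fun w => by
      rw [hdist]
      exact T.depthLe w.1
    branch := by
      rintro ⟨w, v, hv, hvd⟩ hw
      rw [hdist, SimpleGraph.dist_comm] at hw
      obtain ⟨z, hwz, hz⟩ := T.tree.connected.exists_adj_dist_eq
        (x := w) (y := (T.leafEquiv v).1) (by simp only at hw; omega)
      have h₁ := T.tree.connected.dist_triangle (u := z) (v := w) (w := T.root)
      have h₂ := T.tree.connected.dist_triangle (u := (T.leafEquiv v).1) (v := z) (w := T.root)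
      rw [SimpleGraph.dist_eq_one_iff_adj.2 hwz.symm] at h₁
      rw [T.dist_leaf, SimpleGraph.dist_comm (u := (T.leafEquiv v).1)] at h₂
      refine ⟨⟨z, v, hv, by omega⟩, hwz, ?_⟩
      rw [hdist, hdist, SimpleGraph.dist_comm, SimpleGraph.dist_comm (v := w)]
      simp only
      omega
    leafEquiv :=
      { toFun := fun v => ⟨⟨(T.leafEquiv v.1).1, T.mem_above_of_mem v.2⟩, by
          rw [hdist]
          exact (T.leafEquiv v.1).2⟩
        invFun := fun w => ⟨T.leafEquiv.symm ⟨w.1.1, (hdist _ _).symm.trans w.2⟩,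
          T.mem_of_mem_above (by
            rw [Equiv.apply_symm_apply]
            exact w.1.2)⟩
        left_inv := fun v => Subtype.ext (T.leafEquiv.symm_apply_apply v.1)
        right_inv := fun w => by
          ext
          simp }
    iLab := fun v => T.iLab v.1
    S := T.S
    S_range := T.S_range
    S_symm := T.S_symm
    edge_iff := fun u v huv l h => by
      rw [hdist] at h
      exact T.edge_iff u.1 v.1 (fun h => huv (Subtype.ext h)) l h }

/-- Every finite set of vertices is contained in a finite set inducing a subgraph that satisfies a
given monadic sentence true in the whole graph. -/
theorem exists_finite_sat (T : TModel r p d G) {φ : MSOForm (Fin p)} (hφ : φ.IsSentence)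
    (hsat : G.toStr.Sat φ) {F : Set G.V} (hF : F.Finite) :
    ∃ s : Set G.V, s.Finite ∧ F ⊆ s ∧ (G.induce s).toStr.Sat φ := by
  obtain ⟨s, hs, hFs, -, htp⟩ := exists_finite_msoType_eq φ.qr G.adj
    (fun v => (T.iLab v, G.label v)) (fun l a b => (a.1, b.1, l + 1) ∈ T.S) T.ancestor
    T.ancestor_zero_injective d (fun l hl u v => T.adj_iff_of_ancestor hl) le_rfl Set.univ
    (fun u _ v _ => (T.ancestor_height u).trans (T.ancestor_height v).symm) F hF
    (Set.subset_univ F)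
  refine ⟨s, hs, hFs, fun v' s' => ?_⟩
  rw [← msoType_subtype] at htp
  have hcode : ∀ (H : PGraph p) (c : H.V → Fin r × Fin p) (v : ℕ → H.V) (t : ℕ → Set H.V),
      (∀ u, (c u).2 = H.label u) → H.toStr.Coded c (fun a x => x.2 = a) φ.freeFO φ.freeSO
        (fun _ _ => True) (fun _ _ => True) v t := by
    intro H c v t hc
    exact ⟨fun a u => iff_of_eq (congrArg (fun x => x = a) (hc u).symm), by simp [hφ.1], by simp [hφ.2]⟩
  exact (MStr.realize_iff_of_msoType φ le_rfl
    (hcode (G.induce s) (fun a => (T.iLab a.1, G.label a.1)) v' s' fun _ => rfl)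
    (hcode G (fun a => (T.iLab a, G.label a)) (fun i => (v' i).1) (fun _ => ∅) fun _ => rfl)
    htp).2 (hsat _ _)

end TModel

/-- The graphs of `TM(r,p,d)` are MSO-pseudo-finite: every MSO sentence holding
in a graph of the class also holds in a finite induced labeled subgraph of it
belonging to the class; and if the graph is infinite, in infinitely many
pairwise distinct such finite induced labeled subgraphs. -/
theorem stmt17 (r p d : ℕ) (G : PGraph p) (hG : G ∈ TM r p d)
    (φ : MSOForm (Fin p)) (hφ : φ.IsSentence) (hsat : G.toStr.Sat φ) :
    (∃ s : Set G.V, s.Finite ∧ G.induce s ∈ TM r p d ∧ (G.induce s).toStr.Sat φ) ∧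
    (Infinite G.V →
      ∃ S : Set (Set G.V), S.Infinite ∧
        ∀ s ∈ S, s.Finite ∧ G.induce s ∈ TM r p d ∧ (G.induce s).toStr.Sat φ) := by
  obtain ⟨T⟩ := hG
  obtain ⟨x₀⟩ := T.nonempty
  have key : ∀ x : G.V, ∃ s : Set G.V, x ∈ s ∧
      s.Finite ∧ G.induce s ∈ TM r p d ∧ (G.induce s).toStr.Sat φ := by
    intro x
    obtain ⟨s, hs, hxs, hsφ⟩ := T.exists_finite_sat hφ hsat (Set.finite_singleton x)
    have hx : x ∈ s := hxs rfl
    exact ⟨s, hx, hs, ⟨T.induce s ⟨x, hx⟩⟩, hsφ⟩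
  refine ⟨(key x₀).imp fun s hs => hs.2, fun hinf => ?_⟩
  refine ⟨{s | s.Finite ∧ G.induce s ∈ TM r p d ∧ (G.induce s).toStr.Sat φ}, fun hfin => ?_,
    fun s hs => hs⟩
  refine Set.infinite_univ (α := G.V) ((hfin.sUnion fun s hs => hs.1).subset fun x _ => ?_)
  obtain ⟨s, hx, hs⟩ := key x
  exact Set.mem_sUnion_of_mem hx hs
end

section
/- Let r, p, d ∈ ℕ. The class TM(r,p,d) satisfies the extended MSO-Löwenheim–Skolem property with a (d+1)-fold exponential witness function: there exist a constant c ∈ ℕ and a strictly increasing function f : ℕ → ℕ with f(n) ≤ tower(d+1, c·(n+1)·(n+1+⌈log₂ r⌉+⌈log₂ p⌉)) for all n, such that for every graph G ∈ TM(r,p,d) whose cardinality lies in the η-th scale of f (for a cardinal η), the following hold for every cardinal λ. Downward: if λ ≤ η, then (i) if λ is finite, there exists H ∈ TM(r,p,d) that is an induced labeled subgraph of G with |H| in the λ-th scale of f and H ≡^MSO_λ G, and (ii) if λ is infinite, there exists H ∈ TM(r,p,d) that is an induced labeled subgraph of G with |H| = λ and H satisfying exactly the same MSO sentences as G. Upward: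 if λ ≥ η, then (i) if η is finite, there exists H ∈ TM(r,p,d) containing G as an induced labeled subgraph with |H| in the λ-th scale of f and H ≡^MSO_η G, and (ii) if η is infinite, there exists H ∈ TM(r,p,d) containing G as an induced labeled subgraph with |H| = λ and H satisfying exactly the same MSO sentences as G. -/
open Cardinal

/-- `inScale f η c` : the cardinal `c` lies in the `η`-th scale of the (strictly
increasing) function `f`, i.e. `f η < c ≤ f (η+1)` for finite `η`, and `c = η`
for infinite `η`. -/
def inScale (f : ℕ → ℕ) (η c : Cardinal) : Prop :=
  (∃ i : ℕ, η = (i : Cardinal) ∧ ((f i : ℕ) : Cardinal) < c ∧ c ≤ ((f (i + 1) : ℕ) : Cardinal)) ∨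
  (Cardinal.aleph0 ≤ η ∧ c = η)

/-- `G` and `H` satisfy exactly the same MSO sentences. -/
def PGraph.MSOEqv {p : ℕ} (G H : PGraph p) : Prop :=
  ∀ φ : MSOForm (Fin p), φ.IsSentence → (G.toStr.Sat φ ↔ H.toStr.Sat φ)

section Truncation

/-- Truncation of an extended natural number at the threshold `s`. -/
noncomputable def trunc (s : ℕ) (a : ℕ∞) : Fin (s + 1) :=
  ⟨(min a s).toNat, by
    have h : min a (s : ℕ∞) ≤ s := min_le_right _ _
    have := ENat.toNat_le_of_le_natCast h
    omega⟩

theorem trunc_eq_trunc_iff {s : ℕ} {a b : ℕ∞} : trunc s a = trunc s b ↔ min a s = min b s := by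
  have h : ∀ x : ℕ∞, min x (s : ℕ∞) ≠ ⊤ := fun x =>
    ne_top_of_le_ne_top (ENat.natCast_ne_top s) (min_le_right _ _)
  rw [trunc, trunc, Fin.mk.injEq]
  refine ⟨fun hab => ?_, fun hab => by rw [hab]⟩
  rw [← ENat.natCast_toNat (h a), ← ENat.natCast_toNat (h b), hab]

theorem le_iff_of_min_eq {s j : ℕ} {a b : ℕ∞} (h : min a s = min b s) (hj : j ≤ s) :
    (j : ℕ∞) ≤ a ↔ (j : ℕ∞) ≤ b := by
  have hj' : (j : ℕ∞) ≤ s := by exact_mod_cast hj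
  constructor
  · intro ha
    have : (j : ℕ∞) ≤ min a s := le_min ha hj'
    rw [h] at this
    exact this.trans (min_le_left _ _)
  · intro ha
    have : (j : ℕ∞) ≤ min b s := le_min ha hj'
    rw [← h] at this
    exact this.trans (min_le_left _ _)

theorem min_eq_of_forall_le_iff {s : ℕ} {a b : ℕ∞}
    (h : ∀ j : ℕ, j ≤ s → ((j : ℕ∞) ≤ a ↔ (j : ℕ∞) ≤ b)) : min a s = min b s := by
  have key : ∀ {a b : ℕ∞}, (∀ j : ℕ, j ≤ s → (j : ℕ∞) ≤ a → (j : ℕ∞) ≤ b) →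
      min a (s : ℕ∞) ≤ min b s := by
    intro a b h
    have hne : min a (s : ℕ∞) ≠ ⊤ := ne_top_of_le_ne_top (ENat.natCast_ne_top s) (min_le_right _ _)
    obtain ⟨k, hk⟩ := ENat.ne_top_iff_exists.mp hne
    have hks : k ≤ s := by
      have : (k : ℕ∞) ≤ s := hk ▸ min_le_right _ _
      exact_mod_cast this
    refine le_min ?_ (min_le_right _ _)
    rw [← hk]
    exact h k hks (hk ▸ min_le_left _ _)
  exact le_antisymm (key fun j hj => (h j hj).1) (key fun j hj => (h j hj).2)

theorem min_add_eq_min_add {s a b c d : ℕ∞} (h : min a s = min b s) (h' : min c s = min d s) :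
    min (a + c) s = min (b + d) s := by
  have key : ∀ x y : ℕ∞, min (x + y) s = min (min x s + min y s) s := by
    intro x y
    rcases le_total s x with hx | hx
    · rw [min_eq_right hx, min_eq_right (hx.trans le_self_add), min_eq_right le_self_add]
    · rcases le_total s y with hy | hy
      · rw [min_eq_right hy, min_eq_right (hy.trans le_add_self), min_eq_right le_add_self]
      · rw [min_eq_left hx, min_eq_left hy]
  rw [key, h, h', ← key]

theorem min_sum_eq_min_sum {ι : Type*} {s : ℕ∞} (t : Finset ι) {a b : ι → ℕ∞}
    (h : ∀ i, min (a i) s = min (b i) s) : min (∑ i ∈ t, a i) s = min (∑ i ∈ t, b i) s := by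
  classical
  induction t using Finset.induction_on with
  | empty => simp
  | insert i t hi ih => rw [Finset.sum_insert hi, Finset.sum_insert hi]; exact min_add_eq_min_add (h i) ih

theorem natCast_le_encard_iff {α : Type*} {A : Set α} {j : ℕ} :
    (j : ℕ∞) ≤ A.encard ↔ ∃ f : Fin j → α, Function.Injective f ∧ ∀ i, f i ∈ A := by
  constructor
  · intro h
    obtain ⟨B, hBA, hB⟩ := Set.exists_subset_encard_eq h
    have hfin : B.Finite := Set.finite_of_encard_eq_coe hB
    have : Nat.card B = j := by
      rw [Nat.card_coe_set_eq, Set.ncard_def, hB]; simp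
    have := hfin.to_subtype
    let e : B ≃ Fin j := Finite.equivFinOfCardEq ‹_›
    exact ⟨fun i => (e.symm i).1, fun a b hab => e.symm.injective (Subtype.ext hab),
      fun i => hBA (e.symm i).2⟩
  · rintro ⟨f, hf, hfA⟩
    have h1 : (Set.range f).encard = j := by
      rw [← Set.image_univ, hf.encard_image]; simp
    rw [← h1]
    exact Set.encard_le_encard (by rintro _ ⟨i, rfl⟩; exact hfA i)

end Truncation

section Recolouring

theorem exists_recolouring_single {P Q K : Type} [Finite K] {N s : ℕ} (hs : 1 ≤ s)
    (hN : s * Nat.card K ≤ N) (hN0 : 1 ≤ N)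
    (hPQ : min (ENat.card P) N = min (ENat.card Q) N) (t : P → K) :
    ∃ g : Q → P, ∀ k, min {y | t (g y) = k}.encard s = min {x | t x = k}.encard s := by
  classical
  by_cases hlt : ENat.card P < N
  · have hQ : ENat.card P = ENat.card Q := by
      rw [min_eq_left hlt.le] at hPQ
      rcases le_total (ENat.card Q) N with h | h
      · rwa [min_eq_left h] at hPQ
      · rw [min_eq_right h] at hPQ
        exact absurd hPQ hlt.ne
    have : Finite P := ENat.card_lt_top.mp (hlt.trans (ENat.natCast_lt_top N))
    have : Finite Q := ENat.card_lt_top.mp (hQ ▸ hlt.trans (ENat.natCast_lt_top N))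
    have hc : Nat.card Q = Nat.card P := by
      rw [ENat.card_eq_coe_natCard, ENat.card_eq_coe_natCard] at hQ
      exact_mod_cast hQ.symm
    let e : Q ≃ P := (Finite.equivFinOfCardEq hc).trans (Finite.equivFin P).symm
    refine ⟨e, fun k => ?_⟩
    congr 1
    have : {y | t (e y) = k} = e.symm '' {x | t x = k} := by
      ext y; simp
    rw [this, e.symm.injective.encard_image]
  · have hP : (N : ℕ∞) ≤ ENat.card P := not_lt.mp hlt
    have hQ : (N : ℕ∞) ≤ ENat.card Q := (le_iff_of_min_eq hPQ le_rfl).1 hP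
    -- some colour is used at least `s` times
    have hk0 : ∃ k, (s : ℕ∞) ≤ {x | t x = k}.encard := by
      by_contra! hcon
      have hU : (Set.univ : Set P) = ⋃ k, {x | t x = k} := by ext; simp
      have hfin : ∀ k, {x | t x = k}.Finite := fun k =>
        Set.encard_lt_top_iff.mp ((hcon k).trans (ENat.natCast_lt_top s))
      have : Finite P := Set.finite_univ_iff.mp (hU ▸ Set.finite_iUnion hfin)
      have := Fintype.ofFinite K
      have := Fintype.ofFinite P
      have hcard : Fintype.card P = ∑ k, (Finset.univ.filter fun x => t x = k).card :=
        Finset.card_eq_sum_card_fiberwise (fun x _ => Finset.mem_univ _)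
      have hlt' : ∀ k, (Finset.univ.filter fun x => t x = k).card < s := by
        intro k
        have := hcon k
        have this_eq : {x | t x = k} = (↑(Finset.univ.filter fun x => t x = k) : Set P) := by simp
        rw [this_eq, Set.encard_coe_eq_coe_finsetCard] at this; exact_mod_cast this
      have hP' : N ≤ Fintype.card P := by simpa using hP
      have hne : Nonempty P := Fintype.card_pos_iff.mp (by omega)
      have : Nonempty K := hne.map t
      have : ∑ k : K, (Finset.univ.filter fun x => t x = k).card < ∑ _k : K, s :=
        Finset.sum_lt_sum_of_nonempty Finset.univ_nonempty fun k _ => hlt' k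
      rw [← hcard] at this
      simp only [Finset.sum_const, Finset.card_univ, smul_eq_mul] at this
      rw [Nat.card_eq_fintype_card] at hN
      have : s * Fintype.card K = Fintype.card K * s := mul_comm _ _
      omega
    obtain ⟨k0, hk0⟩ := hk0
    obtain ⟨j, hj⟩ : ∃ j : K × Fin s → Q, Function.Injective j := by
      have h1 : (N : ℕ∞) ≤ (Set.univ : Set Q).encard := by rwa [Set.encard_univ]
      obtain ⟨f, hf, -⟩ := natCast_le_encard_iff.1 h1
      have hc : Nat.card (K × Fin s) ≤ N := by
        rw [Nat.card_prod, Nat.card_fin, mul_comm]; exact hN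
      let e := Finite.equivFin (K × Fin s)
      exact ⟨fun x => f (Fin.castLE hc (e x)),
        fun x y hxy => e.injective (Fin.castLE_injective hc (hf hxy))⟩
    have hfib : ∀ y : Q, ∃ k, (∃ x, t x = k) ∧
        ((∀ k' i, y = j (k', i) → ((i : ℕ) : ℕ∞) < {x | t x = k'}.encard → k = k') ∧
        (k ≠ k0 → ∃ i, y = j (k, i) ∧ ((i : ℕ) : ℕ∞) < {x | t x = k}.encard)) := by
      intro y
      by_cases h : ∃ k i, y = j (k, i) ∧ ((i : ℕ) : ℕ∞) < {x | t x = k}.encard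
      · obtain ⟨k, i, hy, hi⟩ := h
        refine ⟨k, ?_, ?_, fun _ => ⟨i, hy, hi⟩⟩
        · exact Set.encard_pos.1 (lt_of_le_of_lt (zero_le) hi)
        · intro k' i' hy' _
          have := hj (hy.symm.trans hy')
          simp at this; exact this.1
      · push Not at h
        refine ⟨k0, ?_, ?_, fun h => absurd rfl h⟩
        · have : (0 : ℕ∞) < {x | t x = k0}.encard := lt_of_lt_of_le (by exact_mod_cast hs) hk0
          exact Set.encard_pos.1 this
        · intro k' i hy hi
          exact absurd hi (not_lt.mpr (h k' i hy))
    choose col hcol hcol1 hcol2 using hfib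
    choose g hg using hcol
    refine ⟨g, fun k => ?_⟩
    simp only [hg]
    apply min_eq_of_forall_le_iff
    intro l hl
    by_cases hk : k = k0
    · subst hk
      have hl' : (l : ℕ∞) ≤ s := by exact_mod_cast hl
      refine iff_of_true ?_ (hl'.trans hk0)
      refine natCast_le_encard_iff.2 ⟨fun i => j (k, Fin.castLE hl i), fun a b hab => ?_, fun i => ?_⟩
      · have := hj hab
        simpa using this
      · refine hcol1 _ k (Fin.castLE hl i) rfl (lt_of_lt_of_le ?_ hk0)
        exact_mod_cast (Fin.castLE hl i).2
    · rw [natCast_le_encard_iff]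
      constructor
      · rintro ⟨f, hf, hfk⟩
        choose i hi1 hi2 using fun a => hcol2 (f a) (by rw [show col (f a) = k from hfk a]; exact hk)
        by_contra hcon
        have hcon : {x | t x = k}.encard < l := not_le.mp hcon
        obtain ⟨n, hn⟩ := ENat.ne_top_iff_exists.mp (ne_top_of_lt hcon)
        have hnl : n < l := by rw [← hn] at hcon; exact_mod_cast hcon
        have hlt : ∀ a, (i a : ℕ) < n := by
          intro a
          have := hi2 a
          rw [show col (f a) = k from hfk a, ← hn] at this
          exact_mod_cast this
        have hinj : Function.Injective fun a => (⟨i a, hlt a⟩ : Fin n) := by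
          intro a b hab
          simp only [Fin.mk.injEq] at hab
          apply hf
          rw [hi1 a, hi1 b, show col (f a) = k from hfk a, show col (f b) = k from hfk b,
            Fin.ext hab]
        have := Fintype.card_le_of_injective _ hinj
        simp at this; omega
      · intro hle
        refine ⟨fun i => j (k, Fin.castLE hl i), fun a b hab => ?_, fun i => ?_⟩
        · have := hj hab
          simpa using this
        · refine hcol1 _ k (Fin.castLE hl i) rfl (lt_of_lt_of_le ?_ hle)
          exact_mod_cast i.2

theorem encard_eq_sum_fibers {P I K : Type} [Fintype I] (p : P → I) (t : P → K) (k : K) :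
    {x | t x = k}.encard = ∑ i, {x : {x // p x = i} | t x.1 = k}.encard := by
  have h : {x | t x = k} = ⋃ i, Subtype.val '' {x : {x // p x = i} | t x.1 = k} := by
    ext x; simp
  rw [h, Set.encard_iUnion_of_finite, finsum_eq_sum_of_fintype]
  · refine Finset.sum_congr rfl fun i _ => Subtype.val_injective.encard_image _
  · intro i i' hii
    rw [Function.onFun, Set.disjoint_left]
    rintro _ ⟨x, -, rfl⟩ ⟨y, -, hxy⟩
    exact hii (by rw [← x.2, ← y.2, hxy])

theorem exists_recolouring {P Q I K : Type} [Finite I] [Finite K] {N s : ℕ} (hs : 1 ≤ s)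
    (hN : s * Nat.card K ≤ N) (hN0 : 1 ≤ N) (p : P → I) (q : Q → I)
    (hpq : ∀ i, min {x | p x = i}.encard N = min {y | q y = i}.encard N) (t : P → K) :
    ∃ g : Q → P, (∀ y, p (g y) = q y) ∧
      ∀ k, min {y | t (g y) = k}.encard s = min {x | t x = k}.encard s := by
  have := Fintype.ofFinite I
  have h : ∀ i, ∃ g : {y // q y = i} → {x // p x = i},
      ∀ k, min {y | t (g y).1 = k}.encard s = min {x : {x // p x = i} | t x.1 = k}.encard s :=
    fun i => exists_recolouring_single hs hN hN0 (hpq i) (fun x : {x // p x = i} => t x.1)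
  choose g hg using h
  refine ⟨fun y => (g (q y) ⟨y, rfl⟩).1, fun y => (g (q y) ⟨y, rfl⟩).2, fun k => ?_⟩
  rw [encard_eq_sum_fibers q, encard_eq_sum_fibers p t]
  apply min_sum_eq_min_sum
  intro i
  rw [← hg i k]
  congr 2
  ext ⟨y, hy⟩
  subst hy
  rfl

end Recolouring

/-- Types of height-`h` classes over the colours `B`, with class multiplicities at level `h`
counted up to the threshold `s h`. -/
def Ty (B : Type) (s : ℕ → ℕ) : ℕ → Type
  | 0 => B
  | h + 1 => Ty B s h → Fin (s h + 1)

instance Ty.finite {B : Type} [Finite B] (s : ℕ → ℕ) : ∀ h, Finite (Ty B s h)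
  | 0 => inferInstanceAs (Finite B)
  | h + 1 =>
    have := Ty.finite (B := B) s h
    inferInstanceAs (Finite (Ty B s h → Fin (s h + 1)))

section Types

variable {V B : Type}

/-- The type of the class of `x` at level `h` of a chain `e` of equivalence relations with
colouring `c`. -/
noncomputable def ty (e : ℕ → Setoid V) (c : V → B) (s : ℕ → ℕ) : (h : ℕ) → V → Ty B s h
  | 0, x => c x
  | h + 1, x => fun τ =>
      trunc (s h) {q : Quotient (e h) | e (h + 1) x q.out ∧ ty e c s h q.out = τ}.encard

/-- The classes of level `h` and type `τ` inside the level `h + 1` class of `x`. -/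
def kids (e : ℕ → Setoid V) (c : V → B) (s : ℕ → ℕ) (h : ℕ) (x : V) (τ : Ty B s h) :
    Set (Quotient (e h)) :=
  {q | e (h + 1) x q.out ∧ ty e c s h q.out = τ}

theorem ty_succ (e : ℕ → Setoid V) (c : V → B) (s : ℕ → ℕ) (h : ℕ) (x : V) (τ : Ty B s h) :
    ty e c s (h + 1) x τ = trunc (s h) (kids e c s h x τ).encard := rfl

theorem ty_succ_eq_iff {V' : Type} {e : ℕ → Setoid V} {e' : ℕ → Setoid V'} {c : V → B}
    {c' : V' → B} {s : ℕ → ℕ} {h : ℕ} {x : V} {x' : V'} :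
    ty e c s (h + 1) x = ty e' c' s (h + 1) x' ↔
      ∀ τ, min (kids e c s h x τ).encard (s h) = min (kids e' c' s h x' τ).encard (s h) := by
  refine Iff.trans (show _ ↔ ∀ τ, ty e c s (h + 1) x τ = ty e' c' s (h + 1) x' τ from
    funext_iff) ?_
  exact forall_congr' fun τ => by rw [ty_succ, ty_succ, trunc_eq_trunc_iff]

theorem mk_eq_iff_rel {r : Setoid V} {x y : V} :
    (Quotient.mk r x = Quotient.mk r y) ↔ r x y := Quotient.eq

theorem rel_out (r : Setoid V) (x : V) : r (Quotient.mk r x).out x :=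
  Quotient.exact (Quotient.out_eq _)

variable {e : ℕ → Setoid V} {c : V → B} {s : ℕ → ℕ}

theorem kids_congr {h : ℕ} {x y : V} (hxy : e (h + 1) x y) (τ : Ty B s h) :
    kids e c s h x τ = kids e c s h y τ := by
  ext q
  exact and_congr_left fun _ =>
    ⟨fun hq => (e _).trans ((e _).symm hxy) hq, fun hq => (e _).trans hxy hq⟩

theorem ty_congr (h0 : e 0 = ⊥) {h : ℕ} {x y : V} (hxy : e h x y) :
    ty e c s h x = ty e c s h y := by
  cases h with
  | zero =>
    rw [h0] at hxy
    obtain rfl : x = y := hxy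
    rfl
  | succ h =>
    rw [ty_succ_eq_iff]
    intro τ
    rw [kids_congr hxy]

theorem rel_mono (hm : Monotone e) {k h : ℕ} (hkh : k ≤ h) {x y : V} (hxy : e k x y) : e h x y :=
  hm hkh hxy

theorem mk_mem_kids (h0 : e 0 = ⊥) (hm : Monotone e) {h : ℕ} {x y : V} (hxy : e (h + 1) x y) :
    Quotient.mk (e h) y ∈ kids e c s h x (ty e c s h y) :=
  ⟨(e _).trans hxy (rel_mono hm (Nat.le_succ h) ((e h).symm (rel_out (e h) y))),
    ty_congr h0 (rel_out (e h) y)⟩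

/-- The type of a class only depends on the colours of its elements. -/
theorem ty_eq_of_eqOn (hm : Monotone e) {c₁ c₂ : V → B} :
    ∀ {h : ℕ} {x : V}, (∀ z, e h x z → c₁ z = c₂ z) → ty e c₁ s h x = ty e c₂ s h x
  | 0, x, hc => hc x ((e 0).refl x)
  | h + 1, x, hc => by
    rw [ty_succ_eq_iff]
    intro τ
    congr 2
    ext q
    refine and_congr_right fun hq => ?_
    rw [ty_eq_of_eqOn hm fun z hz => hc z ((e _).trans hq (rel_mono hm (Nat.le_succ h) hz))]

variable {V' : Type} {e' : ℕ → Setoid V'} {c' : V' → B}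

theorem exists_kid {h : ℕ} {x : V} {x' : V'} (hs : 1 ≤ s h)
    (hty : ty e c s (h + 1) x = ty e' c' s (h + 1) x') {τ : Ty B s h}
    {q : Quotient (e h)} (hq : q ∈ kids e c s h x τ) : ∃ q', q' ∈ kids e' c' s h x' τ := by
  have h1 := (le_iff_of_min_eq (ty_succ_eq_iff.1 hty τ) hs).1
    (by rw [Nat.cast_one, Set.one_le_encard_iff_nonempty]; exact ⟨q, hq⟩)
  rw [Nat.cast_one, Set.one_le_encard_iff_nonempty] at h1
  exact h1

theorem exists_kid_pair {h : ℕ} {x : V} {x' : V'} (hs : 2 ≤ s h)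
    (hty : ty e c s (h + 1) x = ty e' c' s (h + 1) x') {τ₁ τ₂ : Ty B s h}
    {q₁ q₂ : Quotient (e h)} (hq₁ : q₁ ∈ kids e c s h x τ₁) (hq₂ : q₂ ∈ kids e c s h x τ₂)
    (hne : q₁ ≠ q₂) :
    ∃ q₁' q₂', q₁' ∈ kids e' c' s h x' τ₁ ∧ q₂' ∈ kids e' c' s h x' τ₂ ∧ q₁' ≠ q₂' := by
  by_cases hτ : τ₁ = τ₂
  · subst hτ
    have h1 := (le_iff_of_min_eq (ty_succ_eq_iff.1 hty τ₁) hs).1 (by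
      rw [natCast_le_encard_iff]
      refine ⟨![q₁, q₂], ?_, fun i => by fin_cases i <;> assumption⟩
      intro a b hab
      fin_cases a <;> fin_cases b <;> simp_all)
    obtain ⟨f, hf, hfm⟩ := natCast_le_encard_iff.1 h1
    exact ⟨f 0, f 1, hfm 0, hfm 1, fun hEq => by simpa using hf hEq⟩
  · obtain ⟨q₁', h₁⟩ := exists_kid (by omega) hty hq₁
    obtain ⟨q₂', h₂⟩ := exists_kid (by omega) hty hq₂
    exact ⟨q₁', q₂', h₁, h₂, fun hEq => hτ (by rw [← h₁.2, ← h₂.2, hEq])⟩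

/-- Equal types realise the same pairs of colours at the same levels. -/
theorem exists_pair_of_ty_eq (h0 : e 0 = ⊥) (hm : Monotone e) (hm' : Monotone e') (hs : ∀ h, 2 ≤ s h) :
    ∀ (h : ℕ) (u : V) (u' : V'), ty e c s h u = ty e' c' s h u' →
      ∀ x y, e h u x → e h u y → ∃ x' y', e' h u' x' ∧ e' h u' y' ∧ c' x' = c x ∧ c' y' = c y ∧
        ∀ l ≤ h, (e l x y ↔ e' l x' y') := by
  intro h
  induction h with
  | zero =>
    intro u u' hty x y hx hy
    rw [h0] at hx hy
    obtain rfl : u = x := hx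
    obtain rfl : u = y := hy
    refine ⟨u', u', (e' 0).refl _, (e' 0).refl _, hty.symm, hty.symm, fun l _ => ?_⟩
    exact iff_of_true ((e l).refl _) ((e' l).refl _)
  | succ h ih =>
    intro u u' hty x y hx hy
    have hle : h ≤ h + 1 := Nat.le_succ h
    have hxk := mk_mem_kids (c := c) (s := s) h0 hm hx
    have hyk := mk_mem_kids (c := c) (s := s) h0 hm hy
    by_cases hxy : e h x y
    · obtain ⟨q', hq'⟩ := exists_kid (by have := hs h; omega) hty hxk
      obtain ⟨x', y', hx', hy', hcx, hcy, hl⟩ :=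
        ih x q'.out hq'.2.symm x y ((e h).refl x) hxy
      refine ⟨x', y', (e' _).trans hq'.1 (rel_mono hm' hle hx'),
        (e' _).trans hq'.1 (rel_mono hm' hle hy'), hcx, hcy, fun l hlh => ?_⟩
      rcases Nat.lt_or_ge h l with hlt | hge
      · obtain rfl : l = h + 1 := by omega
        exact iff_of_true (rel_mono hm hle hxy)
          (rel_mono hm' hle ((e' h).trans ((e' h).symm hx') hy'))
      · exact hl l hge
    · obtain ⟨q₁, q₂, h₁, h₂, hne⟩ := exists_kid_pair (hs h) hty hxk hyk
        (fun hEq => hxy (mk_eq_iff_rel.1 hEq))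
      obtain ⟨x', -, hx', -, hcx, -, -⟩ :=
        ih x q₁.out h₁.2.symm x x ((e h).refl x) ((e h).refl x)
      obtain ⟨y', -, hy', -, hcy, -, -⟩ :=
        ih y q₂.out h₂.2.symm y y ((e h).refl y) ((e h).refl y)
      have hx'' := (e' _).trans h₁.1 (rel_mono hm' hle hx')
      have hy'' := (e' _).trans h₂.1 (rel_mono hm' hle hy')
      refine ⟨x', y', hx'', hy'', hcx, hcy, fun l hlh => ?_⟩
      rcases Nat.lt_or_ge h l with hlt | hge
      · obtain rfl : l = h + 1 := by omega
        exact iff_of_true ((e _).trans ((e _).symm hx) hy) ((e' _).trans ((e' _).symm hx'') hy'')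
      · refine iff_of_false (fun hc => hxy (rel_mono hm hge hc)) (fun hc => hne ?_)
        have : e' h q₁.out q₂.out :=
          (e' h).trans hx' ((e' h).trans (rel_mono hm' hge hc) ((e' h).symm hy'))
        rw [← Quotient.out_eq q₁, ← Quotient.out_eq q₂]
        exact Quotient.sound this

/-- The colouring refined by a set of vertices. -/
noncomputable def addMark (c : V → B) (X : Set V) : V → B × Bool :=
  fun x => (c x, @decide (x ∈ X) (Classical.dec _))

theorem addMark_snd {X : Set V} {x : V} : (addMark c X x).2 = true ↔ x ∈ X := by
  simp [addMark]

/-- Back-and-forth: a set on one side is answered by a set on the other side, at the price of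
lowering the thresholds. -/
theorem exists_mark_of_ty_eq [Finite B] (hm' : Monotone e') {s₁ : ℕ → ℕ} (hs : ∀ h, 1 ≤ s h) (hs₁ : ∀ h, 1 ≤ s₁ h)
    (hs₁s : ∀ h, s h * Nat.card (Ty (B × Bool) s h) ≤ s₁ h) (X : Set V) :
    ∀ (h : ℕ) (u : V) (u' : V'), ty e c s₁ h u = ty e' c' s₁ h u' →
      ∃ X' : Set V', ty e (addMark c X) s h u = ty e' (addMark c' X') s h u' := by
  intro h
  induction h with
  | zero =>
    intro u u' hty
    have hc : c u = c' u' := hty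
    by_cases hu : u ∈ X
    · exact ⟨Set.univ, by simp [ty, addMark, hc, hu]; rfl⟩
    · exact ⟨∅, by simp [ty, addMark, hc, hu]; rfl⟩
  | succ h ih =>
    intro u u' hty
    obtain ⟨g, hg, hgc⟩ := exists_recolouring (P := {q : Quotient (e h) // e (h + 1) u q.out})
      (Q := {q : Quotient (e' h) // e' (h + 1) u' q.out}) (hs h) (hs₁s h) (hs₁ h)
      (fun q => ty e c s₁ h q.1.out) (fun q => ty e' c' s₁ h q.1.out)
      (fun τ => by
        have := ty_succ_eq_iff.1 hty τ
        rw [← Subtype.val_injective.encard_image, ← Subtype.val_injective.encard_image]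
        convert this using 3 <;> ext q <;> simp [kids, and_comm])
      (fun q => ty e (addMark c X) s h q.1.out)
    choose X' hX' using fun q : {q : Quotient (e' h) // e' (h + 1) u' q.out} =>
      ih (g q).1.out q.1.out (hg q)
    let Y : Set V' := {z | ∃ q : {q : Quotient (e' h) // e' (h + 1) u' q.out},
      q.1 = Quotient.mk (e' h) z ∧ z ∈ X' q}
    have hY : ∀ q : {q : Quotient (e' h) // e' (h + 1) u' q.out},
        ty e' (addMark c' Y) s h q.1.out = ty e (addMark c X) s h (g q).1.out := by
      intro q
      rw [hX' q]
      apply ty_eq_of_eqOn hm'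
      intro z hz
      have hzq : q.1 = Quotient.mk (e' h) z := by
        rw [← Quotient.out_eq q.1]; exact Quotient.sound hz
      have : z ∈ Y ↔ z ∈ X' q := by
        constructor
        · rintro ⟨q', hq', hz'⟩
          obtain rfl : q' = q := Subtype.ext (hq'.trans hzq.symm)
          exact hz'
        · exact fun hz' => ⟨q, hzq, hz'⟩
      simp [addMark, this]
    refine ⟨Y, ?_⟩
    rw [ty_succ_eq_iff]
    intro τ
    have := hgc τ
    rw [← Subtype.val_injective.encard_image, ← Subtype.val_injective.encard_image] at this
    convert this.symm using 3
    · ext q; simp [kids, and_comm]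
    · ext q
      constructor
      · rintro ⟨h1, h2⟩
        exact ⟨⟨q, h1⟩, by rw [Set.mem_ofPred_eq, ← hY]; exact h2, rfl⟩
      · rintro ⟨q, h2, rfl⟩
        exact ⟨q.2, by rw [hY]; exact h2⟩

/-- Back-and-forth for elements. -/
theorem exists_mark_singleton_of_ty_eq [Finite B] (h0 : e 0 = ⊥) (h0' : e' 0 = ⊥)
    (hm : Monotone e) (hm' : Monotone e') {s₁ : ℕ → ℕ} (hs : ∀ h, 2 ≤ s h) (hs₁ : ∀ h, 1 ≤ s₁ h)
    (hs₁s : ∀ h, s h * Nat.card (Ty (B × Bool) s h) ≤ s₁ h) {d : ℕ} (hd : e d = ⊤)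
    (hd' : e' d = ⊤) {u : V} {u' : V'} (hty : ty e c s₁ d u = ty e' c' s₁ d u') (x : V) :
    ∃ x', ty e (addMark c {x}) s d u = ty e' (addMark c' {x'}) s d u' := by
  obtain ⟨X', hX'⟩ := exists_mark_of_ty_eq hm' (fun h => (Nat.le_succ 1).trans (hs h)) hs₁ hs₁s
    {x} d u u' hty
  have hall : ∀ x y, e d x y := fun x y => by rw [hd]; trivial
  have hall' : ∀ x y, e' d x y := fun x y => by rw [hd']; trivial
  obtain ⟨x', -, -, -, hx', -, -⟩ :=
    exists_pair_of_ty_eq h0 hm hm' hs d u u' hX' x x (hall _ _) (hall _ _)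
  have hmem : x' ∈ X' := addMark_snd.1 (by rw [hx']; exact addMark_snd.2 rfl)
  refine ⟨x', ?_⟩
  rw [hX']
  congr
  refine Set.eq_singleton_iff_unique_mem.2 ⟨hmem, fun y' hy' => ?_⟩
  obtain ⟨x₁, y₁, -, -, hx₁, hy₁, hl⟩ :=
    exists_pair_of_ty_eq h0' hm' hm hs d u' u hX'.symm x' y' (hall' _ _) (hall' _ _)
  have e1 : x₁ ∈ ({x} : Set V) := addMark_snd.1 (by rw [hx₁]; exact addMark_snd.2 hmem)
  have e2 : y₁ ∈ ({x} : Set V) := addMark_snd.1 (by rw [hy₁]; exact addMark_snd.2 hy')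
  rw [Set.mem_singleton_iff] at e1 e2
  have hxy := (hl 0 (Nat.zero_le d)).2 (by rw [e1, e2])
  rw [h0'] at hxy
  exact Eq.symm hxy

end Types

/-- An expression for the number of types of height `h` over `2 ^ q` colours. -/
def numTy (s : ℕ → ℕ) (q : ℕ) : ℕ → ℕ
  | 0 => 2 ^ q
  | h + 1 => (s h + 1) ^ numTy s q h

theorem numTy_pos (s : ℕ → ℕ) (q h : ℕ) : 1 ≤ numTy s q h := by
  cases h with
  | zero => exact Nat.one_le_two_pow
  | succ h => exact Nat.one_le_pow _ _ (Nat.succ_pos _)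

theorem card_ty {B : Type} [Finite B] {q : ℕ} (hB : Nat.card B = 2 ^ q) (s : ℕ → ℕ) (h : ℕ) :
    Nat.card (Ty B s h) = numTy s q h := by
  induction h with
  | zero => exact hB
  | succ h ih =>
    have : Nat.card (Ty B s h → Fin (s h + 1)) = numTy s q (h + 1) := by
      rw [Nat.card_fun, ih, Nat.card_fin]; rfl
    exact this

/-- Thresholds sufficient for quantifier rank `m` over `2 ^ q` colours. -/
def thr : ℕ → ℕ → ℕ → ℕ
  | 0, _, _ => 2
  | m + 1, q, h => thr m (q + 1) h * numTy (thr m (q + 1)) (q + 1) h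

theorem two_le_thr (m q h : ℕ) : 2 ≤ thr m q h := by
  induction m generalizing q with
  | zero => exact le_rfl
  | succ m ih => exact (ih (q + 1)).trans (Nat.le_mul_of_pos_right _ (numTy_pos _ _ _))

/-- Type-equivalent structures agree on all formulas of the given quantifier rank, provided that
colours determine labels, and that the assignments of free variables are recorded by colours. -/
theorem realize_iff_of_ty_eq {ι A : Type} {M M' : MStr ι} {d : ℕ}
    {e : ℕ → Setoid M.V} {e' : ℕ → Setoid M'.V} (h0 : e 0 = ⊥) (hm : Monotone e) (hd : e d = ⊤)
    (h0' : e' 0 = ⊥) (hm' : Monotone e') (hd' : e' d = ⊤) {a : M.V → A} {a' : M'.V → A}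
    (hP : ∀ i x x', a x = a' x' → (M.P i x ↔ M'.P i x'))
    (hE : ∀ x y x' y', a x = a' x' → a y = a' y' → (∀ l ≤ d, (e l x y ↔ e' l x' y')) →
      (M.E x y ↔ M'.E x' y'))
    (φ : MSOForm ι) :
    ∀ (m q : ℕ) (B : Type) [Finite B], φ.qr ≤ m → Nat.card B = 2 ^ q →
    ∀ (base : B → A) (fo so : ℕ → Set B) (c : M.V → B) (c' : M'.V → B),
      (∀ x, base (c x) = a x) → (∀ x, base (c' x) = a' x) →
      ∀ (u : M.V) (u' : M'.V), ty e c (thr m q) d u = ty e' c' (thr m q) d u' →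
      ∀ (v : ℕ → M.V) (v' : ℕ → M'.V) (S : ℕ → Set M.V) (S' : ℕ → Set M'.V),
      (∀ i ∈ φ.freeFO, ∀ x, c x ∈ fo i ↔ x = v i) → (∀ i ∈ φ.freeFO, ∀ x, c' x ∈ fo i ↔ x = v' i) →
      (∀ i ∈ φ.freeSO, ∀ x, c x ∈ so i ↔ x ∈ S i) → (∀ i ∈ φ.freeSO, ∀ x, c' x ∈ so i ↔ x ∈ S' i) →
      (M.Realize φ v S ↔ M'.Realize φ v' S') := by
  have hall : ∀ x y, e d x y := fun x y => by rw [hd]; trivial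
  have hall' : ∀ x y, e' d x y := fun x y => by rw [hd']; trivial
  -- the corresponding values of two first-order variables
  have hpair : ∀ (m q : ℕ) (B : Type) (c : M.V → B) (c' : M'.V → B) (u : M.V) (u' : M'.V),
      ty e c (thr m q) d u = ty e' c' (thr m q) d u' → ∀ (I J : Set B) (x y : M.V) (x' y' : M'.V),
      (∀ z, c z ∈ I ↔ z = x) → (∀ z, c z ∈ J ↔ z = y) →
      (∀ z, c' z ∈ I ↔ z = x') → (∀ z, c' z ∈ J ↔ z = y') →
      c x = c' x' ∧ c y = c' y' ∧ ∀ l ≤ d, (e l x y ↔ e' l x' y') := by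
    intro m q B c c' u u' hty I J x y x' y' hx hy hx' hy'
    obtain ⟨x₁, y₁, -, -, hcx, hcy, hl⟩ := exists_pair_of_ty_eq h0 hm hm' (two_le_thr m q) d u u'
      hty x y (hall _ _) (hall _ _)
    obtain rfl : x₁ = x' := (hx' _).1 (hcx ▸ (hx x).2 rfl)
    obtain rfl : y₁ = y' := (hy' _).1 (hcy ▸ (hy y).2 rfl)
    exact ⟨hcx.symm, hcy.symm, hl⟩
  induction φ with
  | fal => intros; exact Iff.rfl
  | eq i j =>
    intro m q B _ _ _ base fo so c c' hb hb' u u' hty v v' S S' hv hv' _ _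
    obtain ⟨-, -, hl⟩ := hpair m q B c c' u u' hty _ _ _ _ _ _ (hv i (by simp [MSOForm.freeFO]))
      (hv j (by simp [MSOForm.freeFO])) (hv' i (by simp [MSOForm.freeFO]))
      (hv' j (by simp [MSOForm.freeFO]))
    have := hl 0 (Nat.zero_le d)
    rw [h0, h0'] at this
    exact this
  | edge i j =>
    intro m q B _ _ _ base fo so c c' hb hb' u u' hty v v' S S' hv hv' _ _
    obtain ⟨h1, h2, hl⟩ := hpair m q B c c' u u' hty _ _ _ _ _ _ (hv i (by simp [MSOForm.freeFO]))
      (hv j (by simp [MSOForm.freeFO])) (hv' i (by simp [MSOForm.freeFO]))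
      (hv' j (by simp [MSOForm.freeFO]))
    exact hE _ _ _ _ (by rw [← hb, ← hb', h1]) (by rw [← hb, ← hb', h2]) hl
  | pred k i =>
    intro m q B _ _ _ base fo so c c' hb hb' u u' hty v v' S S' hv hv' _ _
    obtain ⟨h1, -, -⟩ := hpair m q B c c' u u' hty _ _ _ _ _ _ (hv i (by simp [MSOForm.freeFO]))
      (hv i (by simp [MSOForm.freeFO])) (hv' i (by simp [MSOForm.freeFO]))
      (hv' i (by simp [MSOForm.freeFO]))
    exact hP _ _ _ (by rw [← hb, ← hb', h1])
  | mem i X =>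
    intro m q B _ _ _ base fo so c c' hb hb' u u' hty v v' S S' hv hv' hS hS'
    obtain ⟨h1, -, -⟩ := hpair m q B c c' u u' hty _ _ _ _ _ _ (hv i (by simp [MSOForm.freeFO]))
      (hv i (by simp [MSOForm.freeFO])) (hv' i (by simp [MSOForm.freeFO]))
      (hv' i (by simp [MSOForm.freeFO]))
    change v i ∈ S X ↔ v' i ∈ S' X
    rw [← hS X (by simp [MSOForm.freeSO]), ← hS' X (by simp [MSOForm.freeSO]), h1]
  | imp φ ψ ihφ ihψ =>
    intro m q B _ hqr hB base fo so c c' hb hb' u u' hty v v' S S' hv hv' hS hS'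
    simp only [MSOForm.qr, max_le_iff] at hqr
    simp only [MSOForm.freeFO, MSOForm.freeSO, Finset.mem_union] at hv hv' hS hS'
    exact imp_congr
      (ihφ m q B hqr.1 hB base fo so c c' hb hb' u u' hty v v' S S' (fun i hi => hv i (.inl hi))
        (fun i hi => hv' i (.inl hi)) (fun i hi => hS i (.inl hi)) (fun i hi => hS' i (.inl hi)))
      (ihψ m q B hqr.2 hB base fo so c c' hb hb' u u' hty v v' S S' (fun i hi => hv i (.inr hi))
        (fun i hi => hv' i (.inr hi)) (fun i hi => hS i (.inr hi)) (fun i hi => hS' i (.inr hi)))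
  | exFO n φ ih =>
    intro m q B _ hqr hB base fo so c c' hb hb' u u' hty v v' S S' hv hv' hS hS'
    obtain ⟨m, rfl⟩ : ∃ k, m = k + 1 := ⟨m - 1, by simp only [MSOForm.qr] at hqr; omega⟩
    have hB' : Nat.card (B × Bool) = 2 ^ (q + 1) := by
      rw [Nat.card_prod, hB, Nat.card_eq_fintype_card, Fintype.card_bool, pow_succ]
    have hthr : ∀ h, thr m (q + 1) h * Nat.card (Ty (B × Bool) (thr m (q + 1)) h) ≤
        thr (m + 1) q h := fun h => by rw [card_ty hB']; rfl
    have key : ∀ x x', ty e (addMark c {x}) (thr m (q + 1)) d u =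
        ty e' (addMark c' {x'}) (thr m (q + 1)) d u' →
        (M.Realize φ (Function.update v n x) S ↔ M'.Realize φ (Function.update v' n x') S') := by
      intro x x' hxx
      refine ih m (q + 1) (B × Bool) (by simp only [MSOForm.qr] at hqr; omega) hB'
        (fun b => base b.1)
        (fun i => if i = n then {b | b.2 = true} else {b | b.1 ∈ fo i})
        (fun i => {b | b.1 ∈ so i}) _ _ hb hb' u u' hxx _ _ S S' ?_ ?_ hS hS'
      · intro i hi z
        by_cases hin : i = n
        · subst hin; simpa using addMark_snd.trans Set.mem_singleton_iff
        · simpa [hin, addMark] using hv i (Finset.mem_erase.2 ⟨hin, hi⟩) z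
      · intro i hi z
        by_cases hin : i = n
        · subst hin; simpa using addMark_snd.trans Set.mem_singleton_iff
        · simpa [hin, addMark] using hv' i (Finset.mem_erase.2 ⟨hin, hi⟩) z
    have hone : ∀ h, 1 ≤ thr (m + 1) q h := fun h => (Nat.le_succ 1).trans (two_le_thr _ _ _)
    constructor
    · rintro ⟨x, hx⟩
      obtain ⟨x', hx'⟩ := exists_mark_singleton_of_ty_eq h0 h0' hm hm' (two_le_thr m (q + 1)) hone
        hthr hd hd' hty x
      exact ⟨x', (key x x' hx').1 hx⟩
    · rintro ⟨x', hx'⟩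
      obtain ⟨x, hx⟩ := exists_mark_singleton_of_ty_eq h0' h0 hm' hm (two_le_thr m (q + 1)) hone
        hthr hd' hd hty.symm x'
      exact ⟨x, (key x x' hx.symm).2 hx'⟩
  | exSO n φ ih =>
    intro m q B _ hqr hB base fo so c c' hb hb' u u' hty v v' S S' hv hv' hS hS'
    obtain ⟨m, rfl⟩ : ∃ k, m = k + 1 := ⟨m - 1, by simp only [MSOForm.qr] at hqr; omega⟩
    have hB' : Nat.card (B × Bool) = 2 ^ (q + 1) := by
      rw [Nat.card_prod, hB, Nat.card_eq_fintype_card, Fintype.card_bool, pow_succ]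
    have hthr : ∀ h, thr m (q + 1) h * Nat.card (Ty (B × Bool) (thr m (q + 1)) h) ≤
        thr (m + 1) q h := fun h => by rw [card_ty hB']; rfl
    have key : ∀ X X', ty e (addMark c X) (thr m (q + 1)) d u =
        ty e' (addMark c' X') (thr m (q + 1)) d u' →
        (M.Realize φ v (Function.update S n X) ↔ M'.Realize φ v' (Function.update S' n X')) := by
      intro X X' hXX
      refine ih m (q + 1) (B × Bool) (by simp only [MSOForm.qr] at hqr; omega) hB'
        (fun b => base b.1) (fun i => {b | b.1 ∈ fo i})
        (fun i => if i = n then {b | b.2 = true} else {b | b.1 ∈ so i})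
        _ _ hb hb' u u' hXX v v' _ _ hv hv' ?_ ?_
      · intro i hi z
        by_cases hin : i = n
        · subst hin; simpa using addMark_snd
        · simpa [hin, addMark] using hS i (Finset.mem_erase.2 ⟨hin, hi⟩) z
      · intro i hi z
        by_cases hin : i = n
        · subst hin; simpa using addMark_snd
        · simpa [hin, addMark] using hS' i (Finset.mem_erase.2 ⟨hin, hi⟩) z
    have hone : ∀ h, 1 ≤ thr (m + 1) q h := fun h => (Nat.le_succ 1).trans (two_le_thr _ _ _)
    have hone' : ∀ h, 1 ≤ thr m (q + 1) h := fun h => (Nat.le_succ 1).trans (two_le_thr _ _ _)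
    constructor
    · rintro ⟨X, hX⟩
      obtain ⟨X', hX'⟩ := exists_mark_of_ty_eq hm' hone' hone hthr X d u u' hty
      exact ⟨X', (key X X' hX').1 hX⟩
    · rintro ⟨X', hX'⟩
      obtain ⟨X, hX⟩ := exists_mark_of_ty_eq hm hone' hone hthr X' d u' u hty.symm
      exact ⟨X, (key X X' hX.symm).2 hX'⟩

/-- `par` and `dep` are the parent and depth functions of a tree with the given root. -/
structure IsRooted {W : Type} (g : SimpleGraph W) (root : W) (par : W → W) (dep : W → ℕ) :
    Prop where
  adj : ∀ w w', g.Adj w w' → (dep w = dep w' + 1 ∧ par w = w') ∨ (dep w' = dep w + 1 ∧ par w' = w)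
  par_adj : ∀ w, 0 < dep w → g.Adj w (par w)
  dep_par : ∀ w, 0 < dep w → dep (par w) + 1 = dep w
  dep_eq_zero : ∀ w, dep w = 0 ↔ w = root

namespace IsRooted

variable {W : Type} {g : SimpleGraph W} {root : W} {par : W → W} {dep : W → ℕ}

theorem dep_iterate (hg : IsRooted g root par dep) {w : W} {k : ℕ} (hk : k ≤ dep w) :
    dep (par^[k] w) + k = dep w := by
  induction k with
  | zero => rfl
  | succ k ih =>
    have h1 := ih (by omega)
    rw [Function.iterate_succ_apply']
    have h2 := hg.dep_par (par^[k] w) (by omega)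
    omega

theorem exists_walk_iterate (hg : IsRooted g root par dep) {w : W} {k : ℕ} (hk : k ≤ dep w) :
    ∃ p : g.Walk w (par^[k] w), p.length = k := by
  induction k with
  | zero => exact ⟨.nil, rfl⟩
  | succ k ih =>
    obtain ⟨p, hp⟩ := ih (by omega)
    have h1 := hg.dep_iterate (show k ≤ dep w by omega)
    rw [Function.iterate_succ_apply']
    exact ⟨p.concat (hg.par_adj _ (by omega)), by rw [SimpleGraph.Walk.length_concat, hp]⟩

theorem iterate_dep (hg : IsRooted g root par dep) (w : W) : par^[dep w] w = root :=
  (hg.dep_eq_zero _).1 (by have := hg.dep_iterate (le_refl (dep w)); omega)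

theorem exists_walk_root (hg : IsRooted g root par dep) (w : W) :
    ∃ p : g.Walk w root, p.length = dep w := by
  have := hg.exists_walk_iterate (le_refl (dep w))
  rwa [hg.iterate_dep] at this

theorem connected (hg : IsRooted g root par dep) : g.Connected :=
  SimpleGraph.connected_iff_exists_forall_reachable _ |>.2
    ⟨root, fun w => (hg.exists_walk_root w).choose.reachable.symm⟩

theorem dep_le_add_length (hg : IsRooted g root par dep) {u v : W} (p : g.Walk u v) :
    dep v ≤ dep u + p.length := by
  induction p with
  | nil => exact le_rfl
  | cons h p ih =>
    have := hg.adj _ _ h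
    rw [SimpleGraph.Walk.length_cons]
    omega

theorem even_length (hg : IsRooted g root par dep) {u v : W} (p : g.Walk u v) :
    Even (dep u + dep v + p.length) := by
  induction p with
  | nil => exact ⟨_, rfl⟩
  | cons h p ih =>
    have := hg.adj _ _ h
    rw [SimpleGraph.Walk.length_cons]
    rw [Nat.even_iff] at ih ⊢
    omega

theorem dist_root (hg : IsRooted g root par dep) (w : W) : g.dist root w = dep w := by
  apply le_antisymm
  · obtain ⟨p, hp⟩ := hg.exists_walk_root w
    rw [SimpleGraph.dist_comm, ← hp]
    exact SimpleGraph.dist_le p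
  · obtain ⟨p, hp⟩ := hg.connected.exists_walk_length_eq_dist root w
    have h1 := hg.dep_le_add_length p
    have h2 := (hg.dep_eq_zero root).2 rfl
    omega

theorem isAcyclic (hg : IsRooted g root par dep) : g.IsAcyclic := by
  rw [SimpleGraph.isAcyclic_iff_forall_adj_isBridge]
  -- the descendants of `w` are not connected to the parent of `w` without the connecting edge
  have key : ∀ w w', dep w = dep w' + 1 → par w = w' → g.IsBridge s(w, w') := by
    intro w w' hd hw
    rw [SimpleGraph.isBridge_iff]
    rintro ⟨p⟩
    have hp : ∀ x y (q : (g.deleteEdges {s(w, w')}).Walk x y), (∃ k, par^[k] x = w ∧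
        dep x = dep w + k) → ∃ k, par^[k] y = w ∧ dep y = dep w + k := by
      intro x y q
      induction q with
      | nil => exact id
      | @cons x y z hxy q ih =>
        rintro ⟨k, hk, hdk⟩
        apply ih
        rw [SimpleGraph.deleteEdges_adj, Set.mem_singleton_iff] at hxy
        obtain ⟨hxy, hne⟩ := hxy
        rcases hg.adj _ _ hxy with ⟨h1, h2⟩ | ⟨h1, h2⟩
        · cases k with
          | zero =>
            obtain rfl : x = w := hk
            exact absurd (by rw [← h2, hw]) hne
          | succ k => exact ⟨k, by rw [← h2]; exact hk, by omega⟩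
        · exact ⟨k + 1, by rw [Function.iterate_succ_apply, h2]; exact hk, by omega⟩
    obtain ⟨k, -, hk⟩ := hp _ _ p ⟨0, rfl, rfl⟩
    omega
  intro v w hvw
  rcases hg.adj _ _ hvw with ⟨h1, h2⟩ | ⟨h1, h2⟩
  · exact key _ _ h1 h2
  · rw [Sym2.eq_swap]
    exact key _ _ h1 h2

theorem isTree (hg : IsRooted g root par dep) : g.IsTree := ⟨hg.connected, hg.isAcyclic⟩

theorem iterate_eq_of_walk (hg : IsRooted g root par dep) {u v : W} (p : g.Walk u v) :
    ∀ a b, p.length ≤ a + b → dep u + b = dep v + a → par^[a] u = par^[b] v := by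
  induction p with
  | nil =>
    intro a b _ h
    rw [Nat.add_left_cancel h]
  | @cons u w v h p ih =>
    intro a b hl hd
    rw [SimpleGraph.Walk.length_cons] at hl
    have := hg.dep_le_add_length p
    rcases hg.adj _ _ h with ⟨h1, h2⟩ | ⟨h1, h2⟩
    · obtain ⟨a, rfl⟩ : ∃ k, a = k + 1 := ⟨a - 1, by omega⟩
      rw [Function.iterate_succ_apply, h2]
      exact ih a b (by omega) (by omega)
    · rw [← h2, ← Function.iterate_succ_apply]
      exact ih (a + 1) b (by omega) (by omega)

theorem dist_le_iff (hg : IsRooted g root par dep) {u v : W} (huv : dep u = dep v) {l : ℕ}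
    (hl : l ≤ dep u) : g.dist u v ≤ 2 * l ↔ par^[l] u = par^[l] v := by
  constructor
  · intro h
    obtain ⟨p, hp⟩ := hg.connected.exists_walk_length_eq_dist u v
    exact hg.iterate_eq_of_walk p l l (by omega) (by omega)
  · intro h
    obtain ⟨p, hp⟩ := hg.exists_walk_iterate hl
    obtain ⟨q, hq⟩ := hg.exists_walk_iterate (w := v) (k := l) (by omega)
    have h1 := SimpleGraph.dist_le (p.append (q.reverse.copy h.symm rfl))
    rw [SimpleGraph.Walk.length_append, SimpleGraph.Walk.length_copy,
      SimpleGraph.Walk.length_reverse] at h1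
    omega

theorem dist_eq_iff (hg : IsRooted g root par dep) {u v : W} (huv : dep u = dep v) {l : ℕ}
    (hl : l + 1 ≤ dep u) :
    g.dist u v = 2 * (l + 1) ↔ par^[l + 1] u = par^[l + 1] v ∧ ¬ par^[l] u = par^[l] v := by
  rw [← hg.dist_le_iff huv hl, ← hg.dist_le_iff huv (Nat.le_of_succ_le hl)]
  obtain ⟨p, hp⟩ := hg.connected.exists_walk_length_eq_dist u v
  have h := hg.even_length p
  rw [Nat.even_iff] at h
  omega

end IsRooted

/-- Trees are rooted at every vertex. -/
theorem exists_isRooted {W : Type} {g : SimpleGraph W} (hg : g.IsTree) (root : W) :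
    ∃ par : W → W, IsRooted g root par (g.dist root) := by
  choose p hp hl using hg.connected.exists_path_of_dist root
  have hpar : ∀ w w', g.Adj w w' → g.dist root w = g.dist root w' + 1 →
      w' = (p w).penultimate := by
    intro w w' h hd
    refine hg.isAcyclic.eq_penultimate_of_adj_end (hp w) h ?_
    refine hg.isAcyclic.mem_support_of_ne_mem_support_of_adj_of_isPath (hp w) (hp w') h ?_
    classical
    intro hw
    have h1 := SimpleGraph.dist_le ((p w').takeUntil w hw)
    have h2 := (p w').length_takeUntil_le_length hw
    rw [hl] at h2
    omega
  have hadj : ∀ w, 0 < g.dist root w → g.Adj w (p w).penultimate := fun w hw =>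
    ((p w).adj_penultimate (by
      rw [← SimpleGraph.Walk.length_eq_zero_iff, hl]; omega)).symm
  refine ⟨fun w => (p w).penultimate, ?_, hadj, ?_, ?_⟩
  · intro w w' h
    rcases hg.dist_eq_dist_add_one_of_adj root h with h1 | h1
    · exact .inl ⟨h1, (hpar w w' h h1).symm⟩
    · exact .inr ⟨h1, (hpar w' w h.symm h1).symm⟩
  · intro w hw
    have h1 := SimpleGraph.dist_le (p w).dropLast
    have h2 := (p w).length_dropLast
    rcases hg.dist_eq_dist_add_one_of_adj root (hadj w hw) with h3 | h3
    · exact h3.symm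
    · rw [hl] at h2
      omega
  · intro w
    rw [hg.connected.dist_eq_zero_iff]
    exact eq_comm

/-- A chain of equivalence relations of length `d` from equality to the full relation. -/
structure IsChainRel {V : Type} (d : ℕ) (e : ℕ → Setoid V) : Prop where
  bot : e 0 = ⊥
  mono : Monotone e
  top : e d = ⊤

theorem IsChainRel.all {V : Type} {d : ℕ} {e : ℕ → Setoid V} (he : IsChainRel d e) {l : ℕ}
    (hl : d ≤ l) (x y : V) : e l x y :=
  he.mono hl (by rw [he.top]; trivial)

/-- Adjacency determined by a chain of equivalence relations, vertex labels, and a signature. -/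
def ChainAdj {V R : Type} (e : ℕ → Setoid V) (i : V → R) (S : Set (R × R × ℕ)) (u v : V) : Prop :=
  ∃ l, e (l + 1) u v ∧ ¬ e l u v ∧ (i u, i v, l + 1) ∈ S

theorem exists_chainAdj_of_mem_TM {r p d : ℕ} {G : PGraph p} (hG : G ∈ TM r p d) :
    Nonempty G.V ∧ ∃ (e : ℕ → Setoid G.V) (i : G.V → Fin r) (S : Set (Fin r × Fin r × ℕ)),
      IsChainRel d e ∧ (∀ i j l, (i, j, l) ∈ S ↔ (j, i, l) ∈ S) ∧
      ∀ u v, G.adj u v ↔ ChainAdj e i S u v := by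
  obtain ⟨T⟩ := hG
  obtain ⟨par, hg⟩ := exists_isRooted T.tree T.root
  constructor
  · have h : ∀ k ≤ d, ∃ w, T.g.dist T.root w = k := by
      intro k
      induction k with
      | zero => exact fun _ => ⟨T.root, SimpleGraph.dist_self⟩
      | succ k ih =>
        intro hk
        obtain ⟨w, hw⟩ := ih (by omega)
        obtain ⟨w', -, hw'⟩ := T.branch w (by omega)
        exact ⟨w', by omega⟩
    obtain ⟨w, hw⟩ := h d le_rfl
    exact ⟨T.leafEquiv.symm ⟨w, hw⟩⟩
  have hdep : ∀ u, T.g.dist T.root (T.leafEquiv u).1 = d := fun u => (T.leafEquiv u).2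
  have hchain : IsChainRel d (fun l => Setoid.ker fun u => par^[l] (T.leafEquiv u).1) := by
    refine ⟨?_, ?_, ?_⟩
    · refine Setoid.ext fun u v => ?_
      rw [Setoid.ker_def]
      refine ⟨fun h => T.leafEquiv.injective (Subtype.ext h), fun h => ?_⟩
      obtain rfl : u = v := h
      rfl
    · refine monotone_nat_of_le_succ fun l u v h => ?_
      rw [Setoid.ker_def] at h ⊢
      rw [Function.iterate_succ_apply', Function.iterate_succ_apply', h]
    · refine Setoid.ext fun u v => ?_
      rw [Setoid.ker_def]
      have h : ∀ u, par^[d] (T.leafEquiv u).1 = T.root := fun u => by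
        have := hg.iterate_dep (T.leafEquiv u).1
        rwa [hdep] at this
      rw [h u, h v]
      exact ⟨fun _ => trivial, fun _ => rfl⟩
  refine ⟨_, T.iLab, T.S, hchain, T.S_symm, fun u v => ?_⟩
  have huv : T.g.dist T.root (T.leafEquiv u).1 = T.g.dist T.root (T.leafEquiv v).1 := by
    rw [hdep, hdep]
  constructor
  · intro h
    have hne : u ≠ v := by rintro rfl; exact G.irrefl _ h
    obtain ⟨q, hq⟩ := hg.connected.exists_walk_length_eq_dist (T.leafEquiv u).1 (T.leafEquiv v).1
    have h1 := hg.even_length q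
    rw [Nat.even_iff] at h1
    obtain ⟨l, hl⟩ : ∃ l, T.g.dist (T.leafEquiv u).1 (T.leafEquiv v).1 = 2 * l :=
      ⟨T.g.dist (T.leafEquiv u).1 (T.leafEquiv v).1 / 2, by omega⟩
    have hS := (T.edge_iff u v hne l hl).1 h
    obtain ⟨h2, h3⟩ := T.S_range _ hS
    simp only at h2 h3
    obtain ⟨l, rfl⟩ : ∃ k, l = k + 1 := ⟨l - 1, by omega⟩
    obtain ⟨h4, h5⟩ := (hg.dist_eq_iff huv (by rw [hdep]; omega)).1 hl
    exact ⟨l, h4, h5, hS⟩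
  · rintro ⟨l, h1, h2, hS⟩
    have hne : u ≠ v := by rintro rfl; exact h2 rfl
    have hld : l + 1 ≤ d := (T.S_range _ hS).2
    exact (T.edge_iff u v hne (l + 1)
      ((hg.dist_eq_iff huv (by rw [hdep]; omega)).2 ⟨h1, h2⟩)).2 hS

/-- The graph given by a chain of equivalence relations, vertex labels, and a signature. -/
def chainGraph {V R : Type} {p : ℕ} (e : ℕ → Setoid V) (i : V → R) (S : Set (R × R × ℕ))
    (hS : ∀ i j l, (i, j, l) ∈ S ↔ (j, i, l) ∈ S) (label : V → Fin p) : PGraph p where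
  V := V
  adj := ChainAdj e i S
  symm := fun _ _ ⟨l, h1, h2, h3⟩ => ⟨l, (e _).symm h1, fun h => h2 ((e _).symm h), (hS _ _ _).1 h3⟩
  irrefl := fun v ⟨l, _, h, _⟩ => h ((e l).refl v)
  label := label

/-- Identifies the nodes of the tree of a chain of equivalence relations, where `(k, u)` stands for
the class of `u` at level `k`. -/
def nodeSetoid {V : Type} (d : ℕ) (e : ℕ → Setoid V) : Setoid (Fin (d + 1) × V) where
  r a b := a.1 = b.1 ∧ e a.1 a.2 b.2
  iseqv := by
    refine ⟨fun a => ⟨rfl, (e _).refl _⟩, fun {a b} h => ⟨h.1.symm, ?_⟩,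
      fun {a b c} h h' => ⟨h.1.trans h'.1, ?_⟩⟩
    · rw [← h.1]; exact (e _).symm h.2
    · refine (e _).trans h.2 ?_
      rw [h.1]; exact h'.2

theorem chainGraph_mem_TM {V : Type} [Nonempty V] {r p d : ℕ} {e : ℕ → Setoid V}
    (he : IsChainRel d e) (i : V → Fin r) (S : Set (Fin r × Fin r × ℕ))
    (hS : ∀ i j l, (i, j, l) ∈ S ↔ (j, i, l) ∈ S) (label : V → Fin p) :
    chainGraph e i S hS label ∈ TM r p d := by
  let N := Quotient (nodeSetoid d e)
  let node : ℕ → V → N := fun k u => Quotient.mk _ (⟨min k d, by omega⟩, u)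
  have hnode : ∀ {k k' u u'}, k ≤ d → k' ≤ d → (node k u = node k' u' ↔ k = k' ∧ e k u u') := by
    intro k k' u u' hk hk'
    refine Quotient.eq.trans ?_
    change ((⟨min k d, by omega⟩ : Fin (d + 1)) = ⟨min k' d, by omega⟩ ∧ e (min k d) u u') ↔ _
    rw [Fin.mk.injEq, min_eq_left hk, min_eq_left hk']
  have hind : ∀ w : N, ∃ k u, k ≤ d ∧ w = node k u := by
    intro w
    induction w using Quotient.inductionOn with
    | h a =>
      refine ⟨a.1, a.2, by omega, ?_⟩
      apply congrArg
      exact Prod.ext (Fin.ext (by simp only; omega)) rfl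
  let dep : N → ℕ := Quotient.lift (fun a => d - a.1) (fun a b h => by rw [h.1])
  have hdepn : ∀ k u, dep (node k u) = d - min k d := fun k u => rfl
  let par : N → N := Quotient.lift (fun a => node (a.1 + 1) a.2) (by
    intro a b h
    rw [← h.1]
    apply Quotient.sound
    refine ⟨rfl, ?_⟩
    by_cases hd : a.1.1 + 1 ≤ d
    · change e (min (a.1 + 1) d) a.2 b.2
      rw [min_eq_left hd]
      exact he.mono (Nat.le_succ _) h.2
    · exact he.all (by simp only; omega) _ _)
  have hparn : ∀ k u, k + 1 ≤ d → par (node k u) = node (k + 1) u := by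
    intro k u hk
    change node (min k d + 1) u = _
    rw [min_eq_left (by omega)]
  let u₀ : V := Classical.arbitrary V
  let g : SimpleGraph N :=
    { Adj := fun w w' => (dep w = dep w' + 1 ∧ par w = w') ∨ (dep w' = dep w + 1 ∧ par w' = w)
      symm := ⟨fun w w' h => h.symm⟩
      loopless := ⟨fun w h => by omega⟩ }
  have hdep_par : ∀ w, 0 < dep w → dep (par w) + 1 = dep w := by
    intro w hw
    obtain ⟨k, u, hk, rfl⟩ := hind w
    rw [hdepn] at hw
    rw [hparn k u (by omega), hdepn, hdepn]
    omega
  have hg : IsRooted g (node d u₀) par dep := by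
    refine ⟨fun _ _ => id, fun w hw => .inl ⟨(hdep_par w hw).symm, rfl⟩, hdep_par, fun w => ?_⟩
    obtain ⟨k, u, hk, rfl⟩ := hind w
    rw [hdepn, hnode hk le_rfl]
    constructor
    · intro h
      exact ⟨by omega, he.all (by omega) _ _⟩
    · rintro ⟨rfl, -⟩
      omega
  have hiter : ∀ k u, k ≤ d → par^[k] (node 0 u) = node k u := by
    intro k u hk
    induction k with
    | zero => rfl
    | succ k ih => rw [Function.iterate_succ_apply', ih (by omega), hparn k u hk]
  have hleaf : ∀ u, g.dist (node d u₀) (node 0 u) = d := by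
    intro u
    rw [hg.dist_root, hdepn]
    omega
  have hbij : Function.Bijective
      (fun u => (⟨node 0 u, hleaf u⟩ : {w : N // g.dist (node d u₀) w = d})) := by
    constructor
    · intro u v huv
      have h1 := ((hnode (Nat.zero_le d) (Nat.zero_le d)).1 (congrArg Subtype.val huv)).2
      rw [he.bot] at h1
      exact h1
    · rintro ⟨w, hw⟩
      obtain ⟨k, u, hk, rfl⟩ := hind w
      have hw' := hw
      rw [hg.dist_root, hdepn] at hw'
      refine ⟨u, Subtype.ext ((hnode (Nat.zero_le d) hk).2 ?_)⟩
      by_cases hd : d = 0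
      · exact ⟨by omega, he.all (by omega) _ _⟩
      · exact ⟨by omega, (e 0).refl u⟩
  refine ⟨⟨N, g, hg.isTree, node d u₀, ?_, ?_, Equiv.ofBijective _ hbij, i,
    {x | x ∈ S ∧ 1 ≤ x.2.2 ∧ x.2.2 ≤ d}, fun x hx => hx.2, fun a b l => and_congr_left fun _ =>
      hS a b l, ?_⟩⟩
  · intro w
    obtain ⟨k, u, hk, rfl⟩ := hind w
    rw [hg.dist_root, hdepn]
    omega
  · intro w hw
    obtain ⟨k, u, hk, rfl⟩ := hind w
    rw [hg.dist_root, hdepn] at hw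
    obtain ⟨k, rfl⟩ : ∃ j, k = j + 1 := ⟨k - 1, by omega⟩
    refine ⟨node k u, .inr ⟨?_, hparn k u hk⟩, ?_⟩
    · rw [hdepn, hdepn]; omega
    · rw [hg.dist_root, hg.dist_root, hdepn, hdepn]; omega
  · intro (u : V) (v : V) huv l hl
    change g.dist (node 0 u) (node 0 v) = 2 * l at hl
    have hdep : ∀ u, dep (node 0 u) = d := fun u => by rw [hdepn]; omega
    have hld : ∀ l, l ≤ d → (g.dist (node 0 u) (node 0 v) ≤ 2 * l ↔ e l u v) := by
      intro l hl
      rw [hg.dist_le_iff (by rw [hdep, hdep]) (by rw [hdep]; exact hl), hiter l _ hl,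
        hiter l _ hl, hnode hl hl]
      exact and_iff_right rfl
    have hl0 : l ≠ 0 := by
      rintro rfl
      have h1 := (hld 0 (Nat.zero_le d)).1 (by omega)
      rw [he.bot] at h1
      exact huv h1
    have hl1 : l ≤ d := by
      have h1 := (hld d le_rfl).2 (he.all le_rfl _ _)
      omega
    obtain ⟨l, rfl⟩ : ∃ j, l = j + 1 := ⟨l - 1, by omega⟩
    have h1 : e (l + 1) u v := (hld (l + 1) hl1).1 (by omega)
    have h2 : ¬ e l u v := fun h => by
      have := (hld l (by omega)).2 h
      omega
    constructor
    · rintro ⟨k, hk1, hk2, hk⟩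
      obtain rfl : k = l := by
        by_contra hkl
        rcases Nat.lt_or_gt_of_ne hkl with h | h
        · exact h2 (he.mono (by omega) hk1)
        · exact hk2 (he.mono (by omega) h1)
      exact ⟨hk, by simp only; omega, by simp only; omega⟩
    · rintro ⟨hk, -⟩
      exact ⟨l, h1, h2, hk⟩

section Good

variable {V B : Type} {e : ℕ → Setoid V} {c : V → B} {s : ℕ → ℕ}

theorem mk_mem_kids_iff (h0 : e 0 = ⊥) (hm : Monotone e) {h : ℕ} {x y : V} {τ : Ty B s h} :
    Quotient.mk (e h) y ∈ kids e c s h x τ ↔ e (h + 1) x y ∧ ty e c s h y = τ := by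
  refine and_congr ?_ (by rw [ty_congr h0 (rel_out (e h) y)])
  have h1 := rel_mono hm (Nat.le_succ h) (rel_out (e h) y)
  exact ⟨fun h2 => (e _).trans h2 h1, fun h2 => (e _).trans h2 ((e _).symm h1)⟩

/-- `Y` contains elements of enough classes of every type occurring below its elements, for levels
less than `n`. -/
def IsGood (e : ℕ → Setoid V) (c : V → B) (s : ℕ → ℕ) (n : ℕ) (Y : Set V) : Prop :=
  ∀ y ∈ Y, ∀ h < n, ∀ τ : Ty B s h,
    min (kids e c s h y τ).encard (s h) ≤ (kids e c s h y τ ∩ Quotient.mk (e h) '' Y).encard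

section Embedding

variable {U : Type} {eU : ℕ → Setoid U} {f : U → V}

theorem encard_kids_inter_range (h0 : e 0 = ⊥) (hm : Monotone e) (h0' : eU 0 = ⊥)
    (hm' : Monotone eU) (hf : ∀ l x y, eU l x y ↔ e l (f x) (f y)) {cU : U → B} {h : ℕ}
    (hty : ∀ x, ty eU cU s h x = ty e c s h (f x)) (x : U) (τ : Ty B s h) :
    (kids e c s h (f x) τ ∩ Quotient.mk (e h) '' Set.range f).encard =
      (kids eU cU s h x τ).encard := by
  let φ : Quotient (eU h) → Quotient (e h) := Quotient.map f fun a b hab => (hf h a b).1 hab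
  have hφ : ∀ u, φ (Quotient.mk _ u) = Quotient.mk _ (f u) := fun _ => rfl
  have hinj : Function.Injective φ := by
    intro q q'
    induction q, q' using Quotient.inductionOn₂ with
    | h a b =>
      rw [hφ, hφ, mk_eq_iff_rel, mk_eq_iff_rel]
      exact (hf h a b).2
  rw [← hinj.encard_image]
  congr 1
  ext q
  constructor
  · rintro ⟨hq, _, ⟨u, rfl⟩, rfl⟩
    rw [mk_mem_kids_iff h0 hm] at hq
    exact ⟨Quotient.mk _ u, (mk_mem_kids_iff h0' hm').2 ⟨(hf _ _ _).2 hq.1, by rw [hty, hq.2]⟩, rfl⟩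
  · rintro ⟨q, hq, rfl⟩
    induction q using Quotient.inductionOn with
    | h u =>
      rw [mk_mem_kids_iff h0' hm'] at hq
      refine ⟨?_, f u, ⟨u, rfl⟩, rfl⟩
      rw [hφ, mk_mem_kids_iff h0 hm]
      exact ⟨(hf _ _ _).1 hq.1, by rw [← hty, hq.2]⟩

/-- Embeddings with good range preserve types. -/
theorem ty_eq_of_isGood_range (h0 : e 0 = ⊥) (hm : Monotone e) (h0' : eU 0 = ⊥)
    (hm' : Monotone eU) (hf : ∀ l x y, eU l x y ↔ e l (f x) (f y)) {n : ℕ}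
    (hgood : IsGood e c s n (Set.range f)) {h : ℕ} (hn : h ≤ n) (x : U) :
    ty eU (fun u => c (f u)) s h x = ty e c s h (f x) := by
  induction h generalizing x with
  | zero => rfl
  | succ h ih =>
    rw [ty_succ_eq_iff]
    intro τ
    rw [← encard_kids_inter_range h0 hm h0' hm' hf (fun x => ih (by omega) x)]
    refine le_antisymm (min_le_min_right _ (Set.encard_le_encard Set.inter_subset_left)) ?_
    exact le_min (hgood _ ⟨x, rfl⟩ h hn τ) (min_le_right _ _)

/-- The range of a type-preserving embedding is good. -/
theorem isGood_range_of_ty_eq (h0 : e 0 = ⊥) (hm : Monotone e) (h0' : eU 0 = ⊥)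
    (hm' : Monotone eU) (hf : ∀ l x y, eU l x y ↔ e l (f x) (f y)) {cU : U → B} (n : ℕ)
    (hty : ∀ h x, ty eU cU s h x = ty e c s h (f x)) : IsGood e c s n (Set.range f) := by
  rintro _ ⟨x, rfl⟩ h - τ
  rw [encard_kids_inter_range h0 hm h0' hm' hf (hty h), ← ty_succ_eq_iff.1 (hty (h + 1) x) τ]
  exact min_le_left _ _

end Embedding

theorem IsGood.le_of_subset {n : ℕ} {Y Z : Set V} (hY : IsGood e c s n Y) (hYZ : Y ⊆ Z) {y : V}
    (hy : y ∈ Y) {h : ℕ} (hh : h < n) (τ : Ty B s h) :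
    min (kids e c s h y τ).encard (s h) ≤ (kids e c s h y τ ∩ Quotient.mk (e h) '' Z).encard :=
  (hY y hy h hh τ).trans (Set.encard_le_encard (Set.inter_subset_inter_right _ (Set.image_mono hYZ)))

/-- A bound for the size of good subsets of classes of height `h`. -/
def kernelBound (s : ℕ → ℕ) (q : ℕ) : ℕ → ℕ
  | 0 => 1
  | h + 1 => numTy s q h * (s h * kernelBound s q h)

theorem monotone_kernelBound {s : ℕ → ℕ} (hs : ∀ h, 1 ≤ s h) (q : ℕ) :
    Monotone (kernelBound s q) :=
  monotone_nat_of_le_succ fun h =>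
    (Nat.le_mul_of_pos_left _ (hs h)).trans (Nat.le_mul_of_pos_left _ (numTy_pos s q h))

/-- Classes of height `h` contain small good subsets. -/
theorem exists_kernel [Finite B] {q : ℕ} (hB : Nat.card B = 2 ^ q) (h0 : e 0 = ⊥)
    (hm : Monotone e) (hs : ∀ h, 1 ≤ s h) (h : ℕ) (v : V) :
    ∃ K : Finset V, K.Nonempty ∧ (∀ y ∈ K, e h v y) ∧ K.card ≤ kernelBound s q h ∧
      IsGood e c s h (K : Set V) := by
  classical
  induction h generalizing v with
  | zero =>
    refine ⟨{v}, Finset.singleton_nonempty v, fun y hy => ?_, le_rfl, fun _ _ h hh => by omega⟩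
    rw [Finset.mem_singleton.1 hy]
  | succ h ih =>
    choose K hne hK hcard hgood using ih
    have hC : ∀ τ : Ty B s h, ∃ C : Finset (Quotient (e h)), (C : Set _) ⊆ kids e c s h v τ ∧
        C.card ≤ s h ∧ min (kids e c s h v τ).encard (s h) ≤ C.card := by
      intro τ
      obtain ⟨C, hC, hcardC⟩ := Set.exists_subset_encard_eq
        (min_le_left (kids e c s h v τ).encard (s h : ℕ∞))
      have hfin : C.Finite := Set.finite_of_encard_le_coe (hcardC.trans_le (min_le_right _ _))
      refine ⟨hfin.toFinset, by rwa [hfin.coe_toFinset], ?_, ?_⟩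
      · have := hcardC.trans_le (min_le_right _ _)
        rw [hfin.encard_eq_coe_toFinset_card] at this
        exact_mod_cast this
      · rw [← hcardC, hfin.encard_eq_coe_toFinset_card]
    choose C hC hCcard hCmin using hC
    have : Fintype (Ty B s h) := Fintype.ofFinite _
    let K' : Finset V := Finset.univ.biUnion fun τ => (C τ).biUnion fun q => K q.out
    have hmem : ∀ y, y ∈ K' ↔ ∃ τ, ∃ q ∈ C τ, y ∈ K q.out := fun y => by simp [K']
    have hrel : ∀ y ∈ K', e (h + 1) v y := by
      intro y hy
      obtain ⟨τ, q, hq, hyq⟩ := (hmem y).1 hy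
      exact (e _).trans (hC τ hq).1 (rel_mono hm (Nat.le_succ h) (hK _ _ hyq))
    refine ⟨K', ?_, hrel, ?_, ?_⟩
    · have h1 : (kids e c s h v (ty e c s h v)).Nonempty :=
        ⟨_, mk_mem_kids h0 hm ((e (h + 1)).refl v)⟩
      have h2 : 1 ≤ (C (ty e c s h v)).card := by
        have h3 := (le_min (Set.one_le_encard_iff_nonempty.2 h1) (by exact_mod_cast hs h)).trans
          (hCmin (ty e c s h v))
        exact_mod_cast h3
      obtain ⟨q, hq⟩ := Finset.card_pos.1 h2
      obtain ⟨y, hy⟩ := hne q.out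
      exact ⟨y, (hmem y).2 ⟨_, q, hq, hy⟩⟩
    · refine (Finset.card_biUnion_le_card_mul _ _ (s h * kernelBound s q h) fun τ _ => ?_).trans ?_
      · refine (Finset.card_biUnion_le_card_mul _ _ (kernelBound s q h)
          fun q _ => hcard _).trans ?_
        exact Nat.mul_le_mul_right _ (hCcard τ)
      · rw [Finset.card_univ, ← Nat.card_eq_fintype_card, card_ty hB]
        rfl
    · intro y hy k hk τ
      obtain ⟨τ', q, hq, hyq⟩ := (hmem y).1 hy
      rcases Nat.lt_succ_iff_lt_or_eq.1 hk with hk | rfl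
      · exact (hgood q.out).le_of_subset (fun z hz => (hmem z).2 ⟨τ', q, hq, hz⟩) hyq hk τ
      · rw [← kids_congr (hrel y hy)]
        refine (hCmin τ).trans ?_
        rw [← Set.encard_coe_eq_coe_finsetCard]
        refine Set.encard_le_encard fun q' hq' => ⟨hC τ hq', ?_⟩
        obtain ⟨z, hz⟩ := hne q'.out
        refine ⟨z, (hmem z).2 ⟨τ, q', hq', hz⟩, ?_⟩
        rw [← Quotient.out_eq q', mk_eq_iff_rel]
        exact (e _).symm (hK _ _ hz)

/-- The level at which an element branches off a set. -/
theorem exists_branch_level {d : ℕ} (he : IsChainRel d e) {Y : Set V} (hY : Y.Nonempty) {v : V}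
    (hv : v ∉ Y) : ∃ h < d, (∃ y ∈ Y, e (h + 1) v y) ∧ ∀ y ∈ Y, ¬ e h v y := by
  classical
  have hex : ∃ n, ∃ y ∈ Y, e n v y := ⟨d, hY.some, hY.some_mem, he.all le_rfl _ _⟩
  obtain ⟨y, hy, hvy⟩ := Nat.find_spec hex
  have hpos : Nat.find hex ≠ 0 := by
    intro h
    rw [h, he.bot] at hvy
    obtain rfl : v = y := hvy
    exact hv hy
  have hle : Nat.find hex ≤ d :=
    Nat.find_min' hex ⟨hY.some, hY.some_mem, he.all le_rfl _ _⟩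
  refine ⟨Nat.find hex - 1, by omega, ?_, fun z hz hvz => ?_⟩
  · rw [Nat.sub_add_cancel (by omega)]
    exact ⟨y, hy, hvy⟩
  · exact Nat.find_min hex (show Nat.find hex - 1 < _ by omega) ⟨z, hz, hvz⟩

/-- Good sets can be enlarged in steps of bounded size. -/
theorem IsGood.exists_superset [Finite B] {q d N : ℕ} (hB : Nat.card B = 2 ^ q)
    (he : IsChainRel d e) (hs : ∀ h, 1 ≤ s h) (hN : ∀ Y : Finset V, Y.card ≤ N → ∃ v, v ∉ Y)
    {Y₀ : Finset V} (hY₀ : IsGood e c s d (Y₀ : Set V)) (hne : Y₀.Nonempty) (hcard : Y₀.card ≤ N) :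
    ∃ Y : Finset V, Y₀ ⊆ Y ∧ IsGood e c s d (Y : Set V) ∧ Y.card ≤ N ∧
      N < Y.card + kernelBound s q d := by
  classical
  induction hk : N - Y₀.card using Nat.strong_induction_on generalizing Y₀ with
  | _ k ih =>
    by_cases hlt : N < Y₀.card + kernelBound s q d
    · exact ⟨Y₀, Finset.Subset.refl _, hY₀, hcard, hlt⟩
    obtain ⟨v, hv⟩ := hN Y₀ hcard
    obtain ⟨h, hh, ⟨y₀, hy₀, hvy₀⟩, hnot⟩ := exists_branch_level he
      (Finset.coe_nonempty.2 hne) (v := v) (fun h => hv (Finset.mem_coe.1 h))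
    obtain ⟨K, hKne, hKrel, hKcard, hKgood⟩ := exists_kernel (c := c) hB he.bot he.mono hs h v
    have hKcard' := hKcard.trans (monotone_kernelBound hs q hh.le)
    have hdisj : Disjoint Y₀ K :=
      Finset.disjoint_left.2 fun y hy hyK => hnot y (Finset.mem_coe.2 hy) (hKrel y hyK)
    have hcardU : (Y₀ ∪ K).card = Y₀.card + K.card := Finset.card_union_of_disjoint hdisj
    have hKpos := hKne.card_pos
    have hgood : IsGood e c s d ((Y₀ ∪ K : Finset V) : Set V) := by
      rw [Finset.coe_union]
      rintro y (hy | hy) l hl τ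
      · exact hY₀.le_of_subset Set.subset_union_left hy hl τ
      · by_cases hlh : l < h
        · exact hKgood.le_of_subset Set.subset_union_right hy hlh τ
        · have hyy : e (l + 1) y₀ y := (e _).trans ((e _).symm (rel_mono he.mono (by omega) hvy₀))
            (rel_mono he.mono (by omega) (hKrel y (Finset.mem_coe.1 hy)))
          rw [← kids_congr hyy]
          exact hY₀.le_of_subset Set.subset_union_left hy₀ hl τ
    obtain ⟨Y, hY⟩ := ih (N - (Y₀ ∪ K).card) (by omega) hgood
      (hne.mono Finset.subset_union_left) (by omega) rfl
    exact ⟨Y, Finset.subset_union_left.trans hY.1, hY.2⟩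

/-- In a large structure, some type occurs at least as often as the threshold. -/
theorem exists_le_encard_kids [Finite B] {q d : ℕ} (hB : Nat.card B = 2 ^ q)
    (he : IsChainRel d e) (hs : ∀ h, 1 ≤ s h)
    (hN : ∀ Y : Finset V, Y.card ≤ kernelBound s q d → ∃ v, v ∉ Y) :
    ∃ h < d, ∃ x, ∃ τ : Ty B s h, (s h : ℕ∞) ≤ (kids e c s h x τ).encard := by
  by_contra! hcon
  obtain ⟨v₀, -⟩ := hN ∅ (Nat.zero_le _)
  obtain ⟨K, hKne, -, hKcard, hKgood⟩ := exists_kernel (c := c) hB he.bot he.mono hs d v₀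
  obtain ⟨v, hv⟩ := hN K hKcard
  obtain ⟨h, hh, ⟨y, hy, hvy⟩, hnot⟩ := exists_branch_level he
    (Finset.coe_nonempty.2 hKne) (v := v) (fun h => hv (Finset.mem_coe.1 h))
  have h1 := hKgood y hy h hh (ty e c s h v)
  have h2 := hcon h hh y (ty e c s h v)
  rw [min_eq_left h2.le] at h1
  have hfin : (kids e c s h y (ty e c s h v)).Finite := Set.finite_of_encard_le_coe h2.le
  have h3 : kids e c s h y (ty e c s h v) ∩ Quotient.mk (e h) '' (K : Set V) =
      kids e c s h y (ty e c s h v) :=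
    (hfin.subset Set.inter_subset_left).eq_of_subset_of_encard_le Set.inter_subset_left h1
  have h4 := mk_mem_kids (c := c) (s := s) he.bot he.mono ((e (h + 1)).symm hvy)
  rw [← h3] at h4
  obtain ⟨-, z, hz, hzv⟩ := h4
  exact hnot z hz ((e h).symm (mk_eq_iff_rel.1 hzv))

end Good

section Pump

variable {V B κ : Type}

/-- The elements of a structure in which the class of `w` at level `n` is copied `κ` times. -/
def Pump (e : ℕ → Setoid V) (n : ℕ) (w : V) (κ : Type) : Type :=
  {z : V × Option κ // z.2 = none ∨ e n w z.1}

/-- The chain of equivalence relations with the class of `w` at level `n` copied. -/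
def pumpRel (e : ℕ → Setoid V) (n : ℕ) (w : V) (κ : Type) (l : ℕ) : Setoid (Pump e n w κ) where
  r a b := e l a.1.1 b.1.1 ∧ (a.1.2 = b.1.2 ∨ n < l)
  iseqv := by
    refine ⟨fun a => ⟨(e l).refl _, .inl rfl⟩, fun h => ⟨(e l).symm h.1, h.2.imp_left Eq.symm⟩,
      fun h h' => ⟨(e l).trans h.1 h'.1, ?_⟩⟩
    rcases h.2 with h1 | h1
    · exact h'.2.imp_left h1.trans
    · exact .inr h1

variable {e : ℕ → Setoid V} {c : V → B} {s : ℕ → ℕ} {n d : ℕ} {w : V}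

/-- The original elements among those of the copied structure. -/
def toPump (e : ℕ → Setoid V) (n : ℕ) (w : V) (κ : Type) (x : V) : Pump e n w κ :=
  ⟨(x, none), .inl rfl⟩

theorem pumpRel_toPump (l : ℕ) (x y : V) :
    e l x y ↔ pumpRel e n w κ l (toPump e n w κ x) (toPump e n w κ y) :=
  ⟨fun h => ⟨h, .inl rfl⟩, fun h => h.1⟩

theorem toPump_injective : Function.Injective (toPump e n w κ) := fun _ _ h =>
  congrArg (fun z : Pump e n w κ => z.1.1) h

theorem isChainRel_pumpRel (he : IsChainRel d e) (hn : n < d) :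
    IsChainRel d (pumpRel e n w κ) := by
  refine ⟨Setoid.ext fun a b => ⟨fun h => ?_, fun h => ?_⟩, fun k l hkl a b h => ?_,
    Setoid.ext fun a b => ⟨fun _ => trivial, fun _ => ⟨he.all le_rfl _ _, .inr hn⟩⟩⟩
  · obtain ⟨h1, h2⟩ := h
    rw [he.bot] at h1
    exact Subtype.ext (Prod.ext h1 (h2.resolve_right (Nat.not_lt_zero n)))
  · obtain rfl : a = b := h
    exact (pumpRel e n w κ 0).refl a
  · exact ⟨he.mono hkl h.1, h.2.imp_right fun h2 => h2.trans_le hkl⟩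

/-- Copying a class that has sufficiently many siblings of the same type preserves types. -/
theorem ty_pumpRel (he : IsChainRel d e) (hn : n < d)
    (hw : (s n : ℕ∞) ≤ (kids e c s n w (ty e c s n w)).encard) (h : ℕ) (a : Pump e n w κ) :
    ty (pumpRel e n w κ) (fun a => c a.1.1) s h a = ty e c s h a.1.1 := by
  have he' := isChainRel_pumpRel (w := w) (κ := κ) he hn
  induction h generalizing a with
  | zero => rfl
  | succ h ih =>
    rw [ty_succ_eq_iff]
    intro τ
    let φ : Quotient (pumpRel e n w κ h) → Quotient (e h) :=
      Quotient.map (fun a => a.1.1) fun a b hab => hab.1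
    have hφ : ∀ b, φ (Quotient.mk _ b) = Quotient.mk _ b.1.1 := fun _ => rfl
    have himage : φ '' kids (pumpRel e n w κ) (fun a => c a.1.1) s h a τ =
        kids e c s h a.1.1 τ := by
      ext q
      constructor
      · rintro ⟨q, hq, rfl⟩
        induction q using Quotient.inductionOn with
        | h b =>
          rw [mk_mem_kids_iff he'.bot he'.mono, ih] at hq
          rw [hφ, mk_mem_kids_iff he.bot he.mono]
          exact ⟨hq.1.1, hq.2⟩
      · intro hq
        induction q using Quotient.inductionOn with
        | h x =>
          rw [mk_mem_kids_iff he.bot he.mono] at hq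
          have hb : ∃ b : Pump e n w κ, b.1.1 = x ∧ (a.1.2 = b.1.2 ∨ n < h + 1) := by
            by_cases hnh : n < h + 1
            · exact ⟨toPump e n w κ x, rfl, .inr hnh⟩
            · refine ⟨⟨(x, a.1.2), a.2.imp_right fun h1 => (e n).trans h1 ?_⟩, rfl, .inl rfl⟩
              exact rel_mono he.mono (by omega) hq.1
          obtain ⟨b, rfl, hb⟩ := hb
          refine ⟨Quotient.mk _ b, ?_, rfl⟩
          rw [mk_mem_kids_iff he'.bot he'.mono, ih]
          exact ⟨⟨hq.1, hb⟩, hq.2⟩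
    by_cases hex : h = n ∧ e (h + 1) w a.1.1 ∧ HEq τ (ty e c s n w)
    · obtain ⟨rfl, h1, h2⟩ := hex
      obtain rfl := eq_of_heq h2
      have h3 : (s h : ℕ∞) ≤ (kids e c s h a.1.1 (ty e c s h w)).encard := by
        rwa [← kids_congr h1]
      rw [min_eq_right h3, min_eq_right]
      refine h3.trans ?_
      rw [← himage]
      exact Set.encard_image_le _ _
    · rw [← himage, Set.InjOn.encard_image]
      intro q hq q' hq' hqq
      induction q, q' using Quotient.inductionOn₂ with
      | h b b' =>
        rw [mk_mem_kids_iff he'.bot he'.mono, ih] at hq hq'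
        rw [hφ, hφ, mk_eq_iff_rel] at hqq
        rw [mk_eq_iff_rel]
        refine ⟨hqq, ?_⟩
        by_contra hcon
        push Not at hcon
        obtain ⟨hne, hnh⟩ := hcon
        obtain rfl : h = n := by
          by_contra hh
          have h1 : ¬ n < h + 1 := by omega
          exact hne ((hq.1.2.resolve_right h1).symm.trans (hq'.1.2.resolve_right h1))
        have hwb : e h w b.1.1 := by
          rcases b.2 with h1 | h1
          · rcases b'.2 with h2 | h2
            · exact absurd (h1.trans h2.symm) hne
            · exact (e h).trans h2 ((e h).symm hqq)
          · exact h1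
        refine hex ⟨rfl, ?_, heq_of_eq ?_⟩
        · exact (e _).trans (rel_mono he.mono (Nat.le_succ h) hwb) ((e _).symm hq.1.1)
        · rw [← hq.2, ty_congr he.bot hwb]

end Pump

section ColGraph

variable {V V' A : Type} {r p d : ℕ}

/-- The graph determined by a chain of equivalence relations and a colouring, where colours encode
pairs of labels. -/
def colGraph (dec : A → Fin r × Fin p) {S : Set (Fin r × Fin r × ℕ)}
    (hS : ∀ i j l, (i, j, l) ∈ S ↔ (j, i, l) ∈ S) (e : ℕ → Setoid V) (c : V → A) : PGraph p :=
  chainGraph e (fun v => (dec (c v)).1) S hS fun v => (dec (c v)).2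

theorem exists_eq_colGraph {G : PGraph p} (hG : G ∈ TM r p d) :
    ∃ (V : Type) (_ : Nonempty V) (e : ℕ → Setoid V)
      (c : V → Fin (2 ^ (Nat.clog 2 r + Nat.clog 2 p)))
      (dec : Fin (2 ^ (Nat.clog 2 r + Nat.clog 2 p)) → Fin r × Fin p)
      (S : Set (Fin r × Fin r × ℕ)) (hS : ∀ i j l, (i, j, l) ∈ S ↔ (j, i, l) ∈ S),
      IsChainRel d e ∧ G = colGraph dec hS e c := by
  obtain ⟨hne, e, i, S, he, hS, hadj⟩ := exists_chainAdj_of_mem_TM hG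
  have : Nonempty (Fin r × Fin p) := ⟨(i hne.some, G.label hne.some)⟩
  have hcard : Fintype.card (Fin r × Fin p) ≤
      Fintype.card (Fin (2 ^ (Nat.clog 2 r + Nat.clog 2 p))) := by
    rw [Fintype.card_prod, Fintype.card_fin, Fintype.card_fin, Fintype.card_fin, pow_add]
    exact Nat.mul_le_mul (Nat.le_pow_clog one_lt_two r) (Nat.le_pow_clog one_lt_two p)
  obtain ⟨col⟩ := Function.Embedding.nonempty_of_card_le hcard
  have hdec : ∀ x, Function.invFun col (col x) = x := Function.leftInverse_invFun col.injective
  refine ⟨G.V, hne, e, fun v => col (i v, G.label v), Function.invFun col, S, hS, he, ?_⟩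
  obtain ⟨V, adj, _, _, label⟩ := G
  have h : adj = ChainAdj (V := V) e i S := by
    funext u v
    exact propext (hadj u v)
  simp only [colGraph, chainGraph, hdec, h]

variable {dec : A → Fin r × Fin p} {S : Set (Fin r × Fin r × ℕ)}
  {hS : ∀ i j l, (i, j, l) ∈ S ↔ (j, i, l) ∈ S} {e : ℕ → Setoid V} {e' : ℕ → Setoid V'}
  {c : V → A} {c' : V' → A}

theorem colGraph_adj_iff {u v : V} : (colGraph dec hS e c).adj u v ↔
    ∃ l, e (l + 1) u v ∧ ¬ e l u v ∧ ((dec (c u)).1, (dec (c v)).1, l + 1) ∈ S := Iff.rfl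

theorem colGraph_emb {f : V → V'} (hf : Function.Injective f)
    (he : ∀ l x y, e l x y ↔ e' l (f x) (f y)) (hc : ∀ x, c' (f x) = c x) :
    (colGraph dec hS e c).Emb (colGraph dec hS e' c') := by
  refine ⟨f, hf, fun (a b : V) => ?_, fun (a : V) => ?_⟩
  · refine colGraph_adj_iff.trans (Iff.trans ?_ colGraph_adj_iff.symm)
    simp only [he, hc]
  · change (dec (c' (f a))).2 = (dec (c a)).2
    rw [hc]

theorem msoEquiv_colGraph [Finite A] {q m : ℕ} (hA : Nat.card A = 2 ^ q) (he : IsChainRel d e)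
    (he' : IsChainRel d e') {u : V} {u' : V'}
    (hty : ty e c (thr m q) d u = ty e' c' (thr m q) d u') :
    MStr.MSOEquiv m (colGraph dec hS e c).toStr (colGraph dec hS e' c').toStr := by
  intro φ hφ hqr
  have key : ∀ v S₁ v' S₂, (colGraph dec hS e c).toStr.Realize φ v S₁ ↔
      (colGraph dec hS e' c').toStr.Realize φ v' S₂ := by
    intro v S₁ v' S₂
    refine realize_iff_of_ty_eq (M := (colGraph dec hS e c).toStr)
      (M' := (colGraph dec hS e' c').toStr) (d := d) (e := e) (e' := e') he.bot he.mono he.top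
      he'.bot he'.mono he'.top (a := c) (a' := c') ?_ ?_ φ m q A hqr hA id (fun _ => ∅) (fun _ => ∅)
      c c' (fun _ => rfl) (fun _ => rfl) u u' hty v v' S₁ S₂ ?_ ?_ ?_ ?_
    · intro i x x' (hx : c x = c' x')
      change (dec (c x)).2 = i ↔ (dec (c' x')).2 = i
      rw [hx]
    · intro x y x' y' (hx : c x = c' x') (hy : c y = c' y') hl
      have hall : ∀ l, (e l x y ↔ e' l x' y') := fun l =>
        (le_total l d).elim (hl l) fun h => iff_of_true (he.all h _ _) (he'.all h _ _)
      refine (colGraph_adj_iff (hS := hS)).trans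
        (Iff.trans ?_ (colGraph_adj_iff (hS := hS)).symm)
      simp only [hx, hy, hall]
    all_goals simp [hφ.1, hφ.2]
  exact ⟨fun h v' S₂ => (key (fun _ => u) (fun _ => ∅) _ _).1 (h _ _),
    fun h v S₁ => (key _ _ (fun _ => u') (fun _ => ∅)).2 (h _ _)⟩

end ColGraph

theorem trunc_eq_iff {s : ℕ} {a : ℕ∞} {t : Fin (s + 1)} :
    trunc s a = t ↔ ∀ j : Fin (s + 1), (((j : ℕ) : ℕ∞) ≤ a ↔ (j : ℕ) ≤ t) := by
  have ht : trunc s ((t : ℕ) : ℕ∞) = t := by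
    have h : ((t : ℕ) : ℕ∞) ≤ s := by exact_mod_cast Nat.lt_succ_iff.1 t.2
    refine Fin.ext ?_
    simp [trunc, min_eq_left h]
  have hcast : ∀ j : ℕ, ((j : ℕ∞) ≤ ((t : ℕ) : ℕ∞) ↔ j ≤ t) := fun j => Nat.cast_le
  nth_rewrite 1 [← ht]
  rw [trunc_eq_trunc_iff]
  constructor
  · intro h j
    rw [le_iff_of_min_eq h (Nat.lt_succ_iff.1 j.2), hcast]
  · intro h
    refine min_eq_of_forall_le_iff fun j hj => ?_
    rw [hcast]
    exact h ⟨j, Nat.lt_succ_iff.2 hj⟩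

section FirstOrder

open FirstOrder FirstOrder.Language

/-- The relation symbols describing chains of equivalence relations on coloured sets. -/
inductive ChainSymbol (B : Type) : ℕ → Type
  | colour : B → ChainSymbol B 1
  | level : ℕ → ChainSymbol B 2

/-- The language of chains of equivalence relations on coloured sets. -/
def chainLang (B : Type) : FirstOrder.Language.{0, 0} := ⟨fun _ => Empty, ChainSymbol B⟩

variable {B : Type}

/-- The formula stating that `x` has colour `b`. -/
def colourFormula {α : Type} (b : B) (x : α) : (chainLang B).Formula α :=
  Relations.formula (L := chainLang B) (ChainSymbol.colour b) ![Term.var x]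

/-- The formula stating that `x` and `y` are equivalent at level `l`. -/
def levelFormula {α : Type} (B : Type) (l : ℕ) (x y : α) : (chainLang B).Formula α :=
  Relations.formula (L := chainLang B) (ChainSymbol.level l) ![Term.var x, Term.var y]

theorem card_chainLang_le [Finite B] : (chainLang B).card ≤ ℵ₀ := by
  rw [FirstOrder.Language.card, mk_le_aleph0_iff]
  have h1 : Countable (Σ l, (chainLang B).Functions l) :=
    ⟨fun x => x.2.elim, fun x => x.2.elim⟩
  have h2 : Countable (Σ l, (chainLang B).Relations l) := by
    let g : (Σ l, ChainSymbol B l) → B ⊕ ℕ := fun x => match x with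
      | ⟨_, .colour b⟩ => .inl b
      | ⟨_, .level l⟩ => .inr l
    refine Function.Injective.countable (f := g) ?_
    rintro ⟨_, b | l⟩ ⟨_, b' | l'⟩ h
    · obtain rfl : b = b' := Sum.inl.inj h
      rfl
    · cases h
    · cases h
    · obtain rfl : l = l' := Sum.inr.inj h
      rfl
  exact instCountableSum

variable {V : Type}

/-- A chain of equivalence relations on a coloured set, as a first-order structure. -/
@[reducible] def chainStructure (e : ℕ → Setoid V) (c : V → B) : (chainLang B).Structure V where
  funMap f := f.elim
  RelMap := fun r => match r with
    | .colour b => fun v => c (v 0) = b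
    | .level l => fun v => e l (v 0) (v 1)

section

variable {e : ℕ → Setoid V} {c : V → B}

theorem realize_levelFormula {α : Type} {l : ℕ} {x y : α} {v : α → V} :
    @Formula.Realize (chainLang B) V (chainStructure e c) α (levelFormula B l x y) v ↔
      e l (v x) (v y) :=
  Iff.rfl

/-- Types are definable. -/
theorem exists_formula_ty [Finite B] (s : ℕ → ℕ) (h : ℕ) (τ : Ty B s h) :
    ∃ φ : (chainLang B).Formula Unit, ∀ (V : Type) (e : ℕ → Setoid V) (c : V → B), e 0 = ⊥ →
      Monotone e → ∀ x : Unit → V,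
        (@Formula.Realize (chainLang B) V (chainStructure e c) Unit φ x ↔
          ty e c s h (x ()) = τ) := by
  induction h with
  | zero => exact ⟨colourFormula τ (), fun V e c _ _ x => Iff.rfl⟩
  | succ h ih =>
    choose φ hφ using ih
    let body (σ : Ty B s h) (j : ℕ) : (chainLang B).Formula (Unit ⊕ Fin j) :=
      (Formula.iInf fun i : Fin j => levelFormula B (h + 1) (Sum.inl ()) (Sum.inr i) ⊓
        (φ σ).relabel fun _ => Sum.inr i) ⊓
      Formula.iInf fun i : {i : Fin j × Fin j // i.1 ≠ i.2} =>
        (levelFormula B h (Sum.inr i.1.1) (Sum.inr i.1.2)).not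
    let atLeast (σ : Ty B s h) (j : ℕ) : (chainLang B).Formula Unit := (body σ j).iExs (Fin j)
    have hat : ∀ (V : Type) (e : ℕ → Setoid V) (c : V → B), e 0 = ⊥ → Monotone e →
        ∀ (x : Unit → V) σ j, (@Formula.Realize (chainLang B) V (chainStructure e c) Unit
          (atLeast σ j) x ↔ (j : ℕ∞) ≤ (kids e c s h (x ()) σ).encard) := by
      intro V e c h0 hm x σ j
      let _ := chainStructure e c
      rw [natCast_le_encard_iff, Formula.realize_iExs]
      simp only [body, Formula.realize_inf, Formula.realize_iInf, Formula.realize_relabel,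
        hφ _ V e c h0 hm, Formula.realize_not, realize_levelFormula]
      constructor
      · rintro ⟨y, h1, h2⟩
        refine ⟨fun i => Quotient.mk (e h) (y i), fun i i' hii => ?_, fun i =>
          (mk_mem_kids_iff h0 hm).2 (h1 i)⟩
        by_contra hne
        exact h2 ⟨(i, i'), hne⟩ (mk_eq_iff_rel.1 hii)
      · rintro ⟨f, hinj, hf⟩
        refine ⟨fun i => (f i).out, fun i => hf i, fun i hi => i.2 (hinj ?_)⟩
        have := mk_eq_iff_rel.2 hi
        simpa using this
    let atom (σ : Ty B s h) (j : Fin (s h + 1)) : (chainLang B).Formula Unit :=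
      if (j : ℕ) ≤ τ σ then atLeast σ j else (atLeast σ j).not
    refine ⟨Formula.iInf fun σ => Formula.iInf (atom σ), fun V e c h0 hm x => ?_⟩
    let _ := chainStructure e c
    have hatom : ∀ σ j, (atom σ j).Realize x ↔
        (((j : ℕ) : ℕ∞) ≤ (kids e c s h (x ()) σ).encard ↔ (j : ℕ) ≤ τ σ) := by
      intro σ j
      simp only [atom]
      split_ifs with hj
      · rw [hat V e c h0 hm]; exact (iff_true_right hj).symm
      · rw [Formula.realize_not, hat V e c h0 hm]; exact (iff_false_right hj).symm
    simp only [Formula.realize_iInf, hatom]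
    exact (forall_congr' fun σ => trunc_eq_iff.symm).trans funext_iff.symm

end

/-- Elementarily equivalent structures satisfy the same universal closures. -/
theorem forall_realize_iff {L : FirstOrder.Language.{0, 0}} {M N : Type} [L.Structure M]
    [L.Structure N] (h : M ≅[L] N) {n : ℕ} (φ : L.Formula (Fin n)) :
    (∀ v : Fin n → M, φ.Realize v) ↔ ∀ v : Fin n → N, φ.Realize v := by
  have key : ∀ (K : Type) [L.Structure K], K ⊨ (Formula.iAlls (Fin n)
      (φ.relabel (Sum.inr : Fin n → Empty ⊕ Fin n)) : L.Sentence) ↔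
      ∀ v : Fin n → K, φ.Realize v := by
    intro K _
    rw [Sentence.Realize, Formula.realize_iAlls]
    simp only [Formula.realize_relabel, Sum.elim_comp_inr]
  rw [← key, ← key]
  exact elementarilyEquivalent_iff.1 h _

theorem exists_eq_chainStructure {N : Type} [inst : (chainLang B).Structure N] {d : ℕ}
    {e : ℕ → Setoid V} {c : V → B} [Finite B] (he : IsChainRel d e)
    (h : @ElementarilyEquivalent (chainLang B) V N (chainStructure e c) inst) :
    ∃ (e' : ℕ → Setoid N) (c' : N → B), IsChainRel d e' ∧ inst = chainStructure e' c' := by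
  let _ := chainStructure e c
  have tr : ∀ {n : ℕ} (φ : (chainLang B).Formula (Fin n)), (∀ v : Fin n → V, φ.Realize v) →
      ∀ v : Fin n → N, φ.Realize v := fun φ => (forall_realize_iff h φ).1
  let R (l : ℕ) (x y : N) : Prop := (levelFormula B l (0 : Fin 2) 1).Realize ![x, y]
  have hR : ∀ {n : ℕ} (l : ℕ) (i j : Fin n) (v : Fin n → N),
      (levelFormula B l i j).Realize v ↔ R l (v i) (v j) := by
    intro n l i j v
    refine iff_of_eq (congrArg (Structure.RelMap (L := chainLang B) (ChainSymbol.level l))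
      (funext fun k => ?_))
    fin_cases k <;> rfl
  have hrefl : ∀ l x, R l x x := fun l x => (hR _ _ _ _).1 <|
    tr (levelFormula B l (0 : Fin 1) 0) (fun v => (e l).refl _) ![x]
  have hsymm : ∀ l x y, R l x y → R l y x := fun l x y hxy => (hR _ _ _ ![x, y]).1 <|
    Formula.realize_imp.1 (tr ((levelFormula B l (0 : Fin 2) 1).imp (levelFormula B l (1 : Fin 2) 0))
      (fun v => Formula.realize_imp.2 fun hv => (e l).symm hv) ![x, y]) ((hR _ _ _ _).2 hxy)
  have htrans : ∀ l x y z, R l x y → R l y z → R l x z := fun l x y z hxy hyz =>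
    (hR _ _ _ ![x, y, z]).1 <| Formula.realize_imp.1 (Formula.realize_imp.1
      (tr ((levelFormula B l (0 : Fin 3) 1).imp ((levelFormula B l (1 : Fin 3) 2).imp
          (levelFormula B l (0 : Fin 3) 2)))
        (fun v => Formula.realize_imp.2 fun hv => Formula.realize_imp.2 fun hv' =>
          (e l).trans hv hv') ![x, y, z]) ((hR _ _ _ _).2 hxy)) ((hR _ _ _ _).2 hyz)
  have hmono : ∀ l k, l ≤ k → ∀ x y, R l x y → R k x y := fun l k hlk x y hxy =>
    (hR _ _ _ ![x, y]).1 <| Formula.realize_imp.1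
      (tr ((levelFormula B l (0 : Fin 2) 1).imp (levelFormula B k (0 : Fin 2) 1))
        (fun v => Formula.realize_imp.2 fun hv => he.mono hlk hv) ![x, y]) ((hR _ _ _ _).2 hxy)
  have htop : ∀ x y, R d x y := fun x y => (hR _ _ _ ![x, y]).1 <|
    tr (levelFormula B d (0 : Fin 2) 1) (fun v => he.all le_rfl _ _) ![x, y]
  have hbot : ∀ x y, R 0 x y → x = y := fun x y hxy =>
    Formula.realize_equal.1 <| Formula.realize_imp.1
      (tr ((levelFormula B 0 (0 : Fin 2) 1).imp (Term.equal (Term.var 0) (Term.var 1)))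
        (fun v => Formula.realize_imp.2 fun hv => Formula.realize_equal.2 <| by
          have : e 0 (v 0) (v 1) := hv
          rw [he.bot] at this
          exact this) ![x, y]) ((hR _ _ _ _).2 hxy)
  let C (b : B) (x : N) : Prop := (colourFormula b (0 : Fin 1)).Realize ![x]
  have hex : ∀ x, ∃ b, C b x := fun x => Formula.realize_iSup.1 <|
    tr (Formula.iSup fun b => colourFormula b (0 : Fin 1))
      (fun v => Formula.realize_iSup.2 ⟨c (v 0), rfl⟩) ![x]
  have huniq : ∀ b b' x, C b x → C b' x → b = b' := by
    intro b b' x hb hb'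
    by_contra hne
    exact Formula.realize_not.1 (Formula.realize_imp.1
      (tr ((colourFormula b (0 : Fin 1)).imp (colourFormula b' (0 : Fin 1)).not)
        (fun v => Formula.realize_imp.2 fun hv => Formula.realize_not.2 fun hv' =>
          hne (hv.symm.trans hv')) ![x]) hb) hb'
  choose c' hc' using hex
  refine ⟨fun l => ⟨R l, hrefl l, fun {x y} => hsymm l x y, fun {x y z} => htrans l x y z⟩, c',
    ⟨?_, fun l k hlk x y => hmono l k hlk x y, ?_⟩, ?_⟩
  · exact Setoid.ext fun x y => ⟨hbot x y, fun hxy => by cases hxy; exact hrefl 0 x⟩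
  · exact Setoid.ext fun x y => ⟨fun _ => trivial, fun _ => htop x y⟩
  · refine Structure.ext (funext fun n => funext fun f => f.elim) ?_
    funext n r v
    refine propext ?_
    cases r with
    | colour b =>
      change _ ↔ c' (v 0) = b
      have hC : Structure.RelMap (L := chainLang B) (ChainSymbol.colour b) v ↔ C b (v 0) := by
        refine iff_of_eq (congrArg (Structure.RelMap (L := chainLang B) (ChainSymbol.colour b))
          (funext fun k => ?_))
        fin_cases k
        rfl
      rw [hC]
      exact ⟨fun hb => huniq _ _ _ (hc' _) hb, fun hb => hb ▸ hc' _⟩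
    | level l =>
      change _ ↔ R l (v 0) (v 1)
      refine iff_of_eq (congrArg (Structure.RelMap (L := chainLang B) (ChainSymbol.level l))
        (funext fun k => ?_))
      fin_cases k <;> rfl

theorem preserves_of_elementaryEmbedding {V' : Type} [Finite B] {e : ℕ → Setoid V} {c : V → B}
    {e' : ℕ → Setoid V'} {c' : V' → B} (h0 : e 0 = ⊥) (hm : Monotone e) (h0' : e' 0 = ⊥)
    (hm' : Monotone e')
    (f : @ElementaryEmbedding (chainLang B) V V' (chainStructure e c) (chainStructure e' c')) :
    ∃ g : V → V', Function.Injective g ∧ (∀ l x y, e l x y ↔ e' l (g x) (g y)) ∧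
      (∀ x, c' (g x) = c x) ∧ ∀ s h x, ty e' c' s h (g x) = ty e c s h x := by
  let _ := chainStructure e c
  let _ := chainStructure e' c'
  refine ⟨f, f.injective, fun l x y => ?_, fun x => ?_, fun s h x => ?_⟩
  · exact (f.map_formula (levelFormula B l (0 : Fin 2) 1) ![x, y]).symm
  · exact (f.map_formula (colourFormula (c x) ()) fun _ => x).2 rfl
  · obtain ⟨φ, hφ⟩ := exists_formula_ty s h (ty e c s h x)
    exact (hφ V' e' c' h0' hm' _).1 <|
      (f.map_formula φ fun _ => x).2 ((hφ V e c h0 hm fun _ => x).2 rfl)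

/-- The downward Löwenheim–Skolem theorem for chains of equivalence relations. -/
theorem exists_chain_card_eq_of_le [Finite B] {d : ℕ} {e : ℕ → Setoid V} (c : V → B)
    (he : IsChainRel d e) {κ : Cardinal.{0}} (hκ : ℵ₀ ≤ κ) (hκV : κ ≤ #V) :
    ∃ (V' : Type) (e' : ℕ → Setoid V') (c' : V' → B), #V' = κ ∧ IsChainRel d e' ∧
      ∃ g : V' → V, Function.Injective g ∧ (∀ l x y, e' l x y ↔ e l (g x) (g y)) ∧
        (∀ x, c (g x) = c' x) ∧ ∀ s h x, ty e c s h (g x) = ty e' c' s h x := by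
  let _ := chainStructure e c
  obtain ⟨⟨N, inst⟩, ⟨f⟩, hN⟩ := exists_elementaryEmbedding_card_eq_of_le (chainLang B) V κ hκ
    (by simpa using card_chainLang_le.trans hκ) (by simpa using hκV)
  change @ElementaryEmbedding (chainLang B) N V inst (chainStructure e c) at f
  obtain ⟨e', c', he', rfl⟩ := exists_eq_chainStructure he f.elementarilyEquivalent.symm
  exact ⟨N, e', c', hN, he',
    preserves_of_elementaryEmbedding he'.bot he'.mono he.bot he.mono f⟩

/-- The upward Löwenheim–Skolem theorem for chains of equivalence relations. -/
theorem exists_chain_card_eq_of_ge [Finite B] [Infinite V] {d : ℕ} {e : ℕ → Setoid V} (c : V → B)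
    (he : IsChainRel d e) {κ : Cardinal.{0}} (hκV : #V ≤ κ) :
    ∃ (V' : Type) (e' : ℕ → Setoid V') (c' : V' → B), #V' = κ ∧ IsChainRel d e' ∧
      ∃ g : V → V', Function.Injective g ∧ (∀ l x y, e l x y ↔ e' l (g x) (g y)) ∧
        (∀ x, c' (g x) = c x) ∧ ∀ s h x, ty e' c' s h (g x) = ty e c s h x := by
  let _ := chainStructure e c
  obtain ⟨⟨N, inst⟩, ⟨f⟩, hN⟩ := exists_elementaryEmbedding_card_eq_of_ge (chainLang B) V κ
    (by simpa using card_chainLang_le.trans ((aleph0_le_mk V).trans hκV)) (by simpa using hκV)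
  change @ElementaryEmbedding (chainLang B) V N (chainStructure e c) inst at f
  obtain ⟨e', c', he', rfl⟩ := exists_eq_chainStructure he f.elementarilyEquivalent
  exact ⟨N, e', c', hN, he',
    preserves_of_elementaryEmbedding he.bot he.mono he'.bot he'.mono f⟩

end FirstOrder

section Bounds

theorem tower_mono (h : ℕ) : Monotone (tower h) := by
  induction h with
  | zero => exact monotone_id
  | succ h ih => exact fun x y hxy => Nat.pow_le_pow_right two_pos (ih hxy)

theorem le_tower (h x : ℕ) : x ≤ tower h x := by
  induction h with
  | zero => exact le_rfl
  | succ h ih => exact ih.trans Nat.lt_two_pow_self.le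

theorem tower_add_le (h : ℕ) {x y : ℕ} (hx : 1 ≤ x) (hy : 1 ≤ y) :
    tower h x + tower h y ≤ tower h (x + y) := by
  induction h with
  | zero => exact le_rfl
  | succ h ih =>
    have h1 : 1 ≤ tower h x := hx.trans (le_tower h x)
    have h2 : 1 ≤ tower h y := hy.trans (le_tower h y)
    have h3 := Nat.pow_le_pow_right (n := 2) two_pos h1
    have h4 := Nat.pow_le_pow_right (n := 2) two_pos h2
    refine le_trans ?_ (Nat.pow_le_pow_right two_pos ih)
    rw [pow_add]
    change 2 ^ tower h x + 2 ^ tower h y ≤ _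
    nlinarith

theorem tower_succ_mul_le (h : ℕ) {x y : ℕ} (hx : 1 ≤ x) (hy : 1 ≤ y) :
    tower (h + 1) x * tower (h + 1) y ≤ tower (h + 1) (x + y) := by
  change 2 ^ tower h x * 2 ^ tower h y ≤ _
  rw [← pow_add]
  exact Nat.pow_le_pow_right two_pos (tower_add_le h hx hy)

theorem mul_le_tower_succ {h x y a b : ℕ} (hx : 1 ≤ x) (hy : 1 ≤ y) (ha : a ≤ tower (h + 1) x)
    (hb : b ≤ tower (h + 1) y) : a * b ≤ tower (h + 1) (x + y) :=
  (Nat.mul_le_mul ha hb).trans (tower_succ_mul_le h hx hy)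

/-- The argument of the tower function in bounds for quantifier rank `m` and `2 ^ q` colours. -/
def rankArg (m q : ℕ) : ℕ := (m + 1) * (m + 1 + q)

theorem rankArg_pos (m q : ℕ) : 1 ≤ rankArg m q := Nat.mul_pos (by omega) (by omega)

theorem rankArg_succ (m q : ℕ) : rankArg (m + 1) q = rankArg m (q + 1) + (m + 2 + q) := by
  simp only [rankArg]; ring

theorem add_le_rankArg (m q : ℕ) : m + 1 + q ≤ rankArg m q :=
  Nat.le_mul_of_pos_left _ (by omega)

theorem monotone_rankArg (q : ℕ) : Monotone fun m => rankArg m q :=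
  fun _ _ h => Nat.mul_le_mul (by omega) (by omega)

theorem succ_le_tower_rankArg (h m q : ℕ) : m + 1 ≤ tower h (rankArg m q) :=
  ((Nat.le_add_right _ q).trans (add_le_rankArg m q)).trans (le_tower _ _)

theorem thr_zero_le (m q : ℕ) : thr m q 0 ≤ 2 ^ rankArg m q := by
  induction m generalizing q with
  | zero => exact Nat.le_self_pow (Nat.one_le_iff_ne_zero.1 (rankArg_pos 0 q)) 2
  | succ m ih =>
    rw [rankArg_succ, pow_add]
    exact Nat.mul_le_mul (ih _) (Nat.pow_le_pow_right two_pos (by omega))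

theorem thr_le_of_numTy_le {h k : ℕ}
    (hk : ∀ m q, numTy (thr m q) q h ≤ 2 ^ tower h (k * rankArg m q)) (hk1 : 1 ≤ k) (m q : ℕ) :
    thr m q h ≤ 2 ^ ((m + 1) * tower h (k * rankArg m q)) := by
  induction m generalizing q with
  | zero =>
    have h1 := (Nat.mul_pos hk1 (rankArg_pos 0 q)).trans_le (le_tower h _)
    exact Nat.le_self_pow (by omega) 2
  | succ m ih =>
    have h1 : tower h (k * rankArg m (q + 1)) ≤ tower h (k * rankArg (m + 1) q) :=
      tower_mono h (Nat.mul_le_mul_left _ (by rw [rankArg_succ]; omega))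
    refine (Nat.mul_le_mul (ih (q + 1)) (hk m (q + 1))).trans ?_
    rw [← pow_add]
    exact Nat.pow_le_pow_right two_pos (by nlinarith)

theorem exists_thr_le_tower (h : ℕ) : ∃ k, 1 ≤ k ∧ ∀ m q,
    thr m q h ≤ tower (h + 1) (k * rankArg m q) ∧
      numTy (thr m q) q h ≤ tower (h + 1) (k * rankArg m q) := by
  induction h with
  | zero =>
    refine ⟨1, le_rfl, fun m q => ?_⟩
    rw [one_mul]
    exact ⟨thr_zero_le m q, Nat.pow_le_pow_right two_pos
      ((Nat.le_add_left _ _).trans (add_le_rankArg m q))⟩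
  | succ h ih =>
    obtain ⟨k, hk, hle⟩ := ih
    have hpos : ∀ m q, 1 ≤ k * rankArg m q := fun m q => Nat.mul_pos hk (rankArg_pos m q)
    have hnum : ∀ m q, numTy (thr m q) q (h + 1) ≤ 2 ^ tower (h + 1) (2 * k * rankArg m q) := by
      intro m q
      refine (Nat.pow_le_pow_left (Nat.succ_le_of_lt Nat.lt_two_pow_self) _).trans ?_
      rw [← pow_mul]
      refine Nat.pow_le_pow_right two_pos ?_
      rw [show 2 * k * rankArg m q = k * rankArg m q + k * rankArg m q by ring]
      exact mul_le_tower_succ (hpos m q) (hpos m q) (hle m q).1 (hle m q).2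
    refine ⟨2 * k + 1, by omega, fun m q => ⟨?_, (hnum m q).trans ?_⟩⟩
    · refine (thr_le_of_numTy_le hnum (by omega) m q).trans ?_
      refine Nat.pow_le_pow_right two_pos ?_
      rw [show (2 * k + 1) * rankArg m q = rankArg m q + 2 * k * rankArg m q by ring]
      exact mul_le_tower_succ (rankArg_pos m q) (Nat.mul_pos (by omega) (rankArg_pos m q))
        (succ_le_tower_rankArg _ m q) le_rfl
    · exact tower_mono (h + 2) (Nat.mul_le_mul_right _ (by omega))

theorem exists_kernelBound_le_tower (h : ℕ) : ∃ k, 1 ≤ k ∧ ∀ m q,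
    kernelBound (thr m q) q h ≤ tower (h + 1) (k * rankArg m q) := by
  induction h with
  | zero => exact ⟨1, le_rfl, fun m q => Nat.one_le_two_pow⟩
  | succ h ih =>
    obtain ⟨k, hk, hle⟩ := ih
    obtain ⟨k', hk', hle'⟩ := exists_thr_le_tower h
    refine ⟨k' + (k' + k), by omega, fun m q => le_trans ?_ Nat.lt_two_pow_self.le⟩
    have hpos := rankArg_pos m q
    rw [add_mul, add_mul]
    refine mul_le_tower_succ (by nlinarith) (by nlinarith) (hle' m q).2 ?_
    exact mul_le_tower_succ (by nlinarith) (by nlinarith) (hle' m q).1 (hle m q)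

/-- The witness function for the Löwenheim–Skolem property. -/
def scaleFun (q d m : ℕ) : ℕ :=
  ∑ i ∈ Finset.range (m + 1), ∑ j ∈ Finset.range (i + 1), kernelBound (thr j q) q d

theorem one_le_kernelBound_thr (m q h : ℕ) : 1 ≤ kernelBound (thr m q) q h :=
  monotone_kernelBound (fun h => (Nat.le_succ 1).trans (two_le_thr m q h)) q (Nat.zero_le h)

theorem add_kernelBound_le_scaleFun {q d m j : ℕ} (hj : j ≤ m + 1) :
    scaleFun q d m + kernelBound (thr j q) q d ≤ scaleFun q d (m + 1) := by
  rw [scaleFun, scaleFun, Finset.sum_range_succ _ (m + 1)]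
  exact Nat.add_le_add_left (Finset.single_le_sum
    (f := fun j => kernelBound (thr j q) q d) (fun _ _ => Nat.zero_le _)
    (Finset.mem_range.2 (Nat.lt_succ_of_le hj))) _

theorem strictMono_scaleFun (q d : ℕ) : StrictMono (scaleFun q d) :=
  strictMono_nat_of_lt_succ fun _ =>
    (Nat.lt_add_of_pos_right (one_le_kernelBound_thr 0 q d)).trans_le
      (add_kernelBound_le_scaleFun (Nat.zero_le _))

theorem kernelBound_le_scaleFun (q d m : ℕ) : kernelBound (thr m q) q d ≤ scaleFun q d m := by
  cases m with
  | zero => simp [scaleFun]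
  | succ m => exact (Nat.le_add_left _ _).trans (add_kernelBound_le_scaleFun le_rfl)

theorem exists_scaleFun_le_tower (d : ℕ) :
    ∃ k, ∀ q n, scaleFun q d n ≤ tower (d + 1) (k * rankArg n q) := by
  obtain ⟨k, hk, hle⟩ := exists_kernelBound_le_tower d
  refine ⟨1 + (1 + k), fun q n => ?_⟩
  have hpos := rankArg_pos n q
  have h1 : scaleFun q d n ≤ (n + 1) * ((n + 1) * tower (d + 1) (k * rankArg n q)) := by
    refine (Finset.sum_le_card_nsmul _ _ ((n + 1) * tower (d + 1) (k * rankArg n q)) ?_).trans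
      (by simp)
    intro i hi
    rw [Finset.mem_range] at hi
    refine (Finset.sum_le_card_nsmul _ _ (tower (d + 1) (k * rankArg n q)) ?_).trans ?_
    · intro j hj
      rw [Finset.mem_range] at hj
      exact (hle j q).trans (tower_mono _ (Nat.mul_le_mul_left _
        (monotone_rankArg q (by omega : j ≤ n))))
    · rw [Finset.card_range, smul_eq_mul]
      exact Nat.mul_le_mul_right _ (by omega)
  refine h1.trans ?_
  have h2 := succ_le_tower_rankArg (d + 1) n q
  rw [show (1 + (1 + k)) * rankArg n q = rankArg n q + (rankArg n q + k * rankArg n q) by ring]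
  exact mul_le_tower_succ hpos (by nlinarith) h2
    (mul_le_tower_succ hpos (Nat.mul_pos hk hpos) h2 le_rfl)

end Bounds

section Witness

variable {V B : Type} {e : ℕ → Setoid V} {d q : ℕ}

theorem exists_notMem_of_lt_mk {N : ℕ} (h : (N : Cardinal) < #V) (Y : Finset V)
    (hY : Y.card ≤ N) : ∃ v, v ∉ Y := by
  by_contra! hcon
  have h1 : #V ≤ #Y := Cardinal.mk_le_of_injective (f := fun v => (⟨v, hcon v⟩ : Y))
    fun _ _ h => congrArg Subtype.val h
  rw [Cardinal.mk_coe_finset] at h1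
  exact absurd (h.trans_le (h1.trans (Nat.cast_le.2 hY))) (lt_irrefl _)

theorem isChainRel_comap (he : IsChainRel d e) {U : Type} {g : U → V}
    (hg : Function.Injective g) : IsChainRel d fun l => (e l).comap g := by
  refine ⟨?_, fun k l hkl a b h => he.mono hkl h, ?_⟩
  · refine Setoid.ext fun a b => ⟨fun h => ?_, fun h => ?_⟩
    · have h1 : e 0 (g a) (g b) := h
      rw [he.bot] at h1
      exact hg h1
    · obtain rfl : a = b := h
      exact (e 0).refl _
  · exact Setoid.ext fun a b => ⟨fun _ => trivial, fun _ => he.all le_rfl _ _⟩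

/-- In a sufficiently large chain, a small good set extends to a good set whose size lies in a
prescribed scale. -/
theorem IsGood.exists_superset_scaleFun [Finite B] (hB : Nat.card B = 2 ^ q)
    (he : IsChainRel d e) {c : V → B} {m n : ℕ} (hmn : m ≤ n + 1)
    (hV : (scaleFun q d (n + 1) : Cardinal) < #V) {Y₀ : Finset V}
    (hY₀ : IsGood e c (thr m q) d (Y₀ : Set V)) (hne : Y₀.Nonempty)
    (hcard : Y₀.card ≤ scaleFun q d (n + 1)) :
    ∃ Y : Finset V, Y₀ ⊆ Y ∧ IsGood e c (thr m q) d (Y : Set V) ∧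
      inScale (scaleFun q d) n #Y := by
  obtain ⟨Y, hsub, hgood, hle, hlt⟩ := hY₀.exists_superset hB he
    (fun h => (Nat.le_succ 1).trans (two_le_thr m q h)) (exists_notMem_of_lt_mk hV) hne hcard
  have h1 := add_kernelBound_le_scaleFun (q := q) (d := d) hmn
  refine ⟨Y, hsub, hgood, .inl ⟨n, rfl, ?_⟩⟩
  rw [Cardinal.mk_coe_finset]
  exact ⟨Nat.cast_lt.2 (by omega), Nat.cast_le.2 hle⟩

end Witness

section ColGraph

variable {V A : Type} {r p d q : ℕ} {e : ℕ → Setoid V} {c : V → A} {dec : A → Fin r × Fin p}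
  {S : Set (Fin r × Fin r × ℕ)} {hS : ∀ i j l, (i, j, l) ∈ S ↔ (j, i, l) ∈ S}

theorem msoEquiv_colGraph_comap [Finite A] (hA : Nat.card A = 2 ^ q) (he : IsChainRel d e)
    {m : ℕ} {Y : Finset V} (hY : IsGood e c (thr m q) d (Y : Set V)) (y : Y) :
    MStr.MSOEquiv m
      (colGraph dec hS (fun l => (e l).comap (Subtype.val : Y → V)) fun u => c u.1).toStr
      (colGraph dec hS e c).toStr := by
  have he' := isChainRel_comap (U := Y) he Subtype.val_injective
  refine msoEquiv_colGraph hA he' he (u := y) (u' := y.1) ?_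
  refine ty_eq_of_isGood_range he.bot he.mono he'.bot he'.mono (fun _ _ _ => Iff.rfl) ?_ le_rfl y
  rwa [Subtype.range_coe]

theorem exists_le_colGraph [Finite A] [Nonempty V] (hA : Nat.card A = 2 ^ q)
    (he : IsChainRel d e) (n : ℕ) (hV : (scaleFun q d (n + 1) : Cardinal) < #V) :
    ∃ H ∈ TM r p d, PGraph.Emb H (colGraph dec hS e c) ∧ inScale (scaleFun q d) n #H.V ∧
      MStr.MSOEquiv n H.toStr (colGraph dec hS e c).toStr := by
  obtain ⟨K, hne, -, hcard, hgood⟩ := exists_kernel (c := c) hA he.bot he.mono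
    (fun h => (Nat.le_succ 1).trans (two_le_thr n q h)) d (Classical.arbitrary V)
  obtain ⟨Y, hsub, hgood, hscale⟩ := hgood.exists_superset_scaleFun hA he n.le_succ hV hne
    (hcard.trans ((kernelBound_le_scaleFun q d n).trans
      ((strictMono_scaleFun q d).monotone n.le_succ)))
  obtain ⟨y, hy⟩ := hne.mono hsub
  have : Nonempty Y := ⟨⟨y, hy⟩⟩
  exact ⟨colGraph dec hS (fun l => (e l).comap (Subtype.val : Y → V)) fun u => c u.1,
    chainGraph_mem_TM (isChainRel_comap he Subtype.val_injective) _ _ _ _,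
    colGraph_emb Subtype.val_injective (fun _ _ _ => Iff.rfl) fun _ => rfl, hscale,
    msoEquiv_colGraph_comap hA he hgood ⟨y, hy⟩⟩

/-- The copied structures at a level with many siblings of the same type. -/
theorem exists_pump [Finite A] [Nonempty V] (hA : Nat.card A = 2 ^ q) (he : IsChainRel d e)
    (m : ℕ) (hV : (scaleFun q d m : Cardinal) < #V) :
    ∃ n < d, ∃ w, ∀ κ : Type, ∀ h, ∀ a : Pump e n w κ,
      ty (pumpRel e n w κ) (fun a => c a.1.1) (thr m q) h a = ty e c (thr m q) h a.1.1 := by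
  have hs : ∀ h, 1 ≤ thr m q h := fun h => (Nat.le_succ 1).trans (two_le_thr m q h)
  obtain ⟨n, hn, x, τ, hle⟩ := exists_le_encard_kids (c := c) hA he hs fun Y hY =>
    exists_notMem_of_lt_mk hV Y (hY.trans (kernelBound_le_scaleFun q d m))
  obtain ⟨t, ht⟩ : (kids e c (thr m q) n x τ).Nonempty := by
    rw [← Set.one_le_encard_iff_nonempty]
    exact le_trans (by exact_mod_cast hs n) hle
  induction t using Quotient.inductionOn with
  | h w =>
    have h1 := ht
    rw [mk_mem_kids_iff he.bot he.mono] at h1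
    obtain ⟨h1, rfl⟩ := h1
    rw [kids_congr h1] at hle
    exact ⟨n, hn, w, fun κ h a => ty_pumpRel he hn hle h a⟩

theorem exists_ge_colGraph_of_lt [Finite A] [Nonempty V] (hA : Nat.card A = 2 ^ q)
    (he : IsChainRel d e) {m n : ℕ} (hmn : m < n) (hlt : (scaleFun q d m : Cardinal) < #V)
    (hle : #V ≤ scaleFun q d (m + 1)) :
    ∃ H ∈ TM r p d, PGraph.Emb (colGraph dec hS e c) H ∧ inScale (scaleFun q d) n #H.V ∧
      MStr.MSOEquiv m H.toStr (colGraph dec hS e c).toStr := by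
  classical
  have : Finite V := Cardinal.mk_lt_aleph0_iff.1 (hle.trans_lt (Cardinal.natCast_lt_aleph0))
  have := Fintype.ofFinite V
  obtain ⟨k, hk, w, hty⟩ := exists_pump (c := c) hA he m hlt
  have he' := isChainRel_pumpRel (w := w) (κ := ℕ) he hk
  have hgood : IsGood (pumpRel e k w ℕ) (fun a => c a.1.1) (thr m q) d
      ((Finset.univ.image (toPump e k w ℕ) : Finset _) : Set (Pump e k w ℕ)) := by
    rw [Finset.coe_image, Finset.coe_univ, Set.image_univ]
    exact isGood_range_of_ty_eq he'.bot he'.mono he.bot he.mono pumpRel_toPump d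
      fun h x => (hty ℕ h (toPump e k w ℕ x)).symm
  have hinj : Function.Injective fun i : ℕ => (⟨(w, some i), .inr ((e k).refl w)⟩ : Pump e k w ℕ) :=
    fun i j hij => Option.some_injective _ (congrArg (fun z : Pump e k w ℕ => z.1.2) hij)
  have hcard : (Finset.univ.image (toPump e k w ℕ)).card ≤ scaleFun q d (n + 1) := by
    refine Finset.card_image_le.trans ?_
    rw [Cardinal.mk_fintype, Nat.cast_le] at hle
    exact hle.trans ((strictMono_scaleFun q d).monotone (by omega))
  obtain ⟨Y, hsub, hY, hscale⟩ := hgood.exists_superset_scaleFun hA he' (m := m) (n := n)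
    (by omega)
    (Cardinal.natCast_lt_aleph0.trans_le (Cardinal.mk_nat ▸ Cardinal.mk_le_of_injective hinj))
    (Finset.univ_nonempty.image _) hcard
  have hmem : ∀ x, toPump e k w ℕ x ∈ Y := fun x =>
    hsub (Finset.mem_image_of_mem _ (Finset.mem_univ x))
  let y : Y := ⟨_, hmem (Classical.arbitrary V)⟩
  have : Nonempty Y := ⟨y⟩
  refine ⟨colGraph dec hS (fun l => (pumpRel e k w ℕ l).comap (Subtype.val : Y → _))
      fun u => c u.1.1.1,
    chainGraph_mem_TM (isChainRel_comap he' Subtype.val_injective) _ _ _ _,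
    colGraph_emb (f := fun x => ⟨_, hmem x⟩)
      (fun _ _ h => toPump_injective (congrArg Subtype.val h)) pumpRel_toPump fun _ => rfl,
    hscale, fun φ hφ hm => ?_⟩
  refine (msoEquiv_colGraph_comap hA he' hY y φ hφ hm).trans ?_
  exact msoEquiv_colGraph hA he' he (hty ℕ d y) φ hφ hm

theorem mk_pump [Finite V] {k : ℕ} {w : V} {κ : Type} (hκ : ℵ₀ ≤ #κ) : #(Pump e k w κ) = #κ := by
  refine le_antisymm ?_ ?_
  · refine (Cardinal.mk_subtype_le _).trans ?_
    have : Infinite κ := Cardinal.infinite_iff.2 hκ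
    rw [Cardinal.mk_prod, Cardinal.lift_id, Cardinal.lift_id, Cardinal.mk_option,
      Cardinal.add_one_eq hκ]
    exact Cardinal.mul_le_of_le hκ ((Cardinal.lt_aleph0_of_finite V).le.trans hκ) le_rfl
  · exact Cardinal.mk_le_of_injective
      (f := fun i => (⟨(w, some i), .inr ((e k).refl w)⟩ : Pump e k w κ))
      fun i j hij => Option.some_injective _ (congrArg (fun z : Pump e k w κ => z.1.2) hij)

theorem exists_mk_eq_colGraph [Finite A] [Nonempty V] [Finite V] (hA : Nat.card A = 2 ^ q)
    (he : IsChainRel d e) {m : ℕ} (hlt : (scaleFun q d m : Cardinal) < #V) {κ : Cardinal}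
    (hκ : ℵ₀ ≤ κ) :
    ∃ H ∈ TM r p d, PGraph.Emb (colGraph dec hS e c) H ∧ #H.V = κ ∧
      MStr.MSOEquiv m H.toStr (colGraph dec hS e c).toStr := by
  obtain ⟨k, hk, w, hty⟩ := exists_pump (c := c) hA he m hlt
  have he' := isChainRel_pumpRel (w := w) (κ := κ.out) he hk
  rw [← Cardinal.mk_out κ] at hκ
  have x := Classical.arbitrary V
  have : Nonempty (Pump e k w κ.out) := ⟨toPump e k w κ.out x⟩
  exact ⟨colGraph dec hS (pumpRel e k w κ.out) fun a => c a.1.1,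
    chainGraph_mem_TM he' _ _ _ _,
    colGraph_emb toPump_injective pumpRel_toPump fun _ => rfl,
    (mk_pump hκ).trans (Cardinal.mk_out κ),
    msoEquiv_colGraph hA he' he (hty κ.out d (toPump e k w κ.out x))⟩

theorem msoEqv_colGraph [Finite A] (hA : Nat.card A = 2 ^ q) (he : IsChainRel d e) {V' : Type}
    {e' : ℕ → Setoid V'} {c' : V' → A} (he' : IsChainRel d e') {x : V} {x' : V'}
    (hty : ∀ s, ty e c s d x = ty e' c' s d x') :
    (colGraph dec hS e c).MSOEqv (colGraph dec hS e' c') := fun φ hφ =>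
  msoEquiv_colGraph hA he he' (hty (thr φ.qr q)) φ hφ le_rfl

theorem exists_le_msoEqv_colGraph [Finite A] (hA : Nat.card A = 2 ^ q)
    (he : IsChainRel d e) {κ : Cardinal} (hκ : ℵ₀ ≤ κ) (hκV : κ ≤ #V) :
    ∃ H ∈ TM r p d, PGraph.Emb H (colGraph dec hS e c) ∧ #H.V = κ ∧
      PGraph.MSOEqv H (colGraph dec hS e c) := by
  obtain ⟨V', e', c', hcard, he', g, hg, hge, hgc, hty⟩ :=
    exists_chain_card_eq_of_le c he hκ hκV
  have : Infinite V' := Cardinal.infinite_iff.2 (hcard ▸ hκ)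
  exact ⟨colGraph dec hS e' c', chainGraph_mem_TM he' _ _ _ _, colGraph_emb hg hge hgc, hcard,
    msoEqv_colGraph hA he' he fun s => (hty s d (Classical.arbitrary V')).symm⟩

theorem exists_ge_msoEqv_colGraph [Finite A] [Infinite V] (hA : Nat.card A = 2 ^ q)
    (he : IsChainRel d e) {κ : Cardinal} (hκV : #V ≤ κ) :
    ∃ H ∈ TM r p d, PGraph.Emb (colGraph dec hS e c) H ∧ #H.V = κ ∧
      PGraph.MSOEqv H (colGraph dec hS e c) := by
  obtain ⟨V', e', c', hcard, he', g, hg, hge, hgc, hty⟩ := exists_chain_card_eq_of_ge c he hκV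
  have : Nonempty V' := ⟨g (Classical.arbitrary V)⟩
  exact ⟨colGraph dec hS e' c', chainGraph_mem_TM he' _ _ _ _, colGraph_emb hg hge hgc, hcard,
    msoEqv_colGraph hA he' he fun s => hty s d (Classical.arbitrary V)⟩

end ColGraph

theorem PGraph.Emb.refl {p : ℕ} (G : PGraph p) : G.Emb G :=
  ⟨id, Function.injective_id, fun _ _ => Iff.rfl, fun _ => rfl⟩

/-- The extended MSO-Löwenheim–Skolem property for `TM(r,p,d)`, with a
`(d+1)`-fold exponential witness function `f`: for every graph `G` of the class
at scale `η` of `f` and every cardinal `λ`, downward (`λ ≤ η`) there is an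
induced labeled subgraph of `G` in the class at scale `λ` that is
`MSO[λ]`-equivalent to `G` if `λ` is finite, resp. of size `λ` and
MSO-equivalent to `G` if `λ` is infinite; and upward (`λ ≥ η`) there is a graph
in the class containing `G` as an induced labeled subgraph, at scale `λ` and
`MSO[η]`-equivalent to `G` if `η` is finite, resp. of size `λ` and
MSO-equivalent to `G` if `η` is infinite. -/
theorem stmt18 (r p d : ℕ) :
    ∃ (c : ℕ) (f : ℕ → ℕ), StrictMono f ∧
      (∀ n, f n ≤ tower (d + 1) (c * (n + 1) * (n + 1 + Nat.clog 2 r + Nat.clog 2 p))) ∧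
      ∀ G ∈ TM r p d, ∀ η : Cardinal, inScale f η (Cardinal.mk G.V) →
        ∀ lam : Cardinal,
          (lam ≤ η →
            (∀ nl : ℕ, lam = (nl : Cardinal) →
              ∃ H ∈ TM r p d, PGraph.Emb H G ∧ inScale f lam (Cardinal.mk H.V) ∧
                MStr.MSOEquiv nl H.toStr G.toStr) ∧
            (Cardinal.aleph0 ≤ lam →
              ∃ H ∈ TM r p d, PGraph.Emb H G ∧ Cardinal.mk H.V = lam ∧
                PGraph.MSOEqv H G)) ∧
          (η ≤ lam →
            (∀ ne : ℕ, η = (ne : Cardinal) →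
              ∃ H ∈ TM r p d, PGraph.Emb G H ∧ inScale f lam (Cardinal.mk H.V) ∧
                MStr.MSOEquiv ne H.toStr G.toStr) ∧
            (Cardinal.aleph0 ≤ η →
              ∃ H ∈ TM r p d, PGraph.Emb G H ∧ Cardinal.mk H.V = lam ∧
                PGraph.MSOEqv H G)) := by
  obtain ⟨k, hk⟩ := exists_scaleFun_le_tower d
  refine ⟨k, scaleFun (Nat.clog 2 r + Nat.clog 2 p) d, strictMono_scaleFun _ d, fun n => ?_, ?_⟩
  · have h := hk (Nat.clog 2 r + Nat.clog 2 p) n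
    rwa [rankArg, ← mul_assoc, ← add_assoc] at h
  intro G hG η hη lam
  have hGmem := hG
  obtain ⟨V, _, e, c, dec, S, hS, he, rfl⟩ := exists_eq_colGraph hG
  have hA := Nat.card_fin (2 ^ (Nat.clog 2 r + Nat.clog 2 p))
  change inScale _ η #V at hη
  have hmono := (strictMono_scaleFun (Nat.clog 2 r + Nat.clog 2 p) d).monotone
  refine ⟨fun hle => ⟨?_, fun hlam => ?_⟩, fun hle => ⟨?_, fun hinf => ?_⟩⟩
  · rintro nl rfl
    rcases hle.eq_or_lt with rfl | hlt
    · exact ⟨_, hGmem, .refl _, hη, fun _ _ _ => Iff.rfl⟩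
    refine exists_le_colGraph hA he nl ?_
    rcases hη with ⟨i, rfl, h1, -⟩ | ⟨h1, h2⟩
    · exact (Nat.cast_le.2 (hmono (Nat.succ_le_of_lt (Nat.cast_lt.1 hlt)))).trans_lt h1
    · exact Cardinal.natCast_lt_aleph0.trans_le (h2 ▸ h1)
  · rcases hη with ⟨i, rfl, -⟩ | ⟨-, h2⟩
    · exact absurd (hlam.trans hle) (not_le.2 Cardinal.natCast_lt_aleph0)
    · exact exists_le_msoEqv_colGraph hA he hlam (h2 ▸ hle)
  · rintro ne rfl
    rcases hle.eq_or_lt with rfl | hlt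
    · exact ⟨_, hGmem, .refl _, hη, fun _ _ _ => Iff.rfl⟩
    rcases hη with ⟨i, hi, h1, h2⟩ | ⟨h1, -⟩
    · obtain rfl := Nat.cast_injective hi
      rcases lt_or_ge lam ℵ₀ with h3 | h3
      · obtain ⟨nl, rfl⟩ := Cardinal.lt_aleph0.1 h3
        exact exists_ge_colGraph_of_lt hA he (Nat.cast_lt.1 hlt) h1 h2
      · have : Finite V := Cardinal.mk_lt_aleph0_iff.1 (h2.trans_lt Cardinal.natCast_lt_aleph0)
        obtain ⟨H, hH, hemb, hcard, heqv⟩ := exists_mk_eq_colGraph hA he h1 h3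
        exact ⟨H, hH, hemb, .inr ⟨h3, hcard⟩, heqv⟩
    · exact absurd h1 (not_le.2 Cardinal.natCast_lt_aleph0)
  · rcases hη with ⟨i, rfl, -⟩ | ⟨-, h2⟩
    · exact absurd hinf (not_le.2 Cardinal.natCast_lt_aleph0)
    · have : Infinite V := Cardinal.infinite_iff.2 (h2 ▸ hinf)
      exact exists_ge_msoEqv_colGraph hA he (h2 ▸ hle)
end
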